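/- arXiv:1511.02162 — 4 statements merged into one kernel-verified Lean document; each statement's English description precedes it below -/
import Mathlib

section
/- Let −α/2 < β < 1 and define u : ℝ^N → ℝ by u(x) = (1−|x|²)^{−β} for |x| < 1 and u(x) = 0 for |x| ≥ 1. Then for every x ∈ B the principal-value limit defining Δ^{α/2}u(x) exists, and there exist constants 0 < c₁ ≤ c₂, depending only on N, α and β, such that for every x ∈ B the value Δ^{α/2}u(x) lies between c₁(α+2β−2)(1−|x|²)^{−(α+β)} and c₂(α+2β−2)(1−|x|²)^{−(α+β)}; that is, c₁(α+2β−2)(1−|x|²)^{−(α+β)} ≤ Δ^{α/2}u(x) ≤ c₂(α+2β−2)(1−|x|²)^{−(α+β)} if α+2β−2 ≥ 0, and the reversed inequalities hold if α+2β−2 ≤ 0. -/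
open MeasureTheory Real Filter Topology Metric Set

noncomputable section

abbrev EN (N : ℕ) := EuclideanSpace ℝ (Fin N)

/-- The normalizing constant `c_{N,α}` of the fractional Laplacian. -/
def fracLapCoeff (N : ℕ) (α : ℝ) : ℝ :=
  2 ^ α * Real.pi ^ (-(N : ℝ) / 2) * Real.Gamma (((N : ℝ) + α) / 2) / |Real.Gamma (-α / 2)|

/-- `HasFracLap N α u x L` means the principal-value limit defining `Δ^{α/2} u (x)` exists
and equals `L`. -/
def HasFracLap (N : ℕ) (α : ℝ) (u : EN N → ℝ) (x : EN N) (L : ℝ) : Prop :=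
  Tendsto (fun ε : ℝ =>
      fracLapCoeff N α * ∫ y in {y : EN N | ε < dist y x}, (u y - u x) / dist y x ^ ((N : ℝ) + α))
    (𝓝[>] (0 : ℝ)) (𝓝 L)

/-- The value of the fractional Laplacian at `x` (junk value `0` where the limit fails). -/
def fracLap (N : ℕ) (α : ℝ) (u : EN N → ℝ) (x : EN N) : ℝ :=
  haveI := Classical.propDecidable (∃ L, HasFracLap N α u x L)
  if h : ∃ L, HasFracLap N α u x L then h.choose else 0

/-- The weighted space `𝓛_α`. -/
def memLalpha (N : ℕ) (α : ℝ) (u : EN N → ℝ) : Prop :=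
  Integrable (fun y : EN N => u y * (1 + ‖y‖) ^ (-((N : ℝ) + α)))

/-- `δ(x) = 1 - |x|` on the unit ball, `0` outside. -/
def delta1 {N : ℕ} (x : EN N) : ℝ := if ‖x‖ < 1 then 1 - ‖x‖ else 0

/-- The constant `κ_{N,α}`. -/
def greenCoeff (N : ℕ) (α : ℝ) : ℝ :=
  Real.Gamma ((N : ℝ) / 2) / (2 ^ α * Real.pi ^ ((N : ℝ) / 2) * Real.Gamma (α / 2) ^ 2)

/-- The Green function of the unit ball. -/
def greenB (N : ℕ) (α : ℝ) (x y : EN N) : ℝ :=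
  if ‖x‖ < 1 ∧ ‖y‖ < 1 then
    greenCoeff N α * ‖x - y‖ ^ (α - (N : ℝ)) *
      ∫ s in (0:ℝ)..((1 - ‖x‖ ^ 2) * (1 - ‖y‖ ^ 2) / ‖x - y‖ ^ 2),
        s ^ (α / 2 - 1) * (1 + s) ^ (-(N : ℝ) / 2)
  else 0

/-- The Green function of the ball `B(a,r)`, by scaling. -/
def greenBall (N : ℕ) (α : ℝ) (a : EN N) (r : ℝ) (x y : EN N) : ℝ :=
  r ^ (α - (N : ℝ)) * greenB N α (r⁻¹ • (x - a)) (r⁻¹ • (y - a))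

/-- The constant `c_α^N` of the Poisson kernel. -/
def poissonCoeff (N : ℕ) (α : ℝ) : ℝ :=
  Real.pi ^ (-1 - (N : ℝ) / 2) * Real.Gamma ((N : ℝ) / 2) * Real.sin (Real.pi * α / 2)

/-- The Poisson kernel of the ball `B(a,r)`. -/
def poissonBall (N : ℕ) (α : ℝ) (a : EN N) (r : ℝ) (x y : EN N) : ℝ :=
  poissonCoeff N α * ((r ^ 2 - ‖x - a‖ ^ 2) / (‖y - a‖ ^ 2 - r ^ 2)) ^ (α / 2) *
    ‖x - y‖ ^ (-(N : ℝ))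

/-- The harmonic-measure operator `H^α_{B(a,r)} f`. -/
def Hball (N : ℕ) (α : ℝ) (a : EN N) (r : ℝ) (f : EN N → ℝ) (x : EN N) : ℝ :=
  ∫ y in {y : EN N | r < ‖y - a‖}, poissonBall N α a r x y * f y

/-- Solution (in the distributional sense) of `Δ^{α/2} u = u^γ` in the open set `U`. -/
def IsSolution (N : ℕ) (α γ : ℝ) (U : Set (EN N)) (u : EN N → ℝ) : Prop :=
  (∀ x, 0 ≤ u x) ∧ ContinuousOn u U ∧ memLalpha N α u ∧
    ∀ φ : EN N → ℝ, ContDiff ℝ (⊤ : ℕ∞) φ → HasCompactSupport φ → tsupport φ ⊆ U →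
      (∀ x, 0 ≤ φ x) →
        ∫ x, u x * fracLap N α φ x = ∫ x, u x ^ γ * φ x

/-- The surface measure `σ` on the unit sphere. -/
def sphereMeasure (N : ℕ) : Measure (Metric.sphere (0 : EN N) 1) :=
  (volume : Measure (EN N)).toSphere

/-- The Martin integral `M_B^α g`. -/
def martinB (N : ℕ) (α : ℝ) (g : Metric.sphere (0 : EN N) 1 → ℝ) (x : EN N) : ℝ :=
  if ‖x‖ < 1 then
    ∫ y, (1 - ‖x‖ ^ 2) ^ (α / 2) * ‖x - (y : EN N)‖ ^ (-(N : ℝ)) * g y ∂(sphereMeasure N)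
  else 0

/-- Solution of the moderate blow-up problem `(P_g)`. -/
def IsSolutionPg (N : ℕ) (α γ : ℝ) (g : Metric.sphere (0 : EN N) 1 → ℝ) (u : EN N → ℝ) : Prop :=
  (∀ x, 0 ≤ u x) ∧ memLalpha N α u ∧ (∀ x : EN N, ¬ ‖x‖ < 1 → u x = 0) ∧
    IsSolution N α γ (Metric.ball (0 : EN N) 1) u ∧
    ∀ z : Metric.sphere (0 : EN N) 1,
      Tendsto (fun x => delta1 x ^ (1 - α / 2) * u x)
        (𝓝[Metric.ball (0 : EN N) 1] (z : EN N)) (𝓝 (g z))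

/-- Solution of the blow-up problem `(P_∞)`. -/
def IsSolutionPinf (N : ℕ) (α γ : ℝ) (u : EN N → ℝ) : Prop :=
  (∀ x, 0 ≤ u x) ∧ memLalpha N α u ∧ (∀ x : EN N, ¬ ‖x‖ < 1 → u x = 0) ∧
    IsSolution N α γ (Metric.ball (0 : EN N) 1) u ∧
    ∀ z : Metric.sphere (0 : EN N) 1,
      Tendsto (fun x => delta1 x ^ (1 - α / 2) * u x)
        (𝓝[Metric.ball (0 : EN N) 1] (z : EN N)) atTop



def TT (α w : ℝ) : ℝ := (1 - w ^ 2) ^ (α / 2 - 1) * w ^ (-1 - α)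

def hh (κ s w : ℝ) : ℝ :=
  ((1 + s * w) ^ (κ + 1) + (1 - s * w) ^ (κ + 1)) / 2 * (1 - w ^ 2) ^ (-κ / 2)

def HH (α κ s : ℝ) : ℝ := ∫ w in Ioo (0:ℝ) 1, TT α w * (hh κ s w - 1)

lemma half_concave {e X Y : ℝ} (he : 0 ≤ e) (he1 : e ≤ 1) (hX : 0 ≤ X) (hY : 0 ≤ Y) :
    (X ^ e + Y ^ e) / 2 ≤ ((X + Y) / 2) ^ e := by
  have h := (Real.concaveOn_rpow he he1).2 (mem_Ici.2 hX) (mem_Ici.2 hY)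
    (show (0:ℝ) ≤ 1 / 2 by norm_num) (show (0:ℝ) ≤ 1 / 2 by norm_num) (by norm_num)
  simp only [smul_eq_mul] at h
  calc (X ^ e + Y ^ e) / 2 = 1 / 2 * X ^ e + 1 / 2 * Y ^ e := by ring
    _ ≤ _ := h
    _ = _ := by congr 1; ring

lemma half_convex {e X Y : ℝ} (he : 1 ≤ e) (hX : 0 ≤ X) (hY : 0 ≤ Y) :
    ((X + Y) / 2) ^ e ≤ (X ^ e + Y ^ e) / 2 := by
  have h := (convexOn_rpow he).2 (mem_Ici.2 hX) (mem_Ici.2 hY)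
    (show (0:ℝ) ≤ 1 / 2 by norm_num) (show (0:ℝ) ≤ 1 / 2 by norm_num) (by norm_num)
  simp only [smul_eq_mul] at h
  calc ((X + Y) / 2) ^ e = (1 / 2 * X + 1 / 2 * Y) ^ e := by congr 1; ring
    _ ≤ _ := h
    _ = _ := by ring

/-- AM-GM -/
lemma half_amgm {e t : ℝ} (h1 : -1 < t) (h2 : t < 1) :
    (1 - t ^ 2) ^ (e / 2) ≤ ((1 + t) ^ e + (1 - t) ^ e) / 2 := by
  have p1 : 0 < 1 + t := by linarith
  have p2 : 0 < 1 - t := by linarith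
  have : (1 - t ^ 2) ^ (e / 2) = (1 + t) ^ (e / 2) * (1 - t) ^ (e / 2) := by
    rw [← mul_rpow p1.le p2.le]; congr 1; ring
  have a1 : (1 + t) ^ e = ((1 + t) ^ (e / 2)) ^ 2 := by
    rw [← rpow_natCast, ← rpow_mul p1.le]; congr 1; push_cast; ring
  have a2 : (1 - t) ^ e = ((1 - t) ^ (e / 2)) ^ 2 := by
    rw [← rpow_natCast, ← rpow_mul p2.le]; congr 1; push_cast; ring
  rw [this, a1, a2]
  nlinarith [sq_nonneg ((1 + t) ^ (e / 2) - (1 - t) ^ (e / 2))]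

section bounds
variable {κ s w : ℝ}

lemma hh_pos_lower (hκ : 0 ≤ κ) (hs : |s| < 1) (hw0 : 0 < w) (hw1 : w < 1) :
    (1 - w ^ 2) ^ (-κ / 2) ≤ hh κ s w := by
  have hz : 0 < 1 - w ^ 2 := by nlinarith
  have := abs_lt.1 hs
  have h := half_convex (e := κ + 1) (X := 1 + s * w) (Y := 1 - s * w) (by linarith)
    (by nlinarith) (by nlinarith)
  have e1 : (1 + s * w + (1 - s * w)) / 2 = 1 := by ring
  rw [e1, one_rpow] at h
  have hp := rpow_pos_of_pos hz (-κ / 2)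
  unfold hh
  nlinarith

lemma hh_pos_upper (hκ : 0 ≤ κ) (hκ2 : κ < 2) (hs : |s| < 1) (hw0 : 0 < w) (hw1 : w < 1) :
    hh κ s w ≤ (1 + 3 * w ^ 2) * (1 - w ^ 2) ^ (-κ / 2) := by
  have hz : 0 < 1 - w ^ 2 := by nlinarith
  have hs' := abs_lt.1 hs
  have hs2 : s ^ 2 ≤ 1 := by nlinarith
  have p1 : 0 ≤ 1 + s * w := by nlinarith
  have p2 : 0 ≤ 1 - s * w := by nlinarith
  have h := half_concave (e := (κ + 1) / 3) (X := (1 + s * w) ^ 3) (Y := (1 - s * w) ^ 3)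
    (by linarith) (by linarith) (by positivity) (by positivity)
  have e1 : ((1 + s * w) ^ 3) ^ ((κ + 1) / 3) = (1 + s * w) ^ (κ + 1) := by
    rw [← rpow_natCast, ← rpow_mul p1]; congr 1; push_cast; ring
  have e2 : ((1 - s * w) ^ 3) ^ ((κ + 1) / 3) = (1 - s * w) ^ (κ + 1) := by
    rw [← rpow_natCast, ← rpow_mul p2]; congr 1; push_cast; ring
  have e3 : ((1 + s * w) ^ 3 + (1 - s * w) ^ 3) / 2 = 1 + 3 * (s * w) ^ 2 := by ring
  rw [e1, e2, e3] at h
  have h4 : (1 + 3 * (s * w) ^ 2) ^ ((κ + 1) / 3) ≤ 1 + 3 * w ^ 2 := by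
    calc (1 + 3 * (s * w) ^ 2) ^ ((κ + 1) / 3) ≤ (1 + 3 * (s * w) ^ 2) ^ (1 : ℝ) := by
          apply rpow_le_rpow_of_exponent_le <;> nlinarith [sq_nonneg (s * w)]
      _ = 1 + 3 * (s * w) ^ 2 := rpow_one _
      _ ≤ _ := by
        have : (s * w) ^ 2 = s ^ 2 * w ^ 2 := by ring
        nlinarith [sq_nonneg w]
  have hp := rpow_pos_of_pos hz (-κ / 2)
  unfold hh
  exact mul_le_mul_of_nonneg_right (h.trans h4) hp.le

lemma hh_mid_upper (hκ : κ ≤ 0) (hκ2 : -1 ≤ κ) (hs : |s| < 1) (hw0 : 0 < w) (hw1 : w < 1) :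
    hh κ s w ≤ (1 - w ^ 2) ^ (-κ / 2) := by
  have hz : 0 < 1 - w ^ 2 := by nlinarith
  have := abs_lt.1 hs
  have h := half_concave (e := κ + 1) (X := 1 + s * w) (Y := 1 - s * w) (by linarith)
    (by linarith) (by nlinarith) (by nlinarith)
  have e1 : (1 + s * w + (1 - s * w)) / 2 = 1 := by ring
  rw [e1, one_rpow] at h
  have hp := rpow_pos_of_pos hz (-κ / 2)
  unfold hh
  nlinarith

lemma hh_mid_lower (hκ2 : -1 ≤ κ) (hs : |s| < 1) (hw0 : 0 < w) (hw1 : w < 1) :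
    (1 - w ^ 2) ^ ((1:ℝ) / 2) ≤ hh κ s w := by
  have hz : 0 < 1 - w ^ 2 := by nlinarith
  have hs' := abs_lt.1 hs
  have hs2 : s ^ 2 ≤ 1 := by nlinarith
  have h := half_amgm (e := κ + 1) (t := s * w) (by nlinarith) (by nlinarith)
  have h2 : (1 - w ^ 2) ^ ((κ + 1) / 2) ≤ (1 - (s * w) ^ 2) ^ ((κ + 1) / 2) := by
    apply rpow_le_rpow hz.le _ (by linarith)
    have : (s * w) ^ 2 = s ^ 2 * w ^ 2 := by ring
    nlinarith [sq_nonneg w]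
  have hp := rpow_pos_of_pos hz (-κ / 2)
  unfold hh
  calc (1 - w ^ 2) ^ ((1:ℝ) / 2) = (1 - w ^ 2) ^ ((κ + 1) / 2) * (1 - w ^ 2) ^ (-κ / 2) := by
        rw [← rpow_add hz]; congr 1; ring
    _ ≤ _ := mul_le_mul_of_nonneg_right (h2.trans h) hp.le

lemma hh_neg_lower (hκ2 : κ ≤ -1) (hs : |s| < 1) (hw0 : 0 < w) (hw1 : w < 1) :
    (1 - w ^ 2) ^ (-κ / 2) ≤ hh κ s w := by
  have hz : 0 < 1 - w ^ 2 := by nlinarith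
  have hs' := abs_lt.1 hs
  have hs2 : s ^ 2 ≤ 1 := by nlinarith
  have h := half_amgm (e := κ + 1) (t := s * w) (by nlinarith) (by nlinarith)
  have h2 : 1 ≤ (1 - (s * w) ^ 2) ^ ((κ + 1) / 2) := by
    have : (s * w) ^ 2 = s ^ 2 * w ^ 2 := by ring
    apply one_le_rpow_of_pos_of_le_one_of_nonpos <;> nlinarith [sq_nonneg w, sq_nonneg (s * w)]
  have hp := rpow_pos_of_pos hz (-κ / 2)
  unfold hh
  nlinarith

lemma hh_neg_upper (hκ2 : κ ≤ -1) (hκ3 : -2 ≤ κ) (hs : |s| < 1) (hw0 : 0 < w) (hw1 : w < 1) :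
    hh κ s w ≤ (1 - w ^ 2) ^ ((κ + 2) / 2) := by
  have hz : 0 < 1 - w ^ 2 := by nlinarith
  have hs' := abs_lt.1 hs
  have hs2 : s ^ 2 ≤ 1 := by nlinarith
  have p1 : 0 < 1 + s * w := by nlinarith
  have p2 : 0 < 1 - s * w := by nlinarith
  have h := half_concave (e := -(κ + 1)) (X := 1 + s * w) (Y := 1 - s * w) (by linarith)
    (by linarith) p1.le p2.le
  have e1 : (1 + s * w + (1 - s * w)) / 2 = 1 := by ring
  rw [e1, one_rpow] at h
  have hsw : (s * w) ^ 2 = s ^ 2 * w ^ 2 := by ring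
  have hle : 1 - w ^ 2 ≤ 1 - (s * w) ^ 2 := by nlinarith [sq_nonneg w]
  have key : ((1 + s * w) ^ (κ + 1) + (1 - s * w) ^ (κ + 1)) / 2 =
      (1 - (s * w) ^ 2) ^ (κ + 1) * (((1 + s * w) ^ (-(κ + 1)) + (1 - s * w) ^ (-(κ + 1))) / 2) := by
    have : 1 - (s * w) ^ 2 = (1 + s * w) * (1 - s * w) := by ring
    rw [this, mul_rpow p1.le p2.le, rpow_neg p1.le, rpow_neg p2.le]
    have := rpow_pos_of_pos p1 (κ + 1)
    have := rpow_pos_of_pos p2 (κ + 1)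
    field_simp
    ring
  have h2 : (1 - (s * w) ^ 2) ^ (κ + 1) ≤ (1 - w ^ 2) ^ (κ + 1) :=
    rpow_le_rpow_of_nonpos hz hle (by linarith)
  have hq : 0 < (1 - (s * w) ^ 2) ^ (κ + 1) := rpow_pos_of_pos (by linarith) _
  have hp := rpow_pos_of_pos hz (-κ / 2)
  unfold hh
  calc _ ≤ (1 - w ^ 2) ^ (κ + 1) * (1 - w ^ 2) ^ (-κ / 2) := by
        apply mul_le_mul_of_nonneg_right _ hp.le
        rw [key]; nlinarith
    _ = _ := by rw [← rpow_add hz]; congr 1; ring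

end bounds

/-- Beta integrability -/
lemma beta_integrable {a c : ℝ} (ha : 0 < a) (hc : 0 < c) :
    IntegrableOn (fun w : ℝ => w ^ (a - 1) * (1 - w) ^ (c - 1)) (Ioo 0 1) := by
  have h := Complex.betaIntegral_convergent (u := a) (v := c) (by simpa) (by simpa)
  rw [intervalIntegrable_iff_integrableOn_Ioo_of_le zero_le_one] at h
  refine Integrable.congr (Integrable.norm h) ?_
  filter_upwards [ae_restrict_mem measurableSet_Ioo] with w hw
  have h1 : (1 - (w:ℂ)) = ((1 - w : ℝ) : ℂ) := by push_cast; rfl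
  rw [norm_mul, h1, Complex.norm_cpow_eq_rpow_re_of_pos hw.1,
    Complex.norm_cpow_eq_rpow_re_of_pos (by linarith [hw.2])]
  simp

lemma beta2_integrable {a c : ℝ} (ha : 0 < a) (hc : 0 < c) :
    IntegrableOn (fun w : ℝ => w ^ (a - 1) * (1 - w ^ 2) ^ (c - 1)) (Ioo 0 1) := by
  have h := (beta_integrable ha hc).mul_const (max 1 (2 ^ (c - 1)))
  refine Integrable.mono' h ?_ ?_
  · exact Measurable.aestronglyMeasurable (by fun_prop)
  · filter_upwards [ae_restrict_mem measurableSet_Ioo] with w hw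
    have hw0 := hw.1
    have hw1 : 0 < 1 - w := by linarith [hw.2]
    have : (1 - w ^ 2) = (1 - w) * (1 + w) := by ring
    rw [this, mul_rpow hw1.le (by linarith), norm_of_nonneg (by positivity), ← mul_assoc]
    refine mul_le_mul_of_nonneg_left ?_ (by positivity)
    rcases le_total 0 (c - 1) with h | h
    · exact le_max_of_le_right (rpow_le_rpow (by linarith) (by linarith [hw.2]) h)
    · exact le_max_of_le_left (rpow_le_one_of_one_le_of_nonpos (by linarith) h)

lemma TT_nonneg {α w : ℝ} (hw0 : 0 < w) (hw1 : w < 1) : 0 < TT α w := by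
  have hz : 0 < 1 - w ^ 2 := by nlinarith
  unfold TT; positivity

lemma TT_sq_integrable {α e : ℝ} (hα2 : α < 2) (he : 0 < α / 2 + e) :
    IntegrableOn (fun w : ℝ => TT α w * (w ^ 2 * (1 - w ^ 2) ^ e)) (Ioo 0 1) := by
  have h := beta2_integrable (a := 2 - α) (c := α / 2 + e) (by linarith) he
  refine Integrable.congr h ?_
  filter_upwards [ae_restrict_mem measurableSet_Ioo] with w hw
  have hz : 0 < 1 - w ^ 2 := by nlinarith [hw.1, hw.2]
  unfold TT
  have e1 : w ^ (2 - α - 1) = w ^ (-1 - α) * w ^ 2 := by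
    rw [← rpow_natCast, ← rpow_add hw.1]; congr 1; push_cast; ring
  have e2 : (1 - w ^ 2) ^ (α / 2 + e - 1) = (1 - w ^ 2) ^ (α / 2 - 1) * (1 - w ^ 2) ^ e := by
    rw [← rpow_add hz]; congr 1; ring
  rw [e1, e2]; ring

lemma pow_sub_one_bound {z e : ℝ} (hz : 0 < z) (hz1 : z < 1) (he : -1 ≤ e) (he1 : e ≤ 1) :
    |z ^ e - 1| ≤ (1 - z) * 1 + (1 - z) * z ^ e := by
  have hp := rpow_pos_of_pos hz e
  rcases le_total 0 e with h | h
  · have h1 : z ^ e ≤ 1 := rpow_le_one hz.le hz1.le h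
    have h2 : z ^ (1:ℝ) ≤ z ^ e := rpow_le_rpow_of_exponent_ge hz hz1.le he1
    rw [rpow_one] at h2
    rw [abs_of_nonpos (by linarith)]
    nlinarith
  · have h1 : 1 ≤ z ^ e := one_le_rpow_of_pos_of_le_one_of_nonpos hz hz1.le h
    have h2 : z ^ (1:ℝ) ≤ z ^ (-e) := rpow_le_rpow_of_exponent_ge hz hz1.le (by linarith)
    rw [rpow_one] at h2
    have h3 : z ^ e * z ^ (-e) = 1 := by rw [← rpow_add hz]; simp
    rw [abs_of_nonneg (by linarith)]
    nlinarith

lemma TT_measurable (α : ℝ) : Measurable (TT α) := by unfold TT; fun_prop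

lemma TT_pow_integrable {α e : ℝ} (hα : 0 < α) (hα2 : α < 2) (he : 0 < α / 2 + e)
    (he0 : -1 ≤ e) (he1 : e ≤ 1) :
    IntegrableOn (fun w : ℝ => TT α w * ((1 - w ^ 2) ^ e - 1)) (Ioo 0 1) := by
  have h := (TT_sq_integrable (e := 0) hα2 (by linarith)).add (TT_sq_integrable hα2 he)
  refine Integrable.mono' h ?_ ?_
  · have := TT_measurable α
    exact Measurable.aestronglyMeasurable (by fun_prop)
  · filter_upwards [ae_restrict_mem measurableSet_Ioo] with w hw
    have hz : 0 < 1 - w ^ 2 := by nlinarith [hw.1, hw.2]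
    have hz1 : 1 - w ^ 2 < 1 := by nlinarith [hw.1, hw.2]
    have hT := TT_nonneg (α := α) hw.1 hw.2
    have hb := pow_sub_one_bound hz hz1 he0 he1
    rw [norm_mul, norm_of_nonneg hT.le, norm_eq_abs]
    simp only [Pi.add_apply, rpow_zero]
    calc _ ≤ TT α w * ((1 - (1 - w^2)) * 1 + (1 - (1 - w^2)) * (1 - w^2) ^ e) :=
          mul_le_mul_of_nonneg_left hb hT.le
      _ = _ := by ring

lemma TT_pow_integral_pos {α e : ℝ} (hα : 0 < α) (hα2 : α < 2) (he : 0 < α / 2 + e)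
    (he0 : -1 ≤ e) (he1 : e < 0) :
    0 < ∫ w in Ioo (0:ℝ) 1, TT α w * ((1 - w ^ 2) ^ e - 1) := by
  have hpos : ∀ w ∈ Ioo (0:ℝ) 1, 0 < TT α w * ((1 - w ^ 2) ^ e - 1) := by
    intro w hw
    have hz : 0 < 1 - w ^ 2 := by nlinarith [hw.1, hw.2]
    have hz1 : 1 - w ^ 2 < 1 := by nlinarith [hw.1, hw.2]
    have := one_lt_rpow_of_pos_of_lt_one_of_neg hz hz1 he1
    exact mul_pos (TT_nonneg hw.1 hw.2) (by linarith)
  rw [setIntegral_pos_iff_support_of_nonneg_ae]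
  · have : Ioo (0:ℝ) 1 ⊆ (Function.support fun w : ℝ => TT α w * ((1 - w ^ 2) ^ e - 1)) ∩ Ioo 0 1 :=
      fun w hw => ⟨(hpos w hw).ne', hw⟩
    refine lt_of_lt_of_le ?_ (measure_mono this)
    simp
  · filter_upwards [ae_restrict_mem measurableSet_Ioo] with w hw using (hpos w hw).le
  · exact TT_pow_integrable hα hα2 he he0 (by linarith)

lemma TT_pow_integral_neg {α e : ℝ} (hα : 0 < α) (hα2 : α < 2)
    (he0 : 0 < e) (he1 : e ≤ 1) :
    ∫ w in Ioo (0:ℝ) 1, TT α w * ((1 - w ^ 2) ^ e - 1) < 0 := by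
  have hpos : ∀ w ∈ Ioo (0:ℝ) 1, 0 < -(TT α w * ((1 - w ^ 2) ^ e - 1)) := by
    intro w hw
    have hz : 0 < 1 - w ^ 2 := by nlinarith [hw.1, hw.2]
    have hz1 : 1 - w ^ 2 < 1 := by nlinarith [hw.1, hw.2]
    have := rpow_lt_one hz.le hz1 he0
    have := mul_pos (TT_nonneg (α := α) hw.1 hw.2) (show 0 < 1 - (1 - w ^ 2) ^ e by linarith)
    linarith
  rw [← neg_pos, ← integral_neg]
  rw [setIntegral_pos_iff_support_of_nonneg_ae]
  · have : Ioo (0:ℝ) 1 ⊆ (Function.support fun w : ℝ => -(TT α w * ((1 - w ^ 2) ^ e - 1))) ∩ Ioo 0 1 :=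
      fun w hw => ⟨(hpos w hw).ne', hw⟩
    refine lt_of_lt_of_le ?_ (measure_mono this)
    simp
  · filter_upwards [ae_restrict_mem measurableSet_Ioo] with w hw using (hpos w hw).le
  · exact (TT_pow_integrable hα hα2 (by linarith) (by linarith) (by linarith)).neg

lemma hh_measurable (κ s : ℝ) : Measurable (hh κ s) := by unfold hh; fun_prop

lemma integrable_sandwich {f g k : ℝ → ℝ} {s : Set ℝ} (hs : MeasurableSet s)
    (hf : IntegrableOn f s) (hk : IntegrableOn k s) (hg : Measurable g)
    (h1 : ∀ x ∈ s, f x ≤ g x) (h2 : ∀ x ∈ s, g x ≤ k x) :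
    IntegrableOn g s ∧ ∫ x in s, f x ≤ ∫ x in s, g x ∧ ∫ x in s, g x ≤ ∫ x in s, k x := by
  have hgi : IntegrableOn g s := by
    refine Integrable.mono' (hf.norm.add hk.norm) hg.aestronglyMeasurable ?_
    filter_upwards [ae_restrict_mem hs] with x hx
    simp only [Pi.add_apply, norm_eq_abs]
    have a1 := h1 x hx
    have a2 := h2 x hx
    rw [abs_le]
    constructor
    · linarith [neg_abs_le (f x), abs_nonneg (k x)]
    · linarith [le_abs_self (k x), abs_nonneg (f x)]
  exact ⟨hgi, setIntegral_mono_on hf hgi hs h1, setIntegral_mono_on hgi hk hs h2⟩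

/-- main bounds for `HH` -/
lemma HH_bounds {α κ : ℝ} (hα : 0 < α) (hα2 : α < 2) (hκ : -2 < κ) (hκ2 : κ < α) :
    (∀ s, |s| < 1 → IntegrableOn (fun w => TT α w * (hh κ s w - 1)) (Ioo 0 1)) ∧
    ∃ m M : ℝ, 0 < m ∧ m ≤ M ∧ ∀ s, |s| < 1 →
      (0 ≤ κ → m * κ ≤ HH α κ s ∧ HH α κ s ≤ M * κ) ∧
      (κ ≤ 0 → M * κ ≤ HH α κ s ∧ HH α κ s ≤ m * κ) := by
  have hmeas : ∀ s, Measurable (fun w => TT α w * (hh κ s w - 1)) := fun s => by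
    have := TT_measurable α
    have := hh_measurable κ s
    fun_prop
  have hP := TT_pow_integrable (α := α) (e := -κ / 2) hα hα2 (by linarith) (by linarith) (by linarith)
  rcases lt_trichotomy κ 0 with hk | hk | hk
  · -- negative: obtain common bounds
    obtain ⟨f, k, hf, hkk, hki, hfs, hks⟩ : ∃ f k : ℝ → ℝ, IntegrableOn f (Ioo 0 1) ∧
        IntegrableOn k (Ioo 0 1) ∧ ∫ w in Ioo (0:ℝ) 1, k w < 0 ∧
        (∀ s, |s| < 1 → ∀ w ∈ Ioo (0:ℝ) 1, f w ≤ TT α w * (hh κ s w - 1)) ∧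
        (∀ s, |s| < 1 → ∀ w ∈ Ioo (0:ℝ) 1, TT α w * (hh κ s w - 1) ≤ k w) := by
      rcases le_total (-1) κ with h1 | h1
      · refine ⟨_, _, TT_pow_integrable (α := α) (e := 1 / 2) hα hα2 (by linarith) (by linarith)
          (by linarith), hP, TT_pow_integral_neg hα hα2 (by linarith) (by linarith), ?_, ?_⟩
        · intro s hs w hw
          refine mul_le_mul_of_nonneg_left ?_ (TT_nonneg hw.1 hw.2).le
          linarith [hh_mid_lower h1 hs hw.1 hw.2]
        · intro s hs w hw
          refine mul_le_mul_of_nonneg_left ?_ (TT_nonneg hw.1 hw.2).le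
          linarith [hh_mid_upper hk.le h1 hs hw.1 hw.2]
      · refine ⟨_, _, hP, TT_pow_integrable (α := α) (e := (κ + 2) / 2) hα hα2 (by linarith)
          (by linarith) (by linarith), TT_pow_integral_neg hα hα2 (by linarith) (by linarith), ?_, ?_⟩
        · intro s hs w hw
          refine mul_le_mul_of_nonneg_left ?_ (TT_nonneg hw.1 hw.2).le
          linarith [hh_neg_lower h1 hs hw.1 hw.2]
        · intro s hs w hw
          refine mul_le_mul_of_nonneg_left ?_ (TT_nonneg hw.1 hw.2).le
          linarith [hh_neg_upper h1 hκ.le hs hw.1 hw.2]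
    have hall := fun s (hs : |s| < 1) =>
      integrable_sandwich measurableSet_Ioo hf hkk (hmeas s) (hfs s hs) (hks s hs)
    refine ⟨fun s hs => (hall s hs).1, (∫ w in Ioo (0:ℝ) 1, k w) / κ, (∫ w in Ioo (0:ℝ) 1, f w) / κ,
      div_pos_of_neg_of_neg hki hk, ?_, ?_⟩
    · have := hall 0 (by simp)
      rw [div_le_div_right_of_neg hk]
      linarith [this.2.1, this.2.2]
    · intro s hs
      refine ⟨fun h => absurd h (by linarith), fun _ => ?_⟩
      rw [div_mul_cancel₀ _ hk.ne, div_mul_cancel₀ _ hk.ne]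
      exact (hall s hs).2
  · subst hk
    have h0 : ∀ s w, |s| < 1 → w ∈ Ioo (0:ℝ) 1 → TT α w * (hh 0 s w - 1) = 0 := by
      intro s w hs hw
      unfold hh
      simp
    refine ⟨fun s hs => ?_, 1, 1, one_pos, le_rfl, fun s hs => ?_⟩
    · exact (integrableOn_zero).congr_fun (fun w hw => (h0 s w hs hw).symm) measurableSet_Ioo
    · have : HH α 0 s = 0 := by
        unfold HH
        rw [setIntegral_congr_fun measurableSet_Ioo (fun w hw => h0 s w hs hw)]
        simp
      simp [this]
  · have hS := TT_sq_integrable (α := α) (e := -κ / 2) hα2 (by linarith)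
    have hk2 : IntegrableOn (fun w => TT α w * ((1 - w ^ 2) ^ (-κ / 2) - 1) +
      3 * (TT α w * (w ^ 2 * (1 - w ^ 2) ^ (-κ / 2)))) (Ioo 0 1) := hP.add (hS.const_mul 3)
    have hall := fun s (hs : |s| < 1) =>
      integrable_sandwich measurableSet_Ioo hP hk2 (hmeas s)
      (by
        intro w hw
        refine mul_le_mul_of_nonneg_left ?_ (TT_nonneg hw.1 hw.2).le
        linarith [hh_pos_lower hk.le hs hw.1 hw.2])
      (by
        intro w hw
        have := mul_le_mul_of_nonneg_left (hh_pos_upper hk.le (by linarith) hs hw.1 hw.2)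
          (TT_nonneg (α := α) hw.1 hw.2).le
        linarith)
    have hpos := TT_pow_integral_pos (α := α) (e := -κ / 2) hα hα2 (by linarith) (by linarith) (by linarith)
    set J := ∫ x in Ioo (0:ℝ) 1, (TT α x * ((1 - x ^ 2) ^ (-κ / 2) - 1) +
      3 * (TT α x * (x ^ 2 * (1 - x ^ 2) ^ (-κ / 2)))) with hJ
    refine ⟨fun s hs => (hall s hs).1, _ / κ, J / κ, div_pos hpos hk, ?_, ?_⟩
    · have := hall 0 (by simp)
      gcongr
      linarith [this.2.1, this.2.2]
    · intro s hs
      refine ⟨fun _ => ?_, fun h => absurd h (by linarith)⟩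
      rw [div_mul_cancel₀ _ hk.ne', div_mul_cancel₀ _ hk.ne']
      exact (hall s hs).2

lemma tendsto_setInt {X : Type*} [MeasurableSpace X] {μ : Measure X} {f : X → ℝ}
    (hf : Integrable f μ) (S : ℝ → Set X) (hS : ∀ η, MeasurableSet (S η))
    (h : ∀ᵐ x ∂μ, ∀ᶠ η in 𝓝[>] (0:ℝ), x ∈ S η) :
    Tendsto (fun η => ∫ x in S η, f x ∂μ) (𝓝[>] (0:ℝ)) (𝓝 (∫ x, f x ∂μ)) := by
  have : (fun η => ∫ x in S η, f x ∂μ) = fun η => ∫ x, (S η).indicator f x ∂μ := by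
    ext η; rw [integral_indicator (hS η)]
  rw [this]
  refine tendsto_integral_filter_of_dominated_convergence (fun x => ‖f x‖) ?_ ?_ hf.norm ?_
  · exact Eventually.of_forall fun η => (hf.aestronglyMeasurable.indicator (hS η))
  · exact Eventually.of_forall fun η => Eventually.of_forall fun x => norm_indicator_le_norm_self _ _
  · filter_upwards [h] with x hx
    refine tendsto_const_nhds.congr' ?_
    filter_upwards [hx] with η hη
    rw [indicator_of_mem hη]

lemma taylor_rpow {d : ℝ} (hd : 0 < d) (a : ℝ) :
    ∃ C δ : ℝ, 0 ≤ C ∧ 0 < δ ∧ δ < d ∧ ∀ h : ℝ, |h| < δ →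
      |(d + h) ^ a - d ^ a - a * d ^ (a - 1) * h| ≤ C * h ^ 2 := by
  have hc : ContDiffAt ℝ 1 (fun x : ℝ => a * x ^ (a - 1)) d :=
    contDiffAt_const.mul (contDiffAt_id.rpow contDiffAt_const hd.ne')
  obtain ⟨K, t, ht, hL⟩ := hc.exists_lipschitzOnWith
  obtain ⟨ε, hε, hb⟩ := Metric.mem_nhds_iff.1 ht
  refine ⟨K, min ε (d / 2), K.2, by positivity, by linarith [min_le_right ε (d / 2)], ?_⟩
  intro h hh
  have h1 : |h| < ε := hh.trans_le (min_le_left _ _)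
  have h2 : |h| < d / 2 := hh.trans_le (min_le_right _ _)
  have key := Convex.norm_image_sub_le_of_norm_hasDerivWithin_le (𝕜 := ℝ)
    (f := fun x : ℝ => x ^ a - a * d ^ (a - 1) * x)
    (f' := fun x => a * x ^ (a - 1) - a * d ^ (a - 1)) (s := closedBall d |h|) (x := d) (y := d + h)
    (C := K * |h|) ?_ ?_ (convex_closedBall _ _) (by simp) (by simp)
  · simp only [norm_eq_abs, add_sub_cancel_left] at key
    calc _ = |(d + h) ^ a - a * d ^ (a - 1) * (d + h) - (d ^ a - a * d ^ (a - 1) * d)| := by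
          congr 1; ring
      _ ≤ K * |h| * |h| := key
      _ = _ := by rw [mul_assoc, ← sq, sq_abs]
  · intro x hx
    rw [mem_closedBall, dist_eq] at hx
    have hx0 : 0 < x := by have := abs_le.1 hx; linarith [h2]
    have := (Real.hasDerivAt_rpow_const (x := x) (p := a) (Or.inl hx0.ne')).sub
      ((hasDerivAt_id x).const_mul (a * d ^ (a - 1)))
    rw [mul_one] at this
    exact this.hasDerivWithinAt
  · intro x hx
    rw [mem_closedBall] at hx
    have := hL.dist_le_mul x (hb (hx.trans_lt h1)) d (hb (by simpa using hε))
    rw [dist_eq] at this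
    exact this.trans (by gcongr)

lemma pow_identity {A B C E W : ℝ} (hA : 0 < A) (hB : 0 < B) (hC : 0 < C) (hE : 0 < E) (hW : 0 < W)
    (α β : ℝ) :
    (A ^ 2 * B * C / E ^ 2) ^ (-β) * (A * B * W / E) ^ (-1 - α) * (A * B / E ^ 2) =
      A ^ (-α - 2 * β) * B ^ (-(α + β)) * (C ^ (-β) * E ^ (α + 2 * β - 1) * W ^ (-1 - α)) := by
  obtain ⟨a, rfl⟩ : ∃ a, exp a = A := ⟨log A, exp_log hA⟩
  obtain ⟨b, rfl⟩ : ∃ a, exp a = B := ⟨log B, exp_log hB⟩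
  obtain ⟨c, rfl⟩ : ∃ a, exp a = C := ⟨log C, exp_log hC⟩
  obtain ⟨e, rfl⟩ : ∃ a, exp a = E := ⟨log E, exp_log hE⟩
  obtain ⟨w, rfl⟩ : ∃ a, exp a = W := ⟨log W, exp_log hW⟩
  simp only [← Real.exp_add, ← Real.exp_sub, ← Real.exp_mul, ← Real.exp_nat_mul]
  congr 1
  push_cast
  ring

lemma pow_identity2 {A B E W : ℝ} (hA : 0 < A) (hB : 0 < B) (hE : 0 < E) (hW : 0 < W)
    (α β : ℝ) :
    (A ^ 2 * B) ^ (-β) * (A * B * W / E) ^ (-α) =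
      A ^ (-α - 2 * β) * B ^ (-(α + β)) * (E ^ α * W ^ (-α)) := by
  obtain ⟨a, rfl⟩ : ∃ a, exp a = A := ⟨log A, exp_log hA⟩
  obtain ⟨b, rfl⟩ : ∃ a, exp a = B := ⟨log B, exp_log hB⟩
  obtain ⟨e, rfl⟩ : ∃ a, exp a = E := ⟨log E, exp_log hE⟩
  obtain ⟨w, rfl⟩ : ∃ a, exp a = W := ⟨log W, exp_log hW⟩
  simp only [← Real.exp_add, ← Real.exp_sub, ← Real.exp_mul, ← Real.exp_nat_mul]
  congr 1
  push_cast
  ring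

def UU (β ρ s r : ℝ) : ℝ :=
  if 0 < ρ ^ 2 * (1 - s ^ 2) - 2 * (ρ * s) * r - r ^ 2 then
    (ρ ^ 2 * (1 - s ^ 2) - 2 * (ρ * s) * r - r ^ 2) ^ (-β) else 0

def ph (ρ s w : ℝ) : ℝ := ρ * (1 - s ^ 2) * w / (1 + s * w)

def gg (α β s w : ℝ) : ℝ := (1 - w ^ 2) ^ (-β) * (1 + s * w) ^ (α + 2 * β - 1) * w ^ (-1 - α)

def KK (α β ρ s : ℝ) : ℝ := ρ ^ (-α - 2 * β) * (1 - s ^ 2) ^ (-(α + β))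

section
variable {α β ρ s η : ℝ}

lemma one_sub_sq_pos (hs : |s| < 1) : 0 < 1 - s ^ 2 := by
  have := abs_lt.1 hs; nlinarith

lemma one_add_pos (hs : |s| < 1) {w : ℝ} (h0 : 0 ≤ w) (h1 : w ≤ 1) : 0 < 1 + s * w := by
  have := abs_lt.1 hs; nlinarith

lemma ph_deriv (hs : |s| < 1) {w : ℝ} (h0 : 0 ≤ w) (h1 : w ≤ 1) :
    HasDerivAt (ph ρ s) (ρ * (1 - s ^ 2) / (1 + s * w) ^ 2) w := by
  have hp := one_add_pos hs h0 h1
  have a1 : HasDerivAt (fun w => ρ * (1 - s ^ 2) * w) (ρ * (1 - s ^ 2)) w := by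
    simpa using (hasDerivAt_id w).const_mul (ρ * (1 - s ^ 2))
  have a2 : HasDerivAt (fun w => 1 + s * w) s w := by
    simpa using ((hasDerivAt_id w).const_mul s).const_add 1
  have := a1.fun_div a2 hp.ne'
  refine HasDerivAt.congr_deriv (f := ph ρ s) this ?_
  congr 1; ring

lemma ph_lt_iff (hρ : 0 < ρ) (hs : |s| < 1) {v w : ℝ} (h0 : 0 ≤ w) (h1 : w ≤ 1)
    (k0 : 0 ≤ v) (k1 : v ≤ 1) : ph ρ s v < ph ρ s w ↔ v < w := by
  have hp := one_add_pos hs h0 h1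
  have hp' := one_add_pos hs k0 k1
  have hs2 := one_sub_sq_pos hs
  unfold ph
  rw [div_lt_div_iff₀ hp' hp]
  have : 0 < ρ * (1 - s ^ 2) := by positivity
  have e : ρ * (1 - s ^ 2) * w * (1 + s * v) - ρ * (1 - s ^ 2) * v * (1 + s * w) =
    ρ * (1 - s ^ 2) * (w - v) := by ring
  constructor
  · intro h
    have : 0 < ρ * (1 - s ^ 2) * (w - v) := by linarith
    have := (mul_pos_iff_of_pos_left (by assumption)).1 this
    linarith
  · intro h
    have : 0 < ρ * (1 - s ^ 2) * (w - v) := mul_pos this (by linarith)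
    linarith

lemma ph_one (hs : |s| < 1) : ph ρ s 1 = ρ * (1 - s) := by
  have hp := one_add_pos hs zero_le_one le_rfl
  unfold ph; rw [div_eq_iff hp.ne']; ring

lemma ph_pos (hρ : 0 < ρ) (hs : |s| < 1) {w : ℝ} (h0 : 0 < w) (h1 : w ≤ 1) : 0 < ph ρ s w := by
  have hp := one_add_pos hs h0.le h1
  have hs2 := one_sub_sq_pos hs
  unfold ph; positivity

lemma ph_image (hρ : 0 < ρ) (hs : |s| < 1) (h0 : 0 < η) (h1 : η < 1) :
    ph ρ s '' Ioo η 1 = Ioo (ph ρ s η) (ph ρ s 1) := by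
  have hs2 := one_sub_sq_pos hs
  have hs' := abs_lt.1 hs
  ext r
  constructor
  · rintro ⟨w, hw, rfl⟩
    exact ⟨(ph_lt_iff hρ hs (by linarith [hw.1]) hw.2.le h0.le h1.le).2 hw.1,
      (ph_lt_iff hρ hs zero_le_one le_rfl (by linarith [hw.1]) hw.2.le).2 hw.2⟩
  · intro hr
    have hcont : ContinuousOn (ph ρ s) (Icc η 1) := fun w hw =>
      (ph_deriv hs (by linarith [hw.1]) hw.2).continuousAt.continuousWithinAt
    exact intermediate_value_Ioo h1.le hcont hr

lemma UU_ph (hs : |s| < 1) (hρ : 0 < ρ) {w : ℝ} (h0 : 0 < w) (h1 : w < 1) :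
    UU β ρ s (ph ρ s w) = (ρ ^ 2 * (1 - s ^ 2) * (1 - w ^ 2) / (1 + s * w) ^ 2) ^ (-β) := by
  have hp := one_add_pos hs h0.le h1.le
  have hs2 := one_sub_sq_pos hs
  have e : ρ ^ 2 * (1 - s ^ 2) - 2 * (ρ * s) * ph ρ s w - (ph ρ s w) ^ 2 =
      ρ ^ 2 * (1 - s ^ 2) * (1 - w ^ 2) / (1 + s * w) ^ 2 := by
    unfold ph; field_simp; ring
  have hw : 0 < 1 - w ^ 2 := by nlinarith
  unfold UU
  rw [e, if_pos (by positivity)]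

lemma subst_integrand (hs : |s| < 1) (hρ : 0 < ρ) {w : ℝ} (h0 : 0 < w) (h1 : w < 1) :
    |ρ * (1 - s ^ 2) / (1 + s * w) ^ 2| • (UU β ρ s (ph ρ s w) * ph ρ s w ^ (-1 - α)) =
      KK α β ρ s * gg α β s w := by
  have hp := one_add_pos hs h0.le h1.le
  have hs2 := one_sub_sq_pos hs
  have hw : 0 < 1 - w ^ 2 := by nlinarith
  rw [UU_ph hs hρ h0 h1, abs_of_pos (by positivity), smul_eq_mul, mul_comm]
  exact pow_identity hρ hs2 hw hp h0 α β

lemma gg_integrable (hβ : β < 1) (hs : |s| < 1) (h0 : 0 < η) :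
    IntegrableOn (gg α β s) (Ioo η 1) := by
  have h := (beta2_integrable (a := 1) (c := 1 - β) one_pos (by linarith)).mono_set
    (Ioo_subset_Ioo_left h0.le : Ioo η 1 ⊆ Ioo 0 1)
  have hc : ContinuousOn (fun w => (1 + s * w) ^ (α + 2 * β - 1) * w ^ (-1 - α)) (Icc η 1) := by
    refine ContinuousOn.mul ?_ ?_
    · exact ContinuousOn.rpow_const (by fun_prop) fun w hw =>
        Or.inl (one_add_pos hs (by linarith [hw.1]) hw.2).ne'
    · exact ContinuousOn.rpow_const (by fun_prop) fun w hw => Or.inl (by linarith [hw.1])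
  have := h.mul_continuousOn_of_subset hc measurableSet_Ioo isCompact_Icc Ioo_subset_Icc_self
  refine this.congr_fun ?_ measurableSet_Ioo
  intro w hw
  have e : 1 - β - 1 = -β := by ring
  simp only [sub_self, rpow_zero, one_mul, gg, e]
  ring

lemma UU_zero (hs : |s| < 1) (hρ : 0 < ρ) {r : ℝ} (hr : ph ρ s 1 ≤ r) : UU β ρ s r = 0 := by
  rw [ph_one hs] at hr
  have hs' := abs_lt.1 hs
  unfold UU
  rw [if_neg]
  have : ρ ^ 2 * (1 - s ^ 2) - 2 * (ρ * s) * r - r ^ 2 = (ρ - (r + ρ * s)) * (ρ + (r + ρ * s)) := by ring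
  rw [this, not_lt]
  apply mul_nonpos_of_nonpos_of_nonneg <;> nlinarith

lemma UU_measurable : Measurable (UU β ρ s) := by
  unfold UU
  refine Measurable.ite ?_ (by fun_prop) measurable_const
  exact measurableSet_lt measurable_const (by fun_prop)

lemma subst_integral (hβ : β < 1) (hs : |s| < 1) (hρ : 0 < ρ) (h0 : 0 < η) (h1 : η < 1) :
    IntegrableOn (fun r => UU β ρ s r * r ^ (-1 - α)) (Ioi (ph ρ s η)) ∧
    ∫ r in Ioi (ph ρ s η), UU β ρ s r * r ^ (-1 - α) =
      KK α β ρ s * ∫ w in Ioo η 1, gg α β s w := by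
  have hd : ∀ w ∈ Ioo η 1, HasDerivWithinAt (ph ρ s) (ρ * (1 - s ^ 2) / (1 + s * w) ^ 2) (Ioo η 1) w :=
    fun w hw => (ph_deriv hs (by linarith [hw.1]) hw.2.le).hasDerivWithinAt
  have hinj : InjOn (ph ρ s) (Ioo η 1) := by
    intro v hv w hw hvw
    by_contra hne
    rcases lt_or_gt_of_ne hne with h | h
    · exact absurd hvw ((ph_lt_iff hρ hs (by linarith [hw.1]) hw.2.le (by linarith [hv.1]) hv.2.le).2 h).ne
    · exact absurd hvw ((ph_lt_iff hρ hs (by linarith [hv.1]) hv.2.le (by linarith [hw.1]) hw.2.le).2 h).ne'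
  have hsub : Ioo (ph ρ s η) (ph ρ s 1) ⊆ Ioi (ph ρ s η) := fun r hr => hr.1
  have hz : ∀ r ∈ Ioi (ph ρ s η) \ Ioo (ph ρ s η) (ph ρ s 1), UU β ρ s r * r ^ (-1 - α) = 0 := by
    intro r hr
    have : ph ρ s 1 ≤ r := by
      by_contra hlt
      exact hr.2 ⟨hr.1, not_le.1 hlt⟩
    rw [UU_zero hs hρ this, zero_mul]
  constructor
  · have : IntegrableOn (fun r => UU β ρ s r * r ^ (-1 - α)) (Ioo (ph ρ s η) (ph ρ s 1)) := by
      rw [← ph_image hρ hs h0 h1, integrableOn_image_iff_integrableOn_abs_deriv_smul measurableSet_Ioo hd hinj]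
      refine IntegrableOn.congr_fun (f := fun w => KK α β ρ s * gg α β s w)
        ((gg_integrable (α := α) hβ hs h0).const_mul _) ?_ measurableSet_Ioo
      intro w hw
      exact (subst_integrand hs hρ (by linarith [hw.1]) hw.2).symm
    exact this.of_forall_sdiff_eq_zero measurableSet_Ioi hz
  · rw [setIntegral_eq_of_subset_of_forall_sdiff_eq_zero measurableSet_Ioi hsub hz,
      ← ph_image hρ hs h0 h1, integral_image_eq_integral_abs_deriv_smul measurableSet_Ioo hd hinj,
      ← integral_const_mul]
    refine setIntegral_congr_fun measurableSet_Ioo ?_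
    intro w hw
    exact subst_integrand hs hρ (by linarith [hw.1]) hw.2

lemma J_formula (hα : 0 < α) (hβ : β < 1) (hs : |s| < 1) (hρ : 0 < ρ) (h0 : 0 < η) (h1 : η < 1) :
    IntegrableOn (fun r => (UU β ρ s r - (ρ ^ 2 * (1 - s ^ 2)) ^ (-β)) * r ^ (-1 - α)) (Ioi (ph ρ s η)) ∧
    ∫ r in Ioi (ph ρ s η), (UU β ρ s r - (ρ ^ 2 * (1 - s ^ 2)) ^ (-β)) * r ^ (-1 - α) =
      KK α β ρ s * ((∫ w in Ioo η 1, gg α β s w) - (1 + s * η) ^ α * η ^ (-α) / α) := by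
  obtain ⟨i1, e1⟩ := subst_integral (α := α) hβ hs hρ h0 h1
  have hp := ph_pos hρ hs h0 h1.le
  have i2 : IntegrableOn (fun r : ℝ => (ρ ^ 2 * (1 - s ^ 2)) ^ (-β) * r ^ (-1 - α)) (Ioi (ph ρ s η)) :=
    (integrableOn_Ioi_rpow_of_lt (by linarith) hp).const_mul _
  have ee : (fun r => (UU β ρ s r - (ρ ^ 2 * (1 - s ^ 2)) ^ (-β)) * r ^ (-1 - α)) =
    fun r => UU β ρ s r * r ^ (-1 - α) - (ρ ^ 2 * (1 - s ^ 2)) ^ (-β) * r ^ (-1 - α) := by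
    ext r; ring
  rw [ee]
  refine ⟨i1.sub i2, ?_⟩
  rw [integral_sub i1 i2, e1, integral_const_mul, integral_Ioi_rpow_of_lt (by linarith) hp]
  have := pow_identity2 hρ (one_sub_sq_pos hs) (one_add_pos hs h0.le h1.le) h0 α β
  have e3 : -1 - α + 1 = -α := by ring
  rw [e3, neg_div_neg_eq, ← mul_div_assoc]
  unfold KK
  change _ - (ρ ^ 2 * (1 - s ^ 2)) ^ (-β) * (ρ * (1 - s ^ 2) * η / (1 + s * η)) ^ (-α) / α = _
  rw [this]; ring

lemma TT_integrable (hα : 0 < α) (h0 : 0 < η) : IntegrableOn (TT α) (Ioo η 1) := by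
  have h := gg_integrable (α := α) (β := 1 - α / 2) (s := 0) (η := η) (by linarith) (by simp) h0
  refine h.congr_fun ?_ measurableSet_Ioo
  intro w hw
  have : -(1 - α / 2) = α / 2 - 1 := by ring
  simp [gg, TT, this]

lemma TT_integral (hα : 0 < α) (h0 : 0 < η) (h1 : η < 1) :
    ∫ w in Ioo η 1, TT α w = (1 - η ^ 2) ^ (α / 2) * η ^ (-α) / α := by
  rw [← integral_Ioc_eq_integral_Ioo, ← intervalIntegral.integral_of_le h1.le]
  rw [intervalIntegral.integral_eq_sub_of_hasDerivAt_of_le h1.le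
    (f := fun w => -((1 - w ^ 2) ^ (α / 2) * w ^ (-α) / α))]
  · simp
    rw [zero_rpow (by positivity)]; simp
  · refine ContinuousOn.neg (ContinuousOn.div_const (ContinuousOn.mul ?_ ?_) _)
    · exact ContinuousOn.rpow_const (by fun_prop) fun w hw => Or.inr (by positivity)
    · exact ContinuousOn.rpow_const (by fun_prop) fun w hw => Or.inl (by linarith [hw.1])
  · intro w hw
    have hw0 : 0 < w := by linarith [hw.1]
    have hz : 0 < 1 - w ^ 2 := by nlinarith [hw.2]
    have a1 : HasDerivAt (fun w : ℝ => 1 - w ^ 2) (-(2 * w)) w := by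
      simpa using (hasDerivAt_pow 2 w).const_sub 1
    have a2 := a1.rpow_const (p := α / 2) (Or.inl hz.ne')
    have a3 := Real.hasDerivAt_rpow_const (x := w) (p := -α) (Or.inl hw0.ne')
    have a4 := ((a2.fun_mul a3).div_const α).fun_neg
    refine a4.congr_deriv ?_
    unfold TT
    have b1 : (1 - w ^ 2) ^ (α / 2) = (1 - w ^ 2) ^ (α / 2 - 1) * (1 - w ^ 2) := by
      rw [← rpow_add_one hz.ne']; congr 1; ring
    have b2 : w ^ (-α) = w ^ (-1 - α) * w := by
      rw [← rpow_add_one hw0.ne']; congr 1; ring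
    have b3 : w ^ (-α - 1) = w ^ (-1 - α) := by congr 1; ring
    rw [b1, b2, b3]
    field_simp
    ring
  · rw [intervalIntegrable_iff_integrableOn_Ioo_of_le h1.le]
    exact TT_integrable hα h0

lemma gg_add (hs : |s| < 1) {w : ℝ} (h0 : 0 < w) (h1 : w < 1) :
    gg α β s w + gg α β (-s) w = 2 * (TT α w * hh (α + 2 * β - 2) s w) := by
  have hz : 0 < 1 - w ^ 2 := by nlinarith
  have e : (1 - w ^ 2) ^ (-β) = (1 - w ^ 2) ^ (α / 2 - 1) * (1 - w ^ 2) ^ (-(α + 2 * β - 2) / 2) := by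
    rw [← rpow_add hz]; congr 1; ring
  have e2 : α + 2 * β - 2 + 1 = α + 2 * β - 1 := by ring
  unfold gg TT hh
  rw [e, e2]
  have e3 : 1 + -s * w = 1 - s * w := by ring
  rw [e3]; ring

lemma gg_sum (hα : 0 < α) (hβ : β < 1) (hs : |s| < 1) (h0 : 0 < η) (h1 : η < 1) :
    (∫ w in Ioo η 1, gg α β s w) + (∫ w in Ioo η 1, gg α β (-s) w) =
      2 * (∫ w in Ioo η 1, TT α w * (hh (α + 2 * β - 2) s w - 1)) +
        2 * ((1 - η ^ 2) ^ (α / 2) * η ^ (-α) / α) := by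
  have hs' : |-s| < 1 := by rwa [abs_neg]
  have i1 := gg_integrable (α := α) hβ hs h0
  have i2 := gg_integrable (α := α) hβ hs' h0
  have i3 := TT_integrable hα h0
  rw [← TT_integral hα h0 h1, ← integral_add i1 i2]
  have : ∫ w in Ioo η 1, TT α w * (hh (α + 2 * β - 2) s w - 1) =
      ∫ w in Ioo η 1, ((gg α β s w + gg α β (-s) w) / 2 - TT α w) := by
    refine setIntegral_congr_fun measurableSet_Ioo ?_
    intro w hw
    have := gg_add (α := α) (β := β) hs (by linarith [hw.1] : 0 < w) hw.2
    simp only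
    rw [this]; ring
  have i4 : IntegrableOn (fun w => (gg α β s w + gg α β (-s) w) / 2) (Ioo η 1) :=
    (i1.add i2).div_const 2
  rw [this, integral_sub i4 i3, integral_div]
  ring
end

section
variable {α β ρ s η : ℝ}

lemma tz (hα2 : α < 2) {F : ℝ → ℝ} (C : ℝ) (h : ∀ᶠ η in 𝓝[>] (0:ℝ), |F η| ≤ C * η ^ (2 - α)) :
    Tendsto F (𝓝[>] (0:ℝ)) (𝓝 0) := by
  have h1 : Tendsto (fun η : ℝ => C * η ^ (2 - α)) (𝓝[>] (0:ℝ)) (𝓝 0) := by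
    have : ContinuousAt (fun η : ℝ => C * η ^ (2 - α)) 0 :=
      continuousAt_const.mul (continuousAt_id.rpow_const (Or.inr (by linarith)))
    have h2 := this.tendsto
    simp only [zero_rpow (by linarith : 2 - α ≠ 0), mul_zero] at h2
    exact h2.mono_left nhdsWithin_le_nhds
  exact squeeze_zero_norm' h h1

lemma ev_small {δ : ℝ} (hδ : 0 < δ) : ∀ᶠ η in 𝓝[>] (0:ℝ), 0 < η ∧ η < δ := by
  filter_upwards [Ioo_mem_nhdsGT hδ] with η hη using hη

lemma ph_tendsto (hs : |s| < 1) : Tendsto (ph ρ s) (𝓝[>] (0:ℝ)) (𝓝 0) := by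
  have := (ph_deriv (ρ := ρ) hs le_rfl zero_le_one).continuousAt.tendsto
  simp only [ph, mul_zero, zero_div] at this
  exact this.mono_left nhdsWithin_le_nhds

lemma rem_tendsto (hα : 0 < α) (hα2 : α < 2) (hs : |s| < 1) :
    Tendsto (fun η : ℝ => η ^ (-α) / α *
      (2 * (1 - η ^ 2) ^ (α / 2) - (1 + s * η) ^ α - (1 - s * η) ^ α)) (𝓝[>] (0:ℝ)) (𝓝 0) := by
  obtain ⟨C1, δ1, hC1, hδ1, -, t1⟩ := taylor_rpow one_pos (α / 2)
  obtain ⟨C2, δ2, hC2, hδ2, -, t2⟩ := taylor_rpow one_pos α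
  refine tz hα2 ((α + 2 * C1 + 2 * C2) / α) ?_
  filter_upwards [ev_small hδ1, ev_small hδ2, ev_small one_pos] with η h1 h2 h3
  have hs' := abs_lt.1 hs
  have hs2 : s ^ 2 ≤ 1 := by nlinarith
  have hη2 : η ^ 2 ≤ η := by nlinarith
  have k1 := abs_le.1 (t1 (-(η ^ 2)) (by rw [abs_neg, abs_of_nonneg (by positivity)]; linarith))
  have ks : |s * η| < δ2 := by
    rw [abs_mul, abs_of_pos h3.1]; nlinarith
  have k2 := abs_le.1 (t2 (s * η) ks)
  have k3 := abs_le.1 (t2 (-(s * η)) (by rwa [abs_neg]))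
  simp only [one_rpow, mul_one, ← sub_eq_add_neg] at k1 k2 k3
  have hη4 : (-(η ^ 2)) ^ 2 ≤ η ^ 2 := by nlinarith
  have m1 : C1 * (-(η ^ 2)) ^ 2 ≤ C1 * η ^ 2 := by gcongr
  have hsη : (s * η) ^ 2 ≤ η ^ 2 := by rw [mul_pow]; nlinarith [sq_nonneg η]
  have m2 : C2 * (s * η) ^ 2 ≤ C2 * η ^ 2 := by gcongr
  have m3 : C2 * (-(s * η)) ^ 2 ≤ C2 * η ^ 2 := by rw [neg_sq]; gcongr
  have key : |2 * (1 - η ^ 2) ^ (α / 2) - (1 + s * η) ^ α - (1 - s * η) ^ α| ≤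
      (α + 2 * C1 + 2 * C2) * η ^ 2 := by
    have : 0 ≤ α * η ^ 2 := by positivity
    rw [abs_le]; constructor <;> linarith [k1.1, k1.2, k2.1, k2.2, k3.1, k3.2]
  have e : η ^ (2 - α) = η ^ (-α) * η ^ 2 := by
    rw [← rpow_natCast, ← rpow_add h3.1]; congr 1; push_cast; ring
  have hpos : 0 < η ^ (-α) := rpow_pos_of_pos h3.1 _
  rw [abs_mul, abs_of_pos (by positivity), e]
  calc _ ≤ η ^ (-α) / α * ((α + 2 * C1 + 2 * C2) * η ^ 2) := by gcongr
    _ = _ := by ring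

lemma UU_lip (hρ : 0 < ρ) (hs : |s| < 1) : ∃ C δ : ℝ, 0 ≤ C ∧ 0 < δ ∧ ∀ r, 0 < r → r < δ →
    |UU β ρ s r - (ρ ^ 2 * (1 - s ^ 2)) ^ (-β)| ≤ C * r := by
  have hs2 := one_sub_sq_pos hs
  set d := ρ ^ 2 * (1 - s ^ 2) with hd
  have hd0 : 0 < d := by positivity
  obtain ⟨C, δ, hC, hδ, hδd, t⟩ := taylor_rpow hd0 (-β)
  have hq : 0 < 2 * ρ + 1 := by positivity
  refine ⟨|-β * d ^ (-β - 1)| * (2 * ρ + 1) + C * (2 * ρ + 1) ^ 2, min 1 (δ / (2 * ρ + 1)), by positivity,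
    by positivity, ?_⟩
  intro r hr hrδ
  have hr1 : r < 1 := hrδ.trans_le (min_le_left _ _)
  have hr2 : r < δ / (2 * ρ + 1) := hrδ.trans_le (min_le_right _ _)
  rw [lt_div_iff₀ hq] at hr2
  have hs' := abs_lt.1 hs
  set h := - 2 * (ρ * s) * r - r ^ 2 with hh
  have hab : |h| ≤ (2 * ρ + 1) * r := by
    have : |ρ * s * r| ≤ ρ * r := by
      rw [abs_mul, abs_mul, abs_of_pos hρ, abs_of_pos hr]
      have : ρ * |s| ≤ ρ * 1 := by gcongr
      nlinarith
    have := abs_le.1 this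
    have : r ^ 2 ≤ r := by nlinarith
    rw [abs_le]; constructor <;> nlinarith
  have hlt : |h| < δ := by linarith
  have e : d - 2 * (ρ * s) * r - r ^ 2 = d + h := by rw [hh]; ring
  have hpos : 0 < d + h := by have := abs_lt.1 hlt; linarith
  have : UU β ρ s r = (d + h) ^ (-β) := by
    unfold UU; rw [← hd, e, if_pos hpos]
  rw [this]
  have t1 := t h hlt
  have hsq : h ^ 2 ≤ (2 * ρ + 1) ^ 2 * r := by
    calc h ^ 2 = |h| ^ 2 := (sq_abs h).symm
      _ ≤ ((2 * ρ + 1) * r) ^ 2 := by gcongr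
      _ = (2 * ρ + 1) ^ 2 * (r * r) := by ring
      _ ≤ (2 * ρ + 1) ^ 2 * (r * 1) := by gcongr
      _ = _ := by ring
  calc |(d + h) ^ (-β) - d ^ (-β)|
      = |((d + h) ^ (-β) - d ^ (-β) - -β * d ^ (-β - 1) * h) + -β * d ^ (-β - 1) * h| := by congr 1; ring
    _ ≤ C * h ^ 2 + |-β * d ^ (-β - 1)| * |h| := by
        refine (abs_add_le _ _).trans ?_
        rw [abs_mul (-β * d ^ (-β - 1))]; gcongr
    _ ≤ C * ((2 * ρ + 1) ^ 2 * r) + |-β * d ^ (-β - 1)| * ((2 * ρ + 1) * r) := by gcongr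
    _ = _ := by ring

lemma E_tendsto (hα : 0 < α) (hα2 : α < 2) (hβ : β < 1) (hs : |s| < 1) (hρ : 0 < ρ) :
    Tendsto (fun η =>
      (∫ r in Ioi (ph ρ (-s) η), (UU β ρ s r - (ρ ^ 2 * (1 - s ^ 2)) ^ (-β)) * r ^ (-1 - α)) -
      (∫ r in Ioi (ph ρ s η), (UU β ρ s r - (ρ ^ 2 * (1 - s ^ 2)) ^ (-β)) * r ^ (-1 - α)))
      (𝓝[>] (0:ℝ)) (𝓝 0) := by
  obtain ⟨C, δ, hC, hδ, hl⟩ := UU_lip (β := β) hρ hs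
  have hs2 := one_sub_sq_pos hs
  have hsn : |-s| < 1 := by rwa [abs_neg]
  set q := ρ * (1 - s ^ 2) with hq
  have hq0 : 0 < q := by positivity
  refine tz hα2 (C * (q / 2) ^ (-α) * (4 * q)) ?_
  have hδ' : 0 < δ / (2 * q) := by positivity
  filter_upwards [ev_small (show (0:ℝ) < 1 / 2 by norm_num), ev_small hδ'] with η h1 h2
  obtain ⟨h0, h1⟩ := h1
  have hs' := abs_lt.1 hs
  have h2 := h2.2
  rw [lt_div_iff₀ (by positivity)] at h2
  -- bounds for ph
  have bd : ∀ t, |t| < 1 → t ^ 2 = s ^ 2 → q * η / 2 ≤ ph ρ t η ∧ ph ρ t η ≤ 2 * q * η := by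
    intro t ht hts
    have ht' := abs_lt.1 ht
    have hp := one_add_pos ht h0.le (by linarith)
    unfold ph
    rw [hts, ← hq, le_div_iff₀ hp, div_le_iff₀ hp]
    have : 0 < q * η := by positivity
    have a1 : 1 / 2 ≤ 1 + t * η := by nlinarith
    have a2 : 1 + t * η ≤ 2 := by nlinarith
    constructor <;> nlinarith
  have b1 := bd s hs rfl
  have b2 := bd (-s) hsn (by ring)
  obtain ⟨i1, -⟩ := J_formula hα hβ hs hρ h0 (by linarith : η < 1)
  set f := fun r => (UU β ρ s r - (ρ ^ 2 * (1 - s ^ 2)) ^ (-β)) * r ^ (-1 - α) with hf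
  have hq1 : 0 < q * η / 2 := by positivity
  have hfb : ∀ r, q * η / 2 ≤ r → r ≤ 2 * q * η → ‖f r‖ ≤ C * (q * η / 2) ^ (-α) := by
    intro r hr1 hr2
    have hr0 : 0 < r := by linarith
    rw [hf, norm_eq_abs, abs_mul, abs_of_pos (rpow_pos_of_pos hr0 _)]
    calc _ ≤ (C * r) * r ^ (-1 - α) := by
          gcongr; exact hl r hr0 (by linarith)
      _ = C * r ^ (-α) := by
          have : r ^ (-α) = r ^ (-1 - α) * r := by rw [← rpow_add_one hr0.ne']; congr 1; ring
          rw [this]; ring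
      _ ≤ _ := by
          gcongr C * ?_
          exact rpow_le_rpow_of_nonpos hq1 hr1 (by linarith)
  have i2 : IntegrableOn f (Ioi (ph ρ (-s) η)) := by
    have hsub : Ioi (ph ρ (-s) η) ⊆ Icc (ph ρ (-s) η) (ph ρ s η) ∪ Ioi (ph ρ s η) := by
      intro r hr
      by_cases h : r ≤ ph ρ s η
      · exact Or.inl ⟨le_of_lt hr, h⟩
      · exact Or.inr (not_le.1 h)
    refine (IntegrableOn.union ?_ i1).mono_set hsub
    refine Measure.integrableOn_of_bounded (M := C * (q * η / 2) ^ (-α)) ?_ ?_ ?_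
    · simp
    · exact (((UU_measurable.sub_const _).mul (by fun_prop))).aestronglyMeasurable
    · refine (ae_restrict_iff' measurableSet_Icc).2 (Eventually.of_forall fun r hr => ?_)
      exact hfb r (b2.1.trans hr.1) (hr.2.trans b1.2)
  rw [intervalIntegral.integral_Ioi_sub_Ioi' i2 i1]
  have hb := intervalIntegral.norm_integral_le_of_norm_le_const (f := f) (a := ph ρ (-s) η) (b := ph ρ s η)
    (C := C * (q * η / 2) ^ (-α)) ?_
  · have hlen : |ph ρ s η - ph ρ (-s) η| ≤ 4 * q * η ^ 2 := by
      have p1 := one_add_pos hs h0.le (by linarith)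
      have p2 := one_add_pos hsn h0.le (by linarith)
      have : ph ρ s η - ph ρ (-s) η = q * η * (-2 * s * η) / ((1 + s * η) * (1 + -s * η)) := by
        unfold ph; rw [neg_sq, ← hq, div_sub_div _ _ p1.ne' p2.ne']; congr 1; ring
      have hη0 : 0 < η ^ 2 := by positivity
      have hden : 1 / 2 ≤ (1 + s * η) * (1 + -s * η) := by nlinarith
      rw [this, abs_div, abs_of_pos (mul_pos p1 p2), div_le_iff₀ (mul_pos p1 p2)]
      have : |q * η * (-2 * s * η)| ≤ 2 * q * η ^ 2 := by
        have : q * η * (-2 * s * η) = (2 * q * η ^ 2) * (-s) := by ring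
        rw [this, abs_mul, abs_of_pos (by positivity)]
        have : (2 * q * η ^ 2) * |-s| ≤ (2 * q * η ^ 2) * 1 := by gcongr
        linarith
      have : 0 < q * η ^ 2 := by positivity
      nlinarith
    rw [norm_eq_abs] at hb
    refine hb.trans ?_
    have e : η ^ (2 - α) = η ^ (-α) * η ^ 2 := by
      rw [← rpow_natCast, ← rpow_add h0]; congr 1; push_cast; ring
    have e2 : (q * η / 2) ^ (-α) = (q / 2) ^ (-α) * η ^ (-α) := by
      rw [← mul_rpow (by positivity) h0.le]; congr 1; ring
    rw [e, e2]
    calc _ ≤ C * ((q / 2) ^ (-α) * η ^ (-α)) * (4 * q * η ^ 2) := by gcongr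
      _ = _ := by ring
  · intro r hr
    rw [mem_uIoc] at hr
    rcases hr with hr | hr
    · exact hfb r (by linarith [b2.1, hr.1]) (by linarith [b1.2, hr.2])
    · exact hfb r (by linarith [b1.1, hr.1]) (by linarith [b2.2, hr.2])

theorem oneD (hα : 0 < α) (hα2 : α < 2) (hβ1 : -α / 2 < β) (hβ : β < 1) (hs : |s| < 1) (hρ : 0 < ρ)
    (hI : IntegrableOn (fun r => (UU β ρ s r + UU β ρ (-s) r - 2 * (ρ ^ 2 * (1 - s ^ 2)) ^ (-β)) *
      r ^ (-1 - α)) (Ioi 0)) :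
    ∫ r in Ioi (0:ℝ), (UU β ρ s r + UU β ρ (-s) r - 2 * (ρ ^ 2 * (1 - s ^ 2)) ^ (-β)) * r ^ (-1 - α) =
      2 * KK α β ρ s * HH α (α + 2 * β - 2) s := by
  have hsn : |-s| < 1 := by rwa [abs_neg]
  have T1 := tendsto_setInt hI (fun η => Ioi (ph ρ s η)) (fun _ => measurableSet_Ioi) (by
    refine (ae_restrict_iff' measurableSet_Ioi).2 (Eventually.of_forall fun r hr => ?_)
    exact (ph_tendsto hs).eventually_lt_const hr)
  have hIn1 := (HH_bounds hα hα2 (by linarith : -2 < α + 2 * β - 2) (by linarith)).1 s hs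
  have T2 := tendsto_setInt hIn1 (fun η => Ioo η 1) (fun _ => measurableSet_Ioo) (by
    refine (ae_restrict_iff' measurableSet_Ioo).2 (Eventually.of_forall fun r hr => ?_)
    filter_upwards [ev_small hr.1] with η hη using ⟨hη.2, hr.2⟩)
  have T3 := rem_tendsto hα hα2 hs
  have T4 := E_tendsto (β := β) hα hα2 hβ hsn hρ
  have T5 := (((T2.const_mul 2).add T3).const_mul (KK α β ρ s)).add T4
  have : 2 * KK α β ρ s * HH α (α + 2 * β - 2) s =
      KK α β ρ s * (2 * HH α (α + 2 * β - 2) s + 0) + 0 := by ring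
  rw [this]
  refine tendsto_nhds_unique T1 (T5.congr' ?_)
  filter_upwards [ev_small one_pos] with η hη
  obtain ⟨h0, h1⟩ := hη
  have hp := ph_pos hρ hs h0 h1.le
  have r1 : (volume.restrict (Ioi (0:ℝ))).restrict (Ioi (ph ρ s η)) = volume.restrict (Ioi (ph ρ s η)) := by
    rw [Measure.restrict_restrict measurableSet_Ioi]
    congr 1
    exact inter_eq_left.2 (Ioi_subset_Ioi hp.le)
  have r2 : (volume.restrict (Ioo (0:ℝ) 1)).restrict (Ioo η 1) = volume.restrict (Ioo η 1) := by
    rw [Measure.restrict_restrict measurableSet_Ioo]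
    congr 1
    exact inter_eq_left.2 (Ioo_subset_Ioo_left h0.le)
  rw [r1, r2]
  obtain ⟨i1, e1⟩ := J_formula (α := α) hα hβ hs hρ h0 h1
  obtain ⟨i2, e2⟩ := J_formula (α := α) hα hβ hsn hρ h0 h1
  have i3 := hI.mono_set (Ioi_subset_Ioi hp.le)
  have gs := gg_sum hα hβ hs h0 h1
  have kk : KK α β ρ (-s) = KK α β ρ s := by simp [KK]
  simp only [neg_neg]
  have i4 : IntegrableOn (fun r => (UU β ρ (-s) r - (ρ ^ 2 * (1 - (-s) ^ 2)) ^ (-β)) * r ^ (-1 - α))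
      (Ioi (ph ρ s η)) := by
    refine (i3.sub i1).congr_fun ?_ measurableSet_Ioi
    intro r hr
    simp only [Pi.sub_apply, neg_sq]
    ring
  have e3 : ∫ r in Ioi (ph ρ s η), (UU β ρ s r + UU β ρ (-s) r - 2 * (ρ ^ 2 * (1 - s ^ 2)) ^ (-β)) *
      r ^ (-1 - α) = (∫ r in Ioi (ph ρ s η), (UU β ρ s r - (ρ ^ 2 * (1 - s ^ 2)) ^ (-β)) * r ^ (-1 - α)) +
      ∫ r in Ioi (ph ρ s η), (UU β ρ (-s) r - (ρ ^ 2 * (1 - (-s) ^ 2)) ^ (-β)) * r ^ (-1 - α) := by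
    rw [← integral_add i1 i4]
    congr 1
    ext r
    simp only [neg_sq]; ring
  rw [e3, e1, e2, kk]
  have e4 : 1 + -s * η = 1 - s * η := by ring
  rw [e4]
  have gs' : (∫ w in Ioo η 1, gg α β s w) = 2 * (∫ w in Ioo η 1, TT α w * (hh (α + 2 * β - 2) s w - 1)) +
        2 * ((1 - η ^ 2) ^ (α / 2) * η ^ (-α) / α) - (∫ w in Ioo η 1, gg α β (-s) w) := by linarith
  rw [gs']
  field_simp
  ring
end

lemma polar {E : Type*} [NormedAddCommGroup E] [NormedSpace ℝ E] [FiniteDimensional ℝ E]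
    [MeasurableSpace E] [BorelSpace E] [Nontrivial E] (μ : Measure E) [μ.IsAddHaarMeasure]
    {F : E → ℝ} (hF : Integrable F μ) :
    (∀ᵐ θ : sphere (0:E) 1 ∂μ.toSphere, IntegrableOn (fun r : ℝ => r ^ (Module.finrank ℝ E - 1) * F (r • (θ : E))) (Ioi 0)) ∧
    Integrable (fun θ : sphere (0:E) 1 =>
      ∫ r in Ioi (0:ℝ), r ^ (Module.finrank ℝ E - 1) * F (r • (θ : E))) μ.toSphere ∧
    ∫ x, F x ∂μ = ∫ θ : sphere (0:E) 1,
      (∫ r in Ioi (0:ℝ), r ^ (Module.finrank ℝ E - 1) * F (r • (θ : E))) ∂μ.toSphere := by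
  set G : sphere (0:E) 1 × Ioi (0:ℝ) → ℝ := fun p => F ((p.2 : ℝ) • (p.1 : E)) with hG
  have hcomp : G ∘ (homeomorphUnitSphereProd E) = F ∘ ((↑) : ({0}ᶜ : Set E) → E) := by
    ext x
    have := congrArg Subtype.val ((homeomorphUnitSphereProd E).symm_apply_apply x)
    simp only [homeomorphUnitSphereProd_symm_apply_coe] at this
    simp only [Function.comp, hG, this]
  have mp := μ.measurePreserving_homeomorphUnitSphereProd
  have emb := (homeomorphUnitSphereProd E).measurableEmbedding
  have iG : Integrable G (μ.toSphere.prod (Measure.volumeIoiPow (Module.finrank ℝ E - 1))) := by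
    rw [← mp.integrable_comp_emb emb, hcomp, ← integrableOn_iff_comap_subtypeVal (measurableSet_singleton _).compl]
    exact hF.integrableOn
  have eG : ∫ x, F x ∂μ = ∫ p, G p ∂(μ.toSphere.prod (Measure.volumeIoiPow (Module.finrank ℝ E - 1))) := by
    rw [← mp.integral_comp emb]
    change _ = ∫ x, (G ∘ (homeomorphUnitSphereProd E)) x ∂_
    rw [hcomp]
    simp only [Function.comp]
    rw [integral_subtype_comap (measurableSet_singleton _).compl F, restrict_compl_singleton]
  have inner : ∀ f : ℝ → ℝ, ∫ r : Ioi (0:ℝ), f r ∂(Measure.volumeIoiPow (Module.finrank ℝ E - 1)) =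
      ∫ r in Ioi (0:ℝ), r ^ (Module.finrank ℝ E - 1) * f r := by
    intro f
    simp only [Measure.volumeIoiPow, ENNReal.ofReal]
    rw [integral_withDensity_eq_integral_smul,
        integral_subtype_comap measurableSet_Ioi fun a ↦ Real.toNNReal (a ^ (Module.finrank ℝ E - 1)) • f a,
        setIntegral_congr_fun measurableSet_Ioi fun x hx ↦ ?_]
    · rw [NNReal.smul_def, Real.coe_toNNReal _ (pow_nonneg hx.out.le _), smul_eq_mul]
    · exact (measurable_subtype_coe.pow_const _).real_toNNReal
  have innerI : ∀ f : ℝ → ℝ, Integrable (fun r : Ioi (0:ℝ) => f r) (Measure.volumeIoiPow (Module.finrank ℝ E - 1)) →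
      IntegrableOn (fun r : ℝ => r ^ (Module.finrank ℝ E - 1) * f r) (Ioi (0:ℝ)) := by
    intro f hf
    rw [Measure.volumeIoiPow, integrable_withDensity_iff_integrable_smul'] at hf
    · rw [integrableOn_iff_comap_subtypeVal measurableSet_Ioi]
      refine hf.congr (.of_forall ?_)
      rintro ⟨x, hx : 0 < x⟩
      simp (disch := positivity) [ENNReal.toReal_ofReal]
    · fun_prop
    · simp
  refine ⟨?_, ?_, ?_⟩
  · filter_upwards [iG.prod_right_ae] with θ hθ
    exact innerI (fun r => F (r • (θ : E))) hθ
  · refine iG.integral_prod_left.congr (.of_forall fun θ => ?_)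
    exact inner (fun r => F (r • (θ : E)))
  · rw [eG, integral_prod _ iG]
    refine integral_congr_ae (.of_forall fun θ => ?_)
    exact inner (fun r => F (r • (θ : E)))

/-- The function `(1-|x|^2)^{-β}` on the unit ball. -/
def uu {N : ℕ} (β : ℝ) (x : EuclideanSpace ℝ (Fin N)) : ℝ :=
  if ‖x‖ < 1 then (1 - ‖x‖ ^ 2) ^ (-β) else 0

/-- The radial weight. -/
def WW {N : ℕ} (α : ℝ) (x : EuclideanSpace ℝ (Fin N)) : ℝ := ‖x‖ ^ (-((N : ℝ) + α))

/-- Symmetric second difference. -/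
def DD {N : ℕ} (β : ℝ) (x z : EuclideanSpace ℝ (Fin N)) : ℝ := uu β (x + z) + uu β (x - z) - 2 * uu β x

section
variable {N : ℕ} {α β : ℝ}

lemma uu_measurable : Measurable (uu (N := N) β) := by
  unfold uu
  refine Measurable.ite ?_ (by fun_prop) measurable_const
  exact measurableSet_lt measurable_norm measurable_const

lemma WW_measurable : Measurable (WW (N := N) α) := by
  unfold WW; fun_prop

lemma uu_integrable (hN : 3 ≤ N) (hβ : β < 1) : Integrable (uu (N := N) β) := by
  haveI : Nonempty (Fin N) := ⟨⟨0, by omega⟩⟩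
  have := (integrable_fun_norm_addHaar (E := EuclideanSpace ℝ (Fin N)) volume
    (f := fun t : ℝ => if t < 1 then (1 - t ^ 2) ^ (-β) else 0))
  refine this.2 ?_
  have hb := beta2_integrable (a := (N : ℝ)) (c := 1 - β) (by positivity) (by linarith)
  refine IntegrableOn.of_forall_sdiff_eq_zero (s := Ioo 0 1) ?_ measurableSet_Ioi ?_
  · refine hb.congr_fun ?_ measurableSet_Ioo
    intro w hw
    have e1 : 1 - β - 1 = -β := by ring
    have e2 : w ^ ((N : ℝ) - 1) = w ^ (N - 1) := by
      rw [← rpow_natCast]; congr 1; push_cast [Nat.cast_sub (by omega : 1 ≤ N)]; ring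
    simp only [hw.2, if_true, finrank_euclideanSpace, Fintype.card_fin, smul_eq_mul, e1, e2]
  · intro w hw
    have : ¬ w < 1 := fun h => hw.2 ⟨hw.1, h⟩
    simp [this]

lemma WW_far (hα : 0 < α) {δ : ℝ} (hδ : 0 < δ) :
    IntegrableOn (WW (N := N) α) {z | δ ≤ ‖z‖} := by
  have h1 := (integrable_one_add_norm (E := EuclideanSpace ℝ (Fin N)) (μ := volume) (r := (N : ℝ) + α)
    (by simpa using hα))
  have h2 := (h1.const_mul ((δ / (1 + δ)) ^ (-((N : ℝ) + α)))).integrableOn (s := {z | δ ≤ ‖z‖})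
  refine Integrable.mono' h2 WW_measurable.aestronglyMeasurable ?_
  refine (ae_restrict_iff' (measurableSet_le measurable_const measurable_norm)).2
    (Eventually.of_forall fun z hz => ?_)
  have hz : δ ≤ ‖z‖ := hz
  have hz0 : 0 < ‖z‖ := by linarith
  unfold WW
  rw [norm_eq_abs, abs_of_pos (rpow_pos_of_pos hz0 _), ← mul_rpow (by positivity) (by positivity)]
  refine rpow_le_rpow_of_nonpos (by positivity) ?_ (by have : (0:ℝ) ≤ N := by positivity
                                                       linarith)
  rw [div_mul_eq_mul_div, div_le_iff₀ (by positivity)]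
  nlinarith

lemma uW_far (hN : 3 ≤ N) (hα : 0 < α) (hβ : β < 1) {v : EuclideanSpace ℝ (Fin N) → ℝ} (hv : Integrable v)
    {δ : ℝ} (hδ : 0 < δ) :
    IntegrableOn (fun z => v z * WW (N := N) α z) {z | δ ≤ ‖z‖} := by
  refine hv.integrableOn.mul_bdd (c := δ ^ (-((N : ℝ) + α))) WW_measurable.aestronglyMeasurable ?_
  refine (ae_restrict_iff' (measurableSet_le measurable_const measurable_norm)).2
    (Eventually.of_forall fun z hz => ?_)
  have hz : δ ≤ ‖z‖ := hz
  have hz0 : 0 < ‖z‖ := by linarith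
  unfold WW
  rw [norm_eq_abs, abs_of_pos (rpow_pos_of_pos hz0 _)]
  exact rpow_le_rpow_of_nonpos hδ hz (by have : (0:ℝ) ≤ N := by positivity
                                         linarith)

lemma A_far (hN : 3 ≤ N) (hα : 0 < α) (hβ : β < 1) (x : EuclideanSpace ℝ (Fin N)) {δ : ℝ} (hδ : 0 < δ) :
    IntegrableOn (fun z => (uu β (x + z) - uu β x) * WW (N := N) α z) {z | δ ≤ ‖z‖} := by
  have h1 := uW_far hN hα hβ ((uu_integrable hN hβ).comp_add_left x) hδ
  have h2 : IntegrableOn (fun z => uu β x * WW (N := N) α z) {z | δ ≤ ‖z‖} := (WW_far hα hδ).const_mul _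
  have := h1.sub h2
  refine this.congr (Eventually.of_forall fun z => ?_)
  simp only [Pi.sub_apply]; ring

lemma B_far (hN : 3 ≤ N) (hα : 0 < α) (hβ : β < 1) (x : EuclideanSpace ℝ (Fin N)) {δ : ℝ} (hδ : 0 < δ) :
    IntegrableOn (fun z => (uu β (x - z) - uu β x) * WW (N := N) α z) {z | δ ≤ ‖z‖} := by
  have h1 := uW_far hN hα hβ ((uu_integrable hN hβ).comp_sub_left x) hδ
  have h2 : IntegrableOn (fun z => uu β x * WW (N := N) α z) {z | δ ≤ ‖z‖} := (WW_far hα hδ).const_mul _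
  have := h1.sub h2
  refine this.congr (Eventually.of_forall fun z => ?_)
  simp only [Pi.sub_apply]; ring

lemma uu_of_pos {y : EuclideanSpace ℝ (Fin N)} {t : ℝ} (h : 1 - ‖y‖ ^ 2 = t) :
    uu β y = if 0 < t then t ^ (-β) else 0 := by
  have : ‖y‖ < 1 ↔ 0 < t := by
    rw [← h]; constructor
    · intro h1; nlinarith [norm_nonneg y]
    · intro h1; nlinarith [norm_nonneg y]
  unfold uu
  simp only [this, h]

lemma DD_near {x : EuclideanSpace ℝ (Fin N)} (hx : ‖x‖ < 1) : ∃ C δ : ℝ, 0 ≤ C ∧ 0 < δ ∧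
    ∀ z, ‖z‖ < δ → |DD β x z| ≤ C * ‖z‖ ^ 2 := by
  set d := 1 - ‖x‖ ^ 2 with hd
  have hd0 : 0 < d := by nlinarith [norm_nonneg x]
  obtain ⟨C, δ, hC, hδ, hδd, t⟩ := taylor_rpow hd0 (-β)
  refine ⟨2 * |-β * d ^ (-β - 1)| + 18 * C, min 1 (δ / 3), by positivity, by positivity, ?_⟩
  intro z hz
  have hz1 : ‖z‖ < 1 := hz.trans_le (min_le_left _ _)
  have hz2 : ‖z‖ < δ / 3 := hz.trans_le (min_le_right _ _)
  have hz0 := norm_nonneg z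
  have hin : |inner ℝ x z| ≤ ‖z‖ := by
    refine (abs_real_inner_le_norm x z).trans ?_
    nlinarith
  have hin' := abs_le.1 hin
  set b := inner ℝ x z with hb
  have q1 : 1 - ‖x + z‖ ^ 2 = d + (-2 * b - ‖z‖ ^ 2) := by
    rw [norm_add_sq_real, hd]; ring
  have q2 : 1 - ‖x - z‖ ^ 2 = d + (2 * b - ‖z‖ ^ 2) := by
    rw [norm_sub_sq_real, hd]; ring
  have hzz : ‖z‖ ^ 2 ≤ ‖z‖ := by nlinarith
  have a1 : |(-2 * b - ‖z‖ ^ 2)| ≤ 3 * ‖z‖ := by rw [abs_le]; constructor <;> nlinarith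
  have a2 : |(2 * b - ‖z‖ ^ 2)| ≤ 3 * ‖z‖ := by rw [abs_le]; constructor <;> nlinarith
  have l1 : |(-2 * b - ‖z‖ ^ 2)| < δ := by linarith
  have l2 : |(2 * b - ‖z‖ ^ 2)| < δ := by linarith
  have t1 := t _ l1
  have t2 := t _ l2
  have s1 : C * (-2 * b - ‖z‖ ^ 2) ^ 2 ≤ C * (9 * ‖z‖ ^ 2) := by
    have : (-2 * b - ‖z‖ ^ 2) ^ 2 ≤ (3 * ‖z‖) ^ 2 := sq_le_sq' (abs_le.1 a1).1 (abs_le.1 a1).2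
    gcongr; linarith
  have s2 : C * (2 * b - ‖z‖ ^ 2) ^ 2 ≤ C * (9 * ‖z‖ ^ 2) := by
    have : (2 * b - ‖z‖ ^ 2) ^ 2 ≤ (3 * ‖z‖) ^ 2 := sq_le_sq' (abs_le.1 a2).1 (abs_le.1 a2).2
    gcongr; linarith
  have p1 : 0 < d + (-2 * b - ‖z‖ ^ 2) := by have := abs_lt.1 l1; linarith
  have p2 : 0 < d + (2 * b - ‖z‖ ^ 2) := by have := abs_lt.1 l2; linarith
  unfold DD
  rw [uu_of_pos q1, uu_of_pos q2, uu_of_pos hd.symm, if_pos p1, if_pos p2, if_pos hd0]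
  set c := -β * d ^ (-β - 1) with hc
  have t1' := abs_le.1 (t1.trans s1)
  have t2' := abs_le.1 (t2.trans s2)
  have hcz : |c * ‖z‖ ^ 2| ≤ |c| * ‖z‖ ^ 2 := by
    rw [abs_mul, abs_of_nonneg (sq_nonneg ‖z‖)]
  have hcz' := abs_le.1 hcz
  rw [abs_le]
  constructor <;> nlinarith [t1'.1, t1'.2, t2'.1, t2'.2, hcz'.1, hcz'.2]

lemma DD_measurable (x : EuclideanSpace ℝ (Fin N)) : Measurable (DD β x) := by
  unfold DD
  exact ((uu_measurable.comp (measurable_const_add x)).add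
    (uu_measurable.comp (measurable_const_sub x))).sub_const _

lemma DW_integrable (hN : 3 ≤ N) (hα : 0 < α) (hα2 : α < 2) (hβ : β < 1)
    {x : EuclideanSpace ℝ (Fin N)} (hx : ‖x‖ < 1) :
    Integrable (fun z => DD β x z * WW α z) := by
  obtain ⟨C, δ, hC, hδ, h⟩ := DD_near (β := β) hx
  have n1 : IntegrableOn (fun z => DD β x z * WW α z) (ball 0 δ) := by
    refine integrableOn_ball_of_norm_le_rpow (C := C) (α := (N : ℝ) + α - 2) (by simp; omega)
      (by simp; linarith) ?_ ((DD_measurable x).mul WW_measurable).aestronglyMeasurable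
    refine (ae_restrict_iff' measurableSet_ball).2 (Eventually.of_forall fun z hz => ?_)
    rw [mem_ball_zero_iff] at hz
    rw [norm_eq_abs, abs_mul]
    rcases (norm_nonneg z).eq_or_lt with h0 | h0
    · have : DD β x z = 0 := by
        have := h z hz
        rw [← h0] at this
        simpa using this
      rw [this, abs_zero, zero_mul]
      positivity
    · unfold WW
      rw [abs_of_pos (rpow_pos_of_pos h0 _)]
      have e : ‖z‖ ^ (-((N : ℝ) + α - 2)) = ‖z‖ ^ 2 * ‖z‖ ^ (-((N : ℝ) + α)) := by
        rw [← rpow_natCast, ← rpow_add h0]; congr 1; push_cast; ring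
      rw [e, ← mul_assoc]
      gcongr
      exact h z hz
  have n2 : IntegrableOn (fun z => DD β x z * WW α z) {z | δ ≤ ‖z‖} := by
    refine ((A_far hN hα hβ x hδ).add (B_far hN hα hβ x hδ)).congr (Eventually.of_forall fun z => ?_)
    simp only [Pi.add_apply, DD]; ring
  rw [← integrableOn_univ]
  refine (n1.union n2).mono_set ?_
  intro z _
  by_cases hz : ‖z‖ < δ
  · exact Or.inl (by simpa using hz)
  · exact Or.inr (not_lt.1 hz)

lemma PV_limit (hN : 3 ≤ N) (hα : 0 < α) (hα2 : α < 2) (hβ : β < 1)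
    {x : EuclideanSpace ℝ (Fin N)} (hx : ‖x‖ < 1) :
    Tendsto (fun ε : ℝ => ∫ y in {y : EuclideanSpace ℝ (Fin N) | ε < dist y x},
      (uu β y - uu β x) / dist y x ^ ((N : ℝ) + α))
    (𝓝[>] (0 : ℝ)) (𝓝 ((∫ z, DD β x z * WW α z) / 2)) := by
  have T := (tendsto_setInt (DW_integrable (β := β) hN hα hα2 hβ hx) (fun ε => {z | ε < ‖z‖})
    (fun ε => measurableSet_lt measurable_const measurable_norm) (by
      haveI : Nonempty (Fin N) := ⟨⟨0, by omega⟩⟩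
      filter_upwards [compl_mem_ae_iff.2 (measure_singleton (0 : EuclideanSpace ℝ (Fin N)))] with z hz
      have : 0 < ‖z‖ := norm_pos_iff.2 hz
      filter_upwards [ev_small this] with ε hε using hε.2)).div_const 2
  refine T.congr' ?_
  filter_upwards [ev_small one_pos] with ε hε
  have hsub : {z : EuclideanSpace ℝ (Fin N) | ε < ‖z‖} ⊆ {z | ε ≤ ‖z‖} := by
    intro z hz
    have hz : ε < ‖z‖ := hz
    exact hz.le
  have iA := (A_far hN hα hβ x hε.1).mono_set hsub
  have iB := (B_far hN hα hβ x hε.1).mono_set hsub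
  have eAB : ∫ z in {z : EuclideanSpace ℝ (Fin N) | ε < ‖z‖}, DD β x z * WW α z =
      (∫ z in {z : EuclideanSpace ℝ (Fin N) | ε < ‖z‖}, (uu β (x + z) - uu β x) * WW α z) +
      ∫ z in {z : EuclideanSpace ℝ (Fin N) | ε < ‖z‖}, (uu β (x - z) - uu β x) * WW α z := by
    rw [← integral_add iA iB]
    congr 1; ext z; simp only [DD]; ring
  have eBA : ∫ z in {z : EuclideanSpace ℝ (Fin N) | ε < ‖z‖}, (uu β (x - z) - uu β x) * WW α z =
      ∫ z in {z : EuclideanSpace ℝ (Fin N) | ε < ‖z‖}, (uu β (x + z) - uu β x) * WW α z := by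
    have := (Measure.measurePreserving_neg (volume : Measure (EuclideanSpace ℝ (Fin N)))).setIntegral_preimage_emb
      (MeasurableEquiv.neg _).measurableEmbedding (fun z => (uu β (x + z) - uu β x) * WW α z)
      {z : EuclideanSpace ℝ (Fin N) | ε < ‖z‖}
    simpa [WW, ← sub_eq_add_neg] using this
  have eT := (measurePreserving_add_left (volume : Measure (EuclideanSpace ℝ (Fin N))) x).setIntegral_preimage_emb
      (MeasurableEquiv.addLeft x).measurableEmbedding
      (fun y => (uu β y - uu β x) / dist y x ^ ((N : ℝ) + α))
      {y : EuclideanSpace ℝ (Fin N) | ε < dist y x}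
  rw [eAB, eBA, ← eT]
  simp only [preimage_setOf_eq, dist_eq_norm, add_sub_cancel_left]
  rw [add_self_div_two]
  congr 1
  ext z
  rw [WW, rpow_neg (norm_nonneg z), div_eq_mul_inv]
end

/-- The half-chord length. -/
def rho {N : ℕ} (x θ : EuclideanSpace ℝ (Fin N)) : ℝ := √(1 - ‖x‖ ^ 2 + (inner ℝ x θ) ^ 2)

section
variable {N : ℕ} {α β : ℝ}

lemma rho_facts {x θ : EuclideanSpace ℝ (Fin N)} (hx : ‖x‖ < 1) (hθ : ‖θ‖ = 1) :
    0 < rho x θ ∧ rho x θ ≤ 1 ∧ rho x θ ^ 2 = 1 - ‖x‖ ^ 2 + (inner ℝ x θ) ^ 2 := by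
  have hd0 : 0 < 1 - ‖x‖ ^ 2 := by nlinarith [norm_nonneg x]
  have hp : 0 < 1 - ‖x‖ ^ 2 + (inner ℝ x θ) ^ 2 := by positivity
  refine ⟨Real.sqrt_pos.2 hp, ?_, Real.sq_sqrt hp.le⟩
  refine Real.sqrt_le_one.2 ?_
  have := abs_real_inner_le_norm x θ
  rw [hθ, mul_one] at this
  have := sq_le_sq' (by linarith [(abs_le.1 this).1]) (abs_le.1 this).2
  linarith

lemma s_facts {x θ : EuclideanSpace ℝ (Fin N)} (hx : ‖x‖ < 1) (hθ : ‖θ‖ = 1) :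
    |inner ℝ x θ / rho x θ| < 1 ∧ rho x θ ^ 2 * (1 - (inner ℝ x θ / rho x θ) ^ 2) = 1 - ‖x‖ ^ 2 ∧
      rho x θ * (inner ℝ x θ / rho x θ) = inner ℝ x θ := by
  obtain ⟨h0, h1, h2⟩ := rho_facts hx hθ
  have hd0 : 0 < 1 - ‖x‖ ^ 2 := by nlinarith [norm_nonneg x]
  refine ⟨?_, ?_, by field_simp⟩
  · rw [abs_div, abs_of_pos h0, div_lt_one h0]
    exact abs_lt_of_sq_lt_sq (by linarith) h0.le
  · field_simp; linarith

lemma DD_ray {x θ : EuclideanSpace ℝ (Fin N)} (hx : ‖x‖ < 1) (hθ : ‖θ‖ = 1) (r : ℝ) :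
    DD β x (r • θ) = UU β (rho x θ) (inner ℝ x θ / rho x θ) r + UU β (rho x θ) (-(inner ℝ x θ / rho x θ)) r
      - 2 * (rho x θ ^ 2 * (1 - (inner ℝ x θ / rho x θ) ^ 2)) ^ (-β) := by
  obtain ⟨s1, s2, s3⟩ := s_facts hx hθ
  have hd0 : 0 < 1 - ‖x‖ ^ 2 := by nlinarith [norm_nonneg x]
  have nr : ‖r • θ‖ ^ 2 = r ^ 2 := by rw [norm_smul, hθ, mul_one, norm_eq_abs, sq_abs]
  have q1 : 1 - ‖x + r • θ‖ ^ 2 = 1 - ‖x‖ ^ 2 - 2 * inner ℝ x θ * r - r ^ 2 := by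
    rw [norm_add_sq_real, nr, inner_smul_right]; ring
  have q2 : 1 - ‖x - r • θ‖ ^ 2 = 1 - ‖x‖ ^ 2 - 2 * (-inner ℝ x θ) * r - r ^ 2 := by
    rw [norm_sub_sq_real, nr, inner_smul_right]; ring
  unfold DD UU
  rw [neg_sq, mul_neg, s2, s3, uu_of_pos q1, uu_of_pos q2, uu_of_pos (y := x) rfl, if_pos hd0]

lemma KK_rho {x θ : EuclideanSpace ℝ (Fin N)} (hx : ‖x‖ < 1) (hθ : ‖θ‖ = 1) :
    KK α β (rho x θ) (inner ℝ x θ / rho x θ) = rho x θ ^ α * (1 - ‖x‖ ^ 2) ^ (-(α + β)) := by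
  obtain ⟨s1, s2, s3⟩ := s_facts hx hθ
  obtain ⟨h0, h1, h2⟩ := rho_facts hx hθ
  have hp := one_sub_sq_pos s1
  rw [← s2, mul_rpow (by positivity) hp.le, ← rpow_natCast, ← rpow_mul h0.le, ← mul_assoc,
    ← rpow_add h0]
  unfold KK
  congr 2
  push_cast; ring

lemma ray_integrand (hN : 3 ≤ N) {x θ : EuclideanSpace ℝ (Fin N)} (hθ : ‖θ‖ = 1) {r : ℝ}
    (hr : 0 < r) :
    r ^ (Module.finrank ℝ (EuclideanSpace ℝ (Fin N)) - 1) * (DD β x (r • θ) * WW α (r • θ)) =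
      DD β x (r • θ) * r ^ (-1 - α) := by
  have e : r ^ (-1 - α) = r ^ (N - 1) * r ^ (-((N : ℝ) + α)) := by
    rw [← rpow_natCast, ← rpow_add hr]; congr 1; push_cast [Nat.cast_sub (by omega : 1 ≤ N)]; ring
  unfold WW
  rw [norm_smul, hθ, mul_one, norm_eq_abs, abs_of_pos hr, e]
  simp only [finrank_euclideanSpace, Fintype.card_fin]
  ring

theorem sphere_formula (hN : 3 ≤ N) (hα : 0 < α) (hα2 : α < 2) (hβ1 : -α / 2 < β) (hβ : β < 1)
    {x : EuclideanSpace ℝ (Fin N)} (hx : ‖x‖ < 1) :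
    ∃ G : sphere (0 : EuclideanSpace ℝ (Fin N)) 1 → ℝ,
      Integrable G (volume : Measure (EuclideanSpace ℝ (Fin N))).toSphere ∧
      (∀ᵐ θ ∂(volume : Measure (EuclideanSpace ℝ (Fin N))).toSphere,
        G θ = 2 * (rho x θ ^ α * (1 - ‖x‖ ^ 2) ^ (-(α + β))) *
          HH α (α + 2 * β - 2) (inner ℝ x (θ : EuclideanSpace ℝ (Fin N)) / rho x θ)) ∧
      ∫ z, DD β x z * WW α z = ∫ θ, G θ ∂(volume : Measure (EuclideanSpace ℝ (Fin N))).toSphere := by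
  haveI : Nonempty (Fin N) := ⟨⟨0, by omega⟩⟩
  obtain ⟨p1, p2, p3⟩ := polar volume (DW_integrable (β := β) hN hα hα2 hβ hx)
  refine ⟨_, p2, ?_, p3⟩
  filter_upwards [p1] with θ hθI
  have hθ : ‖(θ : EuclideanSpace ℝ (Fin N))‖ = 1 := by simpa using θ.2
  obtain ⟨s1, s2, s3⟩ := s_facts hx hθ
  obtain ⟨h0, h1, h2⟩ := rho_facts hx hθ
  have hI := hθI.congr_fun (g := fun r => (UU β (rho x θ) (inner ℝ x (θ : EuclideanSpace ℝ (Fin N)) / rho x θ) r +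
      UU β (rho x θ) (-(inner ℝ x (θ : EuclideanSpace ℝ (Fin N)) / rho x θ)) r
      - 2 * (rho x θ ^ 2 * (1 - (inner ℝ x (θ : EuclideanSpace ℝ (Fin N)) / rho x θ) ^ 2)) ^ (-β)) * r ^ (-1 - α)) (by
      intro r hr
      simp only
      rw [ray_integrand hN hθ hr, DD_ray hx hθ]) measurableSet_Ioi
  rw [← KK_rho hx hθ, ← oneD hα hα2 hβ1 hβ s1 h0 hI]
  refine setIntegral_congr_fun measurableSet_Ioi ?_
  intro r hr
  simp only
  rw [ray_integrand hN hθ hr, DD_ray hx hθ]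

theorem rho_int (hN : 3 ≤ N) (hα : 0 < α) (hα2 : α < 2) : ∃ c0 S : ℝ, 0 < c0 ∧ c0 ≤ S ∧
    ∀ x : EuclideanSpace ℝ (Fin N), ‖x‖ < 1 →
      Integrable (fun θ : sphere (0 : EuclideanSpace ℝ (Fin N)) 1 => rho x θ ^ α)
        (volume : Measure (EuclideanSpace ℝ (Fin N))).toSphere ∧
      c0 ≤ ∫ θ : sphere (0 : EuclideanSpace ℝ (Fin N)) 1, rho x θ ^ α
        ∂(volume : Measure (EuclideanSpace ℝ (Fin N))).toSphere ∧
      ∫ θ : sphere (0 : EuclideanSpace ℝ (Fin N)) 1, rho x θ ^ α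
        ∂(volume : Measure (EuclideanSpace ℝ (Fin N))).toSphere ≤ S := by
  haveI : Nonempty (Fin N) := ⟨⟨0, by omega⟩⟩
  set σ := (volume : Measure (EuclideanSpace ℝ (Fin N))).toSphere with hσ
  set c1 : ℝ := Measure.toSphereBallBound (Module.finrank ℝ (EuclideanSpace ℝ (Fin N))) 1 *
    (volume : Measure (EuclideanSpace ℝ (Fin N))).real (ball 0 1) with hc1
  have hc1pos : 0 < c1 := by
    have a := Measure.toSphereBallBound_pos (Module.finrank ℝ (EuclideanSpace ℝ (Fin N))) 1
    have b : 0 < (volume : Measure (EuclideanSpace ℝ (Fin N))).real (ball 0 1) := by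
      refine ENNReal.toReal_pos (measure_ball_pos _ _ one_pos).ne' measure_ball_lt_top.ne
    have a' : (0:ℝ) < Measure.toSphereBallBound (Module.finrank ℝ (EuclideanSpace ℝ (Fin N))) 1 := by
      exact_mod_cast a
    positivity
  have hball : ∀ e : sphere (0 : EuclideanSpace ℝ (Fin N)) 1, c1 ≤ σ.real (ball e 1) := fun e =>
    Measure.toSphereBallBound_mul_measureReal_unitBall_le_toSphere_ball volume one_pos e
  have main : ∀ x : EuclideanSpace ℝ (Fin N), ‖x‖ < 1 →
      Integrable (fun θ : sphere (0 : EuclideanSpace ℝ (Fin N)) 1 => rho x θ ^ α) σ ∧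
      c1 / 4 ≤ ∫ θ : sphere (0 : EuclideanSpace ℝ (Fin N)) 1, rho x θ ^ α ∂σ ∧
      ∫ θ : sphere (0 : EuclideanSpace ℝ (Fin N)) 1, rho x θ ^ α ∂σ ≤ σ.real univ := by
    intro x hx
    have hn : ∀ θ : sphere (0 : EuclideanSpace ℝ (Fin N)) 1, ‖(θ : EuclideanSpace ℝ (Fin N))‖ = 1 := by
      intro θ; simpa using θ.2
    have hcont : Continuous (fun θ : sphere (0 : EuclideanSpace ℝ (Fin N)) 1 => rho x θ ^ α) := by
      unfold rho
      exact Continuous.rpow_const (by fun_prop) fun _ => Or.inr hα.le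
    have hle : ∀ θ : sphere (0 : EuclideanSpace ℝ (Fin N)) 1, rho x θ ^ α ≤ 1 := fun θ =>
      rpow_le_one (rho_facts hx (hn θ)).1.le (rho_facts hx (hn θ)).2.1 hα.le
    have hnn : ∀ θ : sphere (0 : EuclideanSpace ℝ (Fin N)) 1, 0 ≤ rho x θ ^ α := fun θ =>
      rpow_nonneg (rho_facts hx (hn θ)).1.le _
    have hIn1 : Integrable (fun θ : sphere (0 : EuclideanSpace ℝ (Fin N)) 1 => rho x θ ^ α) σ := by
      refine Integrable.of_bound hcont.aestronglyMeasurable 1 (Eventually.of_forall fun θ => ?_)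
      rw [norm_eq_abs, abs_of_nonneg (hnn θ)]; exact hle θ
    refine ⟨hIn1, ?_, ?_⟩
    · obtain ⟨e, he⟩ : ∃ e : sphere (0 : EuclideanSpace ℝ (Fin N)) 1,
          x = ‖x‖ • (e : EuclideanSpace ℝ (Fin N)) := by
        by_cases h0 : x = 0
        · obtain ⟨e, he⟩ := NormedSpace.sphere_nonempty (E := EuclideanSpace ℝ (Fin N)) (x := 0) (r := 1) |>.2
            zero_le_one
          exact ⟨⟨e, he⟩, by simp [h0]⟩
        · have hx0 : ‖x‖ ≠ 0 := norm_ne_zero_iff.2 h0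
          refine ⟨⟨‖x‖⁻¹ • x, ?_⟩, ?_⟩
          · simp [norm_smul, hx0]
          · simp [smul_smul, hx0]
      have hlow : ∀ θ ∈ ball e 1, (1:ℝ) / 4 ≤ rho x θ ^ α := by
        intro θ hθ
        obtain ⟨h0, h1, h2⟩ := rho_facts hx (hn θ)
        have hdist : ‖(θ : EuclideanSpace ℝ (Fin N)) - e‖ < 1 := by
          rw [mem_ball, Subtype.dist_eq, dist_eq_norm] at hθ; exact hθ
        have hin : 1 / 2 ≤ inner ℝ (e : EuclideanSpace ℝ (Fin N)) (θ : EuclideanSpace ℝ (Fin N)) := by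
          have := norm_sub_sq_real (θ : EuclideanSpace ℝ (Fin N)) e
          rw [hn, hn, real_inner_comm] at this
          have : ‖(θ : EuclideanSpace ℝ (Fin N)) - e‖ ^ 2 < 1 := by nlinarith [norm_nonneg ((θ : EuclideanSpace ℝ (Fin N)) - e)]
          linarith
        have hix : inner ℝ x (θ : EuclideanSpace ℝ (Fin N)) =
            ‖x‖ * inner ℝ (e : EuclideanSpace ℝ (Fin N)) (θ : EuclideanSpace ℝ (Fin N)) := by
          conv_lhs => rw [he]
          rw [inner_smul_left]; simp
        have hq : 1 / 4 ≤ rho x θ ^ 2 := by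
          rw [h2, hix, mul_pow]
          have : 1 / 4 ≤ (inner ℝ (e : EuclideanSpace ℝ (Fin N)) (θ : EuclideanSpace ℝ (Fin N))) ^ 2 := by nlinarith
          have hx1 : ‖x‖ ^ 2 ≤ 1 := by nlinarith [norm_nonneg x]
          nlinarith [sq_nonneg ‖x‖]
        refine hq.trans ?_
        rw [← rpow_natCast]
        exact rpow_le_rpow_of_exponent_ge h0 h1 (by push_cast; linarith)
      calc c1 / 4 ≤ σ.real (ball e 1) * (1 / 4) := by linarith [hball e]
        _ = ∫ θ in ball e 1, (1:ℝ) / 4 ∂σ := by simp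
        _ ≤ ∫ θ in ball e 1, rho x θ ^ α ∂σ :=
          setIntegral_mono_on (integrable_const _).integrableOn hIn1.integrableOn measurableSet_ball hlow
        _ ≤ _ := setIntegral_le_integral hIn1 (Eventually.of_forall hnn)
    · calc _ ≤ ∫ θ, (1:ℝ) ∂σ := integral_mono hIn1 (integrable_const _) hle
        _ = _ := by simp
  refine ⟨c1 / 4, σ.real univ, by positivity, ?_, main⟩
  have := main 0 (by simp)
  exact this.2.1.trans this.2.2

theorem final_bounds (hN : 3 ≤ N) (hα : 0 < α) (hα2 : α < 2) (hβ1 : -α / 2 < β) (hβ : β < 1) :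
    ∃ c₁ c₂ : ℝ, 0 < c₁ ∧ c₁ ≤ c₂ ∧ ∀ x : EuclideanSpace ℝ (Fin N), ‖x‖ < 1 →
      (0 ≤ α + 2 * β - 2 →
        c₁ * (α + 2 * β - 2) * (1 - ‖x‖ ^ 2) ^ (-(α + β)) ≤ (∫ z, DD β x z * WW α z) / 2 ∧
        (∫ z, DD β x z * WW α z) / 2 ≤ c₂ * (α + 2 * β - 2) * (1 - ‖x‖ ^ 2) ^ (-(α + β))) ∧
      (α + 2 * β - 2 ≤ 0 →
        c₂ * (α + 2 * β - 2) * (1 - ‖x‖ ^ 2) ^ (-(α + β)) ≤ (∫ z, DD β x z * WW α z) / 2 ∧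
        (∫ z, DD β x z * WW α z) / 2 ≤ c₁ * (α + 2 * β - 2) * (1 - ‖x‖ ^ 2) ^ (-(α + β))) := by
  obtain ⟨-, m, M, hm, hmM, hb⟩ := HH_bounds hα hα2 (by linarith : -2 < α + 2 * β - 2) (by linarith)
  obtain ⟨c0, S, hc0, hcS, hr⟩ := rho_int hN hα hα2
  refine ⟨m * c0, M * S, by positivity, by gcongr; linarith, ?_⟩
  intro x hx
  obtain ⟨G, iG, eG, hG⟩ := sphere_formula hN hα hα2 hβ1 hβ hx
  obtain ⟨iP, P1, P2⟩ := hr x hx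
  set κ := α + 2 * β - 2 with hκ
  set σ := (volume : Measure (EuclideanSpace ℝ (Fin N))).toSphere with hσ
  set P := ∫ θ : sphere (0 : EuclideanSpace ℝ (Fin N)) 1, rho x θ ^ α ∂σ with hP
  set D := (1 - ‖x‖ ^ 2) ^ (-(α + β)) with hD
  have hd0 : 0 < 1 - ‖x‖ ^ 2 := by nlinarith [norm_nonneg x]
  have hD0 : 0 < D := rpow_pos_of_pos hd0 _
  have hn : ∀ θ : sphere (0 : EuclideanSpace ℝ (Fin N)) 1, ‖(θ : EuclideanSpace ℝ (Fin N))‖ = 1 := by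
    intro θ; simpa using θ.2
  have up : ∀ K : ℝ, (∀ s, |s| < 1 → HH α κ s ≤ K) → (∫ θ, G θ ∂σ) / 2 ≤ K * D * P := by
    intro K hK
    have : ∫ θ, G θ ∂σ ≤ ∫ θ : sphere (0 : EuclideanSpace ℝ (Fin N)) 1, (2 * D * K) * rho x θ ^ α ∂σ := by
      refine integral_mono_ae iG (iP.const_mul _) ?_
      filter_upwards [eG] with θ hθ
      rw [hθ]
      have h1 := hK _ (s_facts hx (hn θ)).1
      have h2 : 0 ≤ 2 * (rho x θ ^ α * D) := by
        have := rpow_nonneg (rho_facts hx (hn θ)).1.le α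
        positivity
      calc _ ≤ 2 * (rho x θ ^ α * D) * K := mul_le_mul_of_nonneg_left h1 h2
        _ = _ := by ring
    rw [integral_const_mul, ← hP] at this
    linarith
  have lo : ∀ K : ℝ, (∀ s, |s| < 1 → K ≤ HH α κ s) → K * D * P ≤ (∫ θ, G θ ∂σ) / 2 := by
    intro K hK
    have : ∫ θ : sphere (0 : EuclideanSpace ℝ (Fin N)) 1, (2 * D * K) * rho x θ ^ α ∂σ ≤ ∫ θ, G θ ∂σ := by
      refine integral_mono_ae (iP.const_mul _) iG ?_
      filter_upwards [eG] with θ hθ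
      rw [hθ]
      have h1 := hK _ (s_facts hx (hn θ)).1
      have h2 : 0 ≤ 2 * (rho x θ ^ α * D) := by
        have := rpow_nonneg (rho_facts hx (hn θ)).1.le α
        positivity
      calc _ = 2 * (rho x θ ^ α * D) * K := by ring
        _ ≤ _ := mul_le_mul_of_nonneg_left h1 h2
    rw [integral_const_mul, ← hP] at this
    linarith
  rw [hG]
  have hM : 0 < M := by linarith
  have u1 : m * c0 ≤ m * P := by gcongr
  have u2 : M * P ≤ M * S := by gcongr
  constructor
  · intro hk
    have hkD : 0 ≤ κ * D := by positivity
    refine ⟨le_trans ?_ (lo (m * κ) fun s hs => ((hb s hs).1 hk).1),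
      (up (M * κ) fun s hs => ((hb s hs).1 hk).2).trans ?_⟩
    · nlinarith
    · nlinarith
  · intro hk
    have hkD : κ * D ≤ 0 := mul_nonpos_of_nonpos_of_nonneg hk hD0.le
    refine ⟨le_trans ?_ (lo (M * κ) fun s hs => ((hb s hs).2 hk).1),
      (up (m * κ) fun s hs => ((hb s hs).2 hk).2).trans ?_⟩
    · nlinarith
    · nlinarith
end

/-- two-sided bound for the fractional Laplacian of `(1-|x|²)^{-β}`. -/
theorem statement_0 (N : ℕ) (hN : 3 ≤ N) (α β : ℝ) (hα0 : 0 < α) (hα2 : α < 2)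
    (hβ1 : -α / 2 < β) (hβ2 : β < 1)
    (u : EN N → ℝ)
    (hu : ∀ x : EN N, u x = if ‖x‖ < 1 then (1 - ‖x‖ ^ 2) ^ (-β) else 0) :
    (∀ x : EN N, ‖x‖ < 1 → ∃ L, HasFracLap N α u x L) ∧
    ∃ c₁ c₂ : ℝ, 0 < c₁ ∧ c₁ ≤ c₂ ∧
      ∀ x : EN N, ‖x‖ < 1 →
        (0 ≤ α + 2 * β - 2 →
            c₁ * (α + 2 * β - 2) * (1 - ‖x‖ ^ 2) ^ (-(α + β)) ≤ fracLap N α u x ∧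
              fracLap N α u x ≤ c₂ * (α + 2 * β - 2) * (1 - ‖x‖ ^ 2) ^ (-(α + β))) ∧
        (α + 2 * β - 2 ≤ 0 →
            c₂ * (α + 2 * β - 2) * (1 - ‖x‖ ^ 2) ^ (-(α + β)) ≤ fracLap N α u x ∧
              fracLap N α u x ≤ c₁ * (α + 2 * β - 2) * (1 - ‖x‖ ^ 2) ^ (-(α + β))) := by
  have hu' : u = uu β := by
    ext x; rw [hu x]; rfl
  subst hu'
  have hc : 0 < fracLapCoeff N α := by
    unfold fracLapCoeff
    have h1 : 0 < Real.Gamma (((N : ℝ) + α) / 2) := Real.Gamma_pos_of_pos (by positivity)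
    have h2 : Real.Gamma (-α / 2) ≠ 0 := by
      refine Real.Gamma_ne_zero fun m hm => ?_
      rcases m with _ | m
      · push_cast at hm; linarith
      · push_cast at hm
        have : (0:ℝ) ≤ m := by positivity
        linarith
    have h3 : 0 < |Real.Gamma (-α / 2)| := abs_pos.2 h2
    have h4 : 0 < Real.pi := Real.pi_pos
    positivity
  have hL : ∀ x : EN N, ‖x‖ < 1 →
      HasFracLap N α (uu β) x (fracLapCoeff N α * ((∫ z, DD β x z * WW α z) / 2)) := fun x hx =>
    (PV_limit hN hα0 hα2 hβ2 hx).const_mul _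
  refine ⟨fun x hx => ⟨_, hL x hx⟩, ?_⟩
  have hv : ∀ x : EN N, ‖x‖ < 1 →
      fracLap N α (uu β) x = fracLapCoeff N α * ((∫ z, DD β x z * WW α z) / 2) := by
    intro x hx
    have hex : ∃ L, HasFracLap N α (uu β) x L := ⟨_, hL x hx⟩
    unfold fracLap
    rw [dif_pos hex]
    exact tendsto_nhds_unique hex.choose_spec (hL x hx)
  obtain ⟨c₁, c₂, h1, h2, hb⟩ := final_bounds (N := N) hN hα0 hα2 hβ1 hβ2
  refine ⟨fracLapCoeff N α * c₁, fracLapCoeff N α * c₂, by positivity, by gcongr, ?_⟩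
  intro x hx
  rw [hv x hx]
  simp only [mul_assoc (fracLapCoeff N α)]
  obtain ⟨b1, b2⟩ := hb x hx
  exact ⟨fun hk => ⟨mul_le_mul_of_nonneg_left (b1 hk).1 hc.le, mul_le_mul_of_nonneg_left (b1 hk).2 hc.le⟩,
    fun hk => ⟨mul_le_mul_of_nonneg_left (b2 hk).1 hc.le, mul_le_mul_of_nonneg_left (b2 hk).2 hc.le⟩⟩

end
end

section
/- Let λ < 1 + α/2 be a real number. Then for every x ∈ B, the integral ∫_B G_B^α(x,y) δ(y)^{−λ} dy is finite. -/
open MeasureTheory Real Filter Topology Metric Set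

noncomputable section

lemma aux_int (N : ℕ) (α c T : ℝ) (hc : 0 < c) (hcα : c < α / 2) (hN : α ≤ N) (hT : 0 ≤ T) :
    (∫ s in (0:ℝ)..T, s ^ (α / 2 - 1) * (1 + s) ^ (-(N : ℝ) / 2)) ≤ T ^ c / c := by
  have h1 : (∫ s in (0:ℝ)..T, s ^ (c - 1)) = T ^ c / c := by
    rw [integral_rpow (Or.inl (by linarith))]
    simp [Real.zero_rpow hc.ne']
  rw [← h1, intervalIntegral.integral_of_le hT, intervalIntegral.integral_of_le hT]
  apply MeasureTheory.integral_mono_of_nonneg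
  · filter_upwards [ae_restrict_mem measurableSet_Ioc] with s hs
    have := hs.1
    simp only [Pi.zero_apply]
    positivity
  · exact (intervalIntegral.intervalIntegrable_rpow' (by linarith) :
      IntervalIntegrable (fun s : ℝ => s ^ (c - 1)) volume 0 T).1
  · filter_upwards [ae_restrict_mem measurableSet_Ioc] with s hs
    have hs0 : 0 < s := hs.1
    have e1 : (1 + s) ^ (-(N : ℝ) / 2) ≤ (1 + s) ^ (c - α / 2) :=
      Real.rpow_le_rpow_of_exponent_le (by linarith) (by linarith)
    have e2 : (1 + s) ^ (c - α / 2) ≤ s ^ (c - α / 2) :=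
      Real.rpow_le_rpow_of_nonpos hs0 (by linarith) (by linarith)
    calc s ^ (α / 2 - 1) * (1 + s) ^ (-(N : ℝ) / 2)
        ≤ s ^ (α / 2 - 1) * s ^ (c - α / 2) :=
          mul_le_mul_of_nonneg_left (e1.trans e2) (by positivity)
      _ = s ^ (c - 1) := by rw [← Real.rpow_add hs0]; congr 1; ring

lemma aux_sing (N : ℕ) (hN : 3 ≤ N) (a : ℝ) (ha : 0 < a) (x : EN N) (hx : ‖x‖ < 1) :
    IntegrableOn (fun y : EN N => ‖x - y‖ ^ (a - (N : ℝ))) (Metric.ball (0 : EN N) 1) := by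
  have : Nonempty (Fin N) := ⟨⟨0, by omega⟩⟩
  have h0 : IntegrableOn (fun y : EN N => ‖y‖ ^ (a - (N : ℝ))) (Metric.ball (0 : EN N) 2) := by
    rw [integrableOn_fun_norm_addHaar volume (f := fun t : ℝ => t ^ (a - (N : ℝ)))]
    have : IntegrableOn (fun s : ℝ => s ^ (a - 1)) (Ioo 0 2) :=
      ((intervalIntegral.intervalIntegrable_rpow' (by linarith) :
        IntervalIntegrable (fun s : ℝ => s ^ (a - 1)) volume 0 2).1).mono_set Ioo_subset_Ioc_self
    refine this.congr_fun ?_ measurableSet_Ioo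
    intro s hs
    have hs0 : 0 < s := hs.1
    simp only [finrank_euclideanSpace, Fintype.card_fin, smul_eq_mul]
    rw [← Real.rpow_natCast, ← Real.rpow_add hs0, Nat.cast_sub (by omega)]
    congr 1; push_cast; ring
  have h1 : IntegrableOn (fun y : EN N => ‖y - x‖ ^ (a - (N : ℝ)))
      ((fun y => y - x) ⁻¹' Metric.ball (0 : EN N) 2) :=
    ((measurePreserving_sub_right volume x).integrableOn_comp_preimage
      (MeasurableEquiv.subRight x).measurableEmbedding).2 h0
  simp_rw [norm_sub_rev x]
  refine h1.mono_set ?_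
  intro y hy
  simp only [mem_ball, dist_zero_right, mem_preimage] at hy ⊢
  linarith [norm_sub_le y x]

lemma aux_bdry (N : ℕ) (hN : 3 ≤ N) (b : ℝ) (hb : -1 < b) :
    IntegrableOn (fun y : EN N => (1 - ‖y‖) ^ b) (Metric.ball (0 : EN N) 1) := by
  have : Nonempty (Fin N) := ⟨⟨0, by omega⟩⟩
  rw [integrableOn_fun_norm_addHaar volume (f := fun t : ℝ => (1 - t) ^ b)]
  have h : IntervalIntegrable (fun s : ℝ => (1 - s) ^ b) volume 0 1 := by
    have := (intervalIntegral.intervalIntegrable_rpow' hb :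
      IntervalIntegrable (fun s : ℝ => s ^ b) volume 0 1).comp_sub_left 1
    simpa using this.symm
  have h2 := h.continuousOn_mul
    (g := fun s : ℝ => s ^ (Module.finrank ℝ (EN N) - 1)) (by fun_prop)
  exact h2.1.mono_set Ioo_subset_Ioc_self

lemma aux_green (N : ℕ) (hN : 3 ≤ N) (α : ℝ) (hα0 : 0 < α) (hα2 : α < 2)
    (c : ℝ) (hc : 0 < c) (hcα : c < α / 2) (x y : EN N) (hx : ‖x‖ < 1) (hy : ‖y‖ < 1) :
    greenB N α x y ≤ |greenCoeff N α| * (2 ^ c / c) *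
      (‖x - y‖ ^ (α - 2 * c - (N : ℝ)) * (1 - ‖y‖) ^ c) := by
  have hN' : (3 : ℝ) ≤ N := by exact_mod_cast hN
  have hδ : 0 < 1 - ‖y‖ := by linarith
  have hR : 0 ≤ |greenCoeff N α| * (2 ^ c / c) *
      (‖x - y‖ ^ (α - 2 * c - (N : ℝ)) * (1 - ‖y‖) ^ c) := by positivity
  unfold greenB
  rw [if_pos ⟨hx, hy⟩]
  by_cases hxy : x = y
  · subst hxy
    simpa using hR
  have hd : 0 < ‖x - y‖ := norm_pos_iff.2 (sub_ne_zero.2 hxy)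
  set d := ‖x - y‖
  have hnx := norm_nonneg x
  have hny := norm_nonneg y
  set T := (1 - ‖x‖ ^ 2) * (1 - ‖y‖ ^ 2) / d ^ 2 with hTdef
  have hx2 : 0 ≤ 1 - ‖x‖ ^ 2 := by nlinarith
  have hy2 : 0 ≤ 1 - ‖y‖ ^ 2 := by nlinarith
  have hT : 0 ≤ T := by positivity
  have hT2 : T ≤ 2 * (1 - ‖y‖) * (d ^ (-2 : ℝ)) := by
    rw [hTdef, Real.rpow_neg hd.le, Real.rpow_two, div_eq_mul_inv]
    refine mul_le_mul_of_nonneg_right ?_ (by positivity)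
    calc (1 - ‖x‖ ^ 2) * (1 - ‖y‖ ^ 2) ≤ 1 * (1 - ‖y‖ ^ 2) :=
          mul_le_mul_of_nonneg_right (by nlinarith) hy2
      _ ≤ 2 * (1 - ‖y‖) := by nlinarith
  have hTc : T ^ c ≤ 2 ^ c * (1 - ‖y‖) ^ c * d ^ (-(2 * c)) := by
    refine (Real.rpow_le_rpow hT hT2 hc.le).trans (le_of_eq ?_)
    rw [Real.mul_rpow (by positivity) (by positivity), Real.mul_rpow (by positivity) hδ.le,
      ← Real.rpow_mul hd.le]
    congr 2; ring
  have hI := aux_int N α c T hc hcα (by linarith) hT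
  have hI0 : 0 ≤ ∫ s in (0:ℝ)..T, s ^ (α / 2 - 1) * (1 + s) ^ (-(N : ℝ) / 2) := by
    apply intervalIntegral.integral_nonneg hT
    intro s hs
    have := hs.1
    positivity
  calc _ ≤ |greenCoeff N α| * d ^ (α - (N : ℝ)) *
        ∫ s in (0:ℝ)..T, s ^ (α / 2 - 1) * (1 + s) ^ (-(N : ℝ) / 2) := by
        gcongr
        exact le_abs_self _
    _ ≤ |greenCoeff N α| * d ^ (α - (N : ℝ)) *
        (2 ^ c * (1 - ‖y‖) ^ c * d ^ (-(2 * c)) / c) := by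
        refine mul_le_mul_of_nonneg_left (hI.trans ?_) (by positivity)
        gcongr
    _ = _ := by
        have : d ^ (α - 2 * c - (N : ℝ)) = d ^ (α - (N : ℝ)) * d ^ (-(2 * c)) := by
          rw [← Real.rpow_add hd]; congr 1; ring
        rw [this]; ring

lemma aux_prod (N : ℕ) (hN : 3 ≤ N) (a b : ℝ) (haN : a ≤ N)
    (x y : EN N) (hx : ‖x‖ < 1) (hy : ‖y‖ < 1) :
    ‖x - y‖ ^ (a - (N : ℝ)) * (1 - ‖y‖) ^ b ≤
      (((1 - ‖x‖) / 2) ^ b + 1) * ‖x - y‖ ^ (a - (N : ℝ)) +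
        ((1 - ‖x‖) / 2) ^ (a - (N : ℝ)) * (1 - ‖y‖) ^ b := by
  have hδ : 0 < 1 - ‖y‖ := by linarith
  have hr : 0 < (1 - ‖x‖) / 2 := by linarith
  set r := (1 - ‖x‖) / 2 with hrdef
  have hu : 0 ≤ ‖x - y‖ ^ (a - (N : ℝ)) := by positivity
  have hv : 0 ≤ (1 - ‖y‖) ^ b := by positivity
  have hw : 0 ≤ r ^ (a - (N : ℝ)) := by positivity
  have hz : 0 ≤ r ^ b := by positivity
  rcases le_total r (‖x - y‖) with h | h
  · have : ‖x - y‖ ^ (a - (N : ℝ)) ≤ r ^ (a - (N : ℝ)) :=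
      Real.rpow_le_rpow_of_nonpos hr h (by linarith)
    nlinarith [mul_le_mul_of_nonneg_right this hv, mul_nonneg hz hu]
  · have h1 : r ≤ 1 - ‖y‖ := by
      have : ‖y‖ ≤ ‖x‖ + ‖x - y‖ := by
        have := norm_sub_le x (x - y)
        simpa using this
      linarith
    have : (1 - ‖y‖) ^ b ≤ r ^ b + 1 := by
      rcases le_total 0 b with hb | hb
      · have := Real.rpow_le_one hδ.le (by linarith [norm_nonneg y]) hb
        linarith
      · have := Real.rpow_le_rpow_of_nonpos hr h1 hb
        linarith
    nlinarith [mul_le_mul_of_nonneg_left this hu, mul_nonneg hw hv]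

/-- finiteness of `∫_B G_B^α(x,y) δ(y)^{-λ} dy`. -/
theorem statement_1 (N : ℕ) (hN : 3 ≤ N) (α : ℝ) (hα0 : 0 < α) (hα2 : α < 2)
    (lam : ℝ) (hlam : lam < 1 + α / 2) :
    ∀ x : EN N, ‖x‖ < 1 →
      (∫⁻ y in Metric.ball (0 : EN N) 1,
        ENNReal.ofReal (greenB N α x y * delta1 y ^ (-lam))) < ⊤ := by
  intro x hx
  have hN' : (3 : ℝ) ≤ N := by exact_mod_cast hN
  obtain ⟨c, hc1, hcα⟩ : ∃ c, max (lam - 1) 0 < c ∧ c < α / 2 :=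
    exists_between (max_lt (by linarith) (by linarith))
  have hc : 0 < c := (le_max_right _ _).trans_lt hc1
  have hcl : lam - 1 < c := (le_max_left _ _).trans_lt hc1
  set K := |greenCoeff N α| * (2 ^ c / c) with hK
  have hK0 : 0 ≤ K := by positivity
  have hint : IntegrableOn (fun y : EN N =>
      K * ((((1 - ‖x‖) / 2) ^ (c - lam) + 1) * ‖x - y‖ ^ (α - 2 * c - (N : ℝ)) +
        ((1 - ‖x‖) / 2) ^ (α - 2 * c - (N : ℝ)) * (1 - ‖y‖) ^ (c - lam)))
      (Metric.ball (0 : EN N) 1) :=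
    (((aux_sing N hN (α - 2 * c) (by linarith) x hx).const_mul _).add
      ((aux_bdry N hN (c - lam) (by linarith)).const_mul _)).const_mul _
  refine lt_of_le_of_lt ?_ hint.lintegral_lt_top
  refine setLIntegral_mono' measurableSet_ball ?_
  intro y hy
  have hy : ‖y‖ < 1 := by simpa using hy
  have hδ : 0 < 1 - ‖y‖ := by linarith
  apply ENNReal.ofReal_le_ofReal
  have hd : delta1 y = 1 - ‖y‖ := by simp [delta1, hy]
  rw [hd]
  calc greenB N α x y * (1 - ‖y‖) ^ (-lam)
      ≤ K * (‖x - y‖ ^ (α - 2 * c - (N : ℝ)) * (1 - ‖y‖) ^ c) * (1 - ‖y‖) ^ (-lam) :=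
        mul_le_mul_of_nonneg_right (aux_green N hN α hα0 hα2 c hc hcα x y hx hy) (by positivity)
    _ = K * (‖x - y‖ ^ (α - 2 * c - (N : ℝ)) * (1 - ‖y‖) ^ (c - lam)) := by
        rw [sub_eq_add_neg c lam, Real.rpow_add hδ]; ring
    _ ≤ _ := mul_le_mul_of_nonneg_left
        (aux_prod N hN (α - 2 * c) (c - lam) (by linarith) x y hx hy) hK0

end
end

section
/- Let λ < 1 + α/2 be a real number. Then the function h defined on B by h(x) = ∫_B G_B^α(x,y) δ(y)^{−λ} dy is continuous on B. -/
open MeasureTheory Real Filter Topology Metric Set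

noncomputable section

/-- Globally continuous version of the inner primitive. -/
def primF (N : ℕ) (α T : ℝ) : ℝ :=
  ∫ s in (0:ℝ)..T, s ^ (α / 2 - 1) * (1 + |s|) ^ (-(N : ℝ) / 2)

lemma primF_intble (N : ℕ) (α : ℝ) (hα0 : 0 < α) (a b : ℝ) :
    IntervalIntegrable (fun s : ℝ => s ^ (α / 2 - 1) * (1 + |s|) ^ (-(N : ℝ) / 2)) volume a b := by
  apply IntervalIntegrable.mul_continuousOn
  · exact intervalIntegral.intervalIntegrable_rpow' (by linarith)
  · apply Continuous.continuousOn
    apply Continuous.rpow_const (by fun_prop)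
    intro x
    left
    positivity

lemma primF_cont (N : ℕ) (α : ℝ) (hα0 : 0 < α) : Continuous (primF N α) :=
  intervalIntegral.continuous_primitive (primF_intble N α hα0) 0

lemma primF_nonneg (N : ℕ) (α T : ℝ) (hT : 0 ≤ T) : 0 ≤ primF N α T := by
  apply intervalIntegral.integral_nonneg hT
  intro s hs
  have := hs.1
  positivity

lemma primF_le (N : ℕ) (hN : 3 ≤ N) (α : ℝ) (hα0 : 0 < α) (hα2 : α < 2) (ε : ℝ) (hε : 0 < ε)
    (hε2 : ε ≤ α / 2) (T : ℝ) (hT : 0 ≤ T) : primF N α T ≤ T ^ ε / ε := by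
  have hN' : (3 : ℝ) ≤ N := by exact_mod_cast hN
  have h1 : ∫ s in (0:ℝ)..T, s ^ (ε - 1) = T ^ ε / ε := by
    rw [integral_rpow (Or.inl (by linarith))]
    simp [Real.zero_rpow hε.ne']
  rw [← h1]
  apply intervalIntegral.integral_mono_on_of_le_Ioo hT (primF_intble N α hα0 0 T)
    (intervalIntegral.intervalIntegrable_rpow' (by linarith))
  intro s hs
  have hs0 := hs.1
  rw [abs_of_pos hs0]
  calc s ^ (α / 2 - 1) * (1 + s) ^ (-(N : ℝ) / 2)
      ≤ s ^ (α / 2 - 1) * s ^ (-(α / 2 - ε)) := by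
        gcongr
        calc (1 + s) ^ (-(N : ℝ) / 2) ≤ (1 + s) ^ (-(α / 2 - ε)) :=
              Real.rpow_le_rpow_of_exponent_le (by linarith) (by linarith)
          _ ≤ s ^ (-(α / 2 - ε)) :=
              Real.rpow_le_rpow_of_nonpos hs0 (by linarith) (by linarith)
    _ = s ^ (ε - 1) := by
        rw [← Real.rpow_add hs0]; congr 1; ring

/-- The argument of the primitive. -/
def argT {N : ℕ} (x y : EN N) : ℝ := (1 - ‖x‖ ^ 2) * (1 - ‖y‖ ^ 2) / ‖x - y‖ ^ 2

lemma one_sub_sq_nonneg' {t : ℝ} (h0 : 0 ≤ t) (h : t < 1) : 0 ≤ 1 - t ^ 2 := by nlinarith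

lemma argT_nonneg {N : ℕ} (x y : EN N) (hx : ‖x‖ < 1) (hy : ‖y‖ < 1) : 0 ≤ argT x y := by
  have h1 := one_sub_sq_nonneg' (norm_nonneg x) hx
  have h2 := one_sub_sq_nonneg' (norm_nonneg y) hy
  unfold argT
  positivity

lemma greenB_eq (N : ℕ) (α : ℝ) (x y : EN N) (hx : ‖x‖ < 1) (hy : ‖y‖ < 1) :
    greenB N α x y = greenCoeff N α * ‖x - y‖ ^ (α - (N : ℝ)) * primF N α (argT x y) := by
  have h := argT_nonneg x y hx hy
  unfold greenB primF
  rw [if_pos ⟨hx, hy⟩]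
  congr 1
  apply intervalIntegral.integral_congr
  intro s hs
  have hs : s ∈ uIcc 0 (argT x y) := hs
  rw [uIcc_of_le h] at hs
  simp only
  rw [abs_of_nonneg hs.1]

lemma greenB_zero (N : ℕ) (α : ℝ) (x y : EN N) (hy : ¬ ‖y‖ < 1) : greenB N α x y = 0 := by
  unfold greenB
  rw [if_neg (fun h => hy h.2)]

lemma greenB_abs_le (N : ℕ) (hN : 3 ≤ N) (α : ℝ) (hα0 : 0 < α) (hα2 : α < 2) (ε : ℝ) (hε : 0 < ε)
    (hε2 : ε ≤ α / 2) (x y : EN N) (hx : ‖x‖ < 1) (hy : ‖y‖ < 1) (S : ℝ) (hS : argT x y ≤ S) :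
    |greenB N α x y| ≤ |greenCoeff N α| * ‖x - y‖ ^ (α - (N : ℝ)) * (S ^ ε / ε) := by
  have h := argT_nonneg x y hx hy
  rw [greenB_eq N α x y hx hy, abs_mul, abs_mul, abs_of_nonneg (primF_nonneg N α _ h),
    abs_of_nonneg (Real.rpow_nonneg (norm_nonneg (x - y)) _)]
  have := primF_le N hN α hα0 hα2 ε hε hε2 _ h
  have h3 : argT x y ^ ε ≤ S ^ ε := Real.rpow_le_rpow h hS hε.le
  have h4 : primF N α (argT x y) ≤ S ^ ε / ε := this.trans (by gcongr)
  gcongr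

lemma measurable_greenB (N : ℕ) (α : ℝ) (hα0 : 0 < α) (x : EN N) (hx : ‖x‖ < 1) :
    Measurable (fun y => greenB N α x y) := by
  have h : (fun y => greenB N α x y) = fun y => if ‖y‖ < 1 then
      greenCoeff N α * ‖x - y‖ ^ (α - (N : ℝ)) * primF N α (argT x y) else 0 := by
    funext y
    split_ifs with hy
    · exact greenB_eq N α x y hx hy
    · exact greenB_zero N α x y hy
  rw [h]
  apply Measurable.ite (measurableSet_lt measurable_norm measurable_const) _ measurable_const
  apply Measurable.mul (by fun_prop)
  apply (primF_cont N α hα0).measurable.comp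
  unfold argT
  fun_prop

lemma measurable_delta1 (N : ℕ) : Measurable (fun y : EN N => delta1 y) := by
  unfold delta1
  apply Measurable.ite (measurableSet_lt measurable_norm measurable_const) _ measurable_const
  fun_prop

/-- The integrand. -/
def kerK (N : ℕ) (α lam : ℝ) (x y : EN N) : ℝ := greenB N α x y * delta1 y ^ (-lam)

lemma measurable_kerK (N : ℕ) (α lam : ℝ) (hα0 : 0 < α) (x : EN N) (hx : ‖x‖ < 1) :
    Measurable (fun y => kerK N α lam x y) := by
  unfold kerK
  have := measurable_greenB N α hα0 x hx
  have := measurable_delta1 N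
  fun_prop

lemma kerK_eq (N : ℕ) (α lam : ℝ) (x y : EN N) (hx : ‖x‖ < 1) (hy : ‖y‖ < 1) :
    kerK N α lam x y = greenCoeff N α * ‖x - y‖ ^ (α - (N : ℝ)) * primF N α (argT x y)
      * (1 - ‖y‖) ^ (-lam) := by
  rw [kerK, greenB_eq N α x y hx hy, delta1, if_pos hy]

lemma kerK_zero (N : ℕ) (α lam : ℝ) (x y : EN N) (hy : ¬ ‖y‖ < 1) : kerK N α lam x y = 0 := by
  rw [kerK, greenB_zero N α x y hy, zero_mul]

/-- Joint continuity off the diagonal, along a continuous curve. -/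
lemma kerK_contAt (N : ℕ) (α lam : ℝ) (hα0 : 0 < α) (x0 : EN N) (g : EN N → EN N)
    (hg : Continuous g) (hx : ‖x0‖ < 1) (hy : ‖g x0‖ < 1) (hne : x0 ≠ g x0) :
    ContinuousAt (fun x => kerK N α lam x (g x)) x0 := by
  have hsub : ‖x0 - g x0‖ ≠ 0 := by rwa [norm_ne_zero_iff, sub_ne_zero]
  have e1 : ∀ᶠ x in 𝓝 x0, ‖x‖ < 1 := continuous_norm.continuousAt.eventually_lt_const hx
  have e2 : ∀ᶠ x in 𝓝 x0, ‖g x‖ < 1 := hg.norm.continuousAt.eventually_lt_const hy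
  have hc : ContinuousAt (fun x => greenCoeff N α * ‖x - g x‖ ^ (α - (N : ℝ)) *
      primF N α (argT x (g x)) * (1 - ‖g x‖) ^ (-lam)) x0 := by
    apply ContinuousAt.mul
    · apply ContinuousAt.mul
      · apply continuousAt_const.mul
        exact ContinuousAt.rpow_const (by fun_prop) (Or.inl hsub)
      · apply (primF_cont N α hα0).continuousAt.comp'
        unfold argT
        apply ContinuousAt.div (by fun_prop) (by fun_prop)
        exact pow_ne_zero 2 hsub
    · exact ContinuousAt.rpow_const (by fun_prop) (Or.inl (by linarith))
  apply hc.congr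
  filter_upwards [e1, e2] with x h1 h2
  exact (kerK_eq N α lam x (g x) h1 h2).symm

lemma intble_near (N : ℕ) (hN : 3 ≤ N) (p R C : ℝ) (hp : -(N : ℝ) < p) (hR : 0 < R) :
    Integrable (fun z : EN N => (ball (0 : EN N) R).indicator (fun z => C * ‖z‖ ^ p) z) := by
  have : Nontrivial (EN N) := by
    have : Nonempty (Fin N) := ⟨⟨0, by omega⟩⟩
    infer_instance
  rw [integrable_indicator_iff measurableSet_ball]
  apply Integrable.const_mul
  have := (integrableOn_fun_norm_addHaar (volume : Measure (EN N)) (f := fun t => t ^ p) (r := R))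
  refine this.2 ?_
  have h2 : IntegrableOn (fun y : ℝ => y ^ (p + (N - 1))) (Ioo 0 R) := by
    rw [intervalIntegral.integrableOn_Ioo_rpow_iff hR]
    linarith
  refine h2.congr_fun ?_ measurableSet_Ioo
  intro y hy
  simp only [finrank_euclideanSpace, Fintype.card_fin, smul_eq_mul]
  rw [← Real.rpow_natCast, ← Real.rpow_add hy.1, Nat.cast_sub (by omega)]
  congr 1
  push_cast
  ring

lemma intble_far (N : ℕ) (hN : 3 ≤ N) (q C : ℝ) (hq : -1 < q) :
    Integrable (fun z : EN N => (ball (0 : EN N) 1).indicator (fun z => C * (1 - ‖z‖) ^ q) z) := by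
  have : Nontrivial (EN N) := by
    have : Nonempty (Fin N) := ⟨⟨0, by omega⟩⟩
    infer_instance
  rw [integrable_indicator_iff measurableSet_ball]
  apply Integrable.const_mul
  have := (integrableOn_fun_norm_addHaar (volume : Measure (EN N)) (f := fun t => (1 - t) ^ q)
    (r := 1))
  refine this.2 ?_
  have h2 : IntervalIntegrable (fun y : ℝ => (1 - y) ^ q) volume 0 1 := by
    have := (intervalIntegral.intervalIntegrable_rpow' (a := 0) (b := 1) hq).comp_sub_left 1
    simpa using this.symm
  have h3 : IntervalIntegrable (fun y : ℝ => y ^ (Module.finrank ℝ (EN N) - 1) * (1 - y) ^ q)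
      volume 0 1 := h2.continuousOn_mul (by fun_prop)
  rw [intervalIntegrable_iff_integrableOn_Ioo_of_le zero_le_one] at h3
  exact h3

/-- Cutoff. -/
def cutψ (r t : ℝ) : ℝ := min 1 (max 0 (2 - t / r))

lemma cut_cont (r : ℝ) : Continuous (cutψ r) := by unfold cutψ; fun_prop
lemma cut_nonneg (r t : ℝ) : 0 ≤ cutψ r t := by unfold cutψ; positivity
lemma cut_le_one (r t : ℝ) : cutψ r t ≤ 1 := by unfold cutψ; exact min_le_left _ _
lemma cut_eq_zero (r t : ℝ) (hr : 0 < r) (h : 2 * r ≤ t) : cutψ r t = 0 := by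
  unfold cutψ
  have : 2 ≤ t / r := by rwa [le_div_iff₀ hr]
  rw [max_eq_left (by linarith)]; simp
lemma cut_eq_one (r t : ℝ) (hr : 0 < r) (h : t ≤ r) : cutψ r t = 1 := by
  unfold cutψ
  have : t / r ≤ 1 := by rwa [div_le_one hr]
  rw [max_eq_right (by linarith), min_eq_left (by linarith)]

lemma near_bound (N : ℕ) (hN : 3 ≤ N) (α : ℝ) (hα0 : 0 < α) (hα2 : α < 2) (lam r : ℝ)
    (hr : 0 < r) (x z : EN N) (hx : ‖x‖ ≤ 1 - 3 * r) :
    ‖cutψ r ‖z‖ * kerK N α lam x (x - z)‖ ≤ (ball (0 : EN N) (2 * r)).indicator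
      (fun z => (|greenCoeff N α| * (1 / (α / 4)) * (1 + r ^ (-lam))) * ‖z‖ ^ (α / 2 - N)) z := by
  by_cases hz : ‖z‖ < 2 * r
  swap
  · rw [cut_eq_zero r _ hr (not_lt.1 hz), zero_mul, norm_zero]
    apply indicator_nonneg
    intro z _
    positivity
  rw [indicator_of_mem (by simpa using hz)]
  have hx1 : ‖x‖ < 1 := by linarith
  have hy : ‖x - z‖ ≤ 1 - r := by
    have := norm_sub_le x z
    linarith
  have hy1 : ‖x - z‖ < 1 := by linarith
  rw [norm_mul, Real.norm_eq_abs, Real.norm_eq_abs, abs_of_nonneg (cut_nonneg _ _)]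
  refine (mul_le_of_le_one_left (abs_nonneg _) (cut_le_one _ _)).trans ?_
  by_cases hz0 : z = 0
  · subst hz0
    rw [kerK_eq N α lam _ _ hx1 hy1]
    have : primF N α (argT x (x - 0)) = 0 := by simp [argT, primF]
    rw [this]
    simp only [mul_zero, zero_mul, abs_zero]
    positivity
  have hzp : 0 < ‖z‖ := norm_pos_iff.2 hz0
  have hT : argT x (x - z) ≤ ‖z‖ ^ (-2 : ℝ) := by
    unfold argT
    have h1 := one_sub_sq_nonneg' (norm_nonneg x) hx1
    have h2 := one_sub_sq_nonneg' (norm_nonneg _) hy1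
    rw [sub_sub_cancel, Real.rpow_neg hzp.le, Real.rpow_two, ← one_div]
    gcongr
    apply mul_le_one₀ _ h2
    · nlinarith [norm_nonneg (x - z)]
    · nlinarith [norm_nonneg x]
  have hG := greenB_abs_le N hN α hα0 hα2 (α / 4) (by linarith) (by linarith) x (x - z) hx1 hy1 _ hT
  rw [sub_sub_cancel, ← Real.rpow_mul hzp.le] at hG
  have hd : delta1 (x - z) ^ (-lam) ≤ 1 + r ^ (-lam) := by
    rw [delta1, if_pos hy1]
    have ha : 0 < 1 - ‖x - z‖ := by linarith
    rcases le_total 0 lam with h | h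
    · have := Real.rpow_le_rpow_of_nonpos hr (show r ≤ 1 - ‖x - z‖ by linarith)
        (show -lam ≤ 0 by linarith)
      linarith
    · have := Real.rpow_le_one ha.le (by linarith [norm_nonneg (x - z)]) (show 0 ≤ -lam by linarith)
      have : 0 ≤ r ^ (-lam) := by positivity
      linarith
  have hd0 : 0 ≤ delta1 (x - z) ^ (-lam) := by
    apply Real.rpow_nonneg
    rw [delta1, if_pos hy1]
    linarith
  rw [kerK, abs_mul, abs_of_nonneg hd0]
  calc _ ≤ (|greenCoeff N α| * ‖z‖ ^ (α - (N : ℝ)) * (‖z‖ ^ (-2 * (α / 4)) / (α / 4)))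
        * (1 + r ^ (-lam)) := by gcongr
    _ = _ := by
      have : ‖z‖ ^ (α / 2 - N) = ‖z‖ ^ (α - (N : ℝ)) * ‖z‖ ^ (-2 * (α / 4)) := by
        rw [← Real.rpow_add hzp]; congr 1; ring
      rw [this]
      ring

lemma far_bound (N : ℕ) (hN : 3 ≤ N) (α : ℝ) (hα0 : 0 < α) (hα2 : α < 2) (lam r : ℝ)
    (hr : 0 < r) (x y : EN N) (hx : ‖x‖ ≤ 1 - 3 * r) :
    ‖(1 - cutψ r ‖x - y‖) * kerK N α lam x y‖ ≤ (ball (0 : EN N) 1).indicator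
      (fun y => (|greenCoeff N α| * r ^ (α - (N : ℝ)) * ((2 / r ^ 2) ^ (α / 2) / (α / 2)))
        * (1 - ‖y‖) ^ (α / 2 - lam)) y := by
  by_cases hy : ‖y‖ < 1
  swap
  · rw [kerK_zero _ _ _ _ _ hy, mul_zero, norm_zero, indicator_of_notMem (by simpa using hy)]
  rw [indicator_of_mem (by simpa using hy)]
  have hN' : (3 : ℝ) ≤ N := by exact_mod_cast hN
  have hx1 : ‖x‖ < 1 := by linarith
  have hδ : 0 < 1 - ‖y‖ := by linarith
  by_cases hz : ‖x - y‖ ≤ r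
  · rw [cut_eq_one r _ hr hz, sub_self, zero_mul, norm_zero]
    positivity
  push Not at hz
  rw [norm_mul, Real.norm_eq_abs, Real.norm_eq_abs,
    abs_of_nonneg (sub_nonneg.2 (cut_le_one r ‖x - y‖))]
  refine (mul_le_of_le_one_left (abs_nonneg _) (by linarith [cut_nonneg r ‖x - y‖])).trans ?_
  have hT : argT x y ≤ 2 / r ^ 2 * (1 - ‖y‖) := by
    unfold argT
    have h1 := one_sub_sq_nonneg' (norm_nonneg x) hx1
    have h2 := one_sub_sq_nonneg' (norm_nonneg _) hy
    rw [div_mul_eq_mul_div]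
    refine div_le_div₀ (by positivity) ?_ (by positivity) (by gcongr)
    calc (1 - ‖x‖ ^ 2) * (1 - ‖y‖ ^ 2) ≤ 1 * (1 - ‖y‖ ^ 2) := by
          gcongr; nlinarith [norm_nonneg x]
      _ ≤ 2 * (1 - ‖y‖) := by nlinarith [norm_nonneg y]
  have hG := greenB_abs_le N hN α hα0 hα2 (α / 2) (by linarith) le_rfl x y hx1 hy _ hT
  rw [Real.mul_rpow (by positivity) hδ.le] at hG
  have hp : ‖x - y‖ ^ (α - (N : ℝ)) ≤ r ^ (α - (N : ℝ)) :=
    Real.rpow_le_rpow_of_nonpos hr hz.le (by linarith)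
  rw [kerK, abs_mul, delta1, if_pos hy, abs_of_nonneg (Real.rpow_nonneg hδ.le (-lam))]
  calc _ ≤ (|greenCoeff N α| * ‖x - y‖ ^ (α - (N : ℝ)) *
          ((2 / r ^ 2) ^ (α / 2) * (1 - ‖y‖) ^ (α / 2) / (α / 2))) * (1 - ‖y‖) ^ (-lam) := by gcongr
    _ ≤ (|greenCoeff N α| * r ^ (α - (N : ℝ)) *
          ((2 / r ^ 2) ^ (α / 2) * (1 - ‖y‖) ^ (α / 2) / (α / 2))) * (1 - ‖y‖) ^ (-lam) := by gcongr
    _ = _ := by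
      rw [sub_eq_add_neg (α / 2) lam, Real.rpow_add hδ]
      ring

/-- continuity of `h(x) = ∫_B G_B^α(x,y) δ(y)^{-λ} dy` on `B`. -/
theorem statement_2 (N : ℕ) (hN : 3 ≤ N) (α : ℝ) (hα0 : 0 < α) (hα2 : α < 2)
    (lam : ℝ) (hlam : lam < 1 + α / 2) :
    ContinuousOn
      (fun x : EN N => ∫ y in Metric.ball (0 : EN N) 1, greenB N α x y * delta1 y ^ (-lam))
      (Metric.ball (0 : EN N) 1) := by
  intro x0 hx0
  apply ContinuousAt.continuousWithinAt
  have hx0' : ‖x0‖ < 1 := by simpa using hx0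
  have : Nontrivial (EN N) := by
    have : Nonempty (Fin N) := ⟨⟨0, by omega⟩⟩
    infer_instance
  set r : ℝ := (1 - ‖x0‖) / 4 with hrdef
  have hr : 0 < r := by linarith
  have ev : ∀ᶠ x in 𝓝 x0, ‖x‖ ≤ 1 - 3 * r := by
    have : ∀ᶠ x in 𝓝 x0, ‖x‖ < 1 - 3 * r :=
      continuous_norm.continuousAt.eventually_lt_const (by linarith)
    exact this.mono fun _ h => h.le
  have hI1 := intble_near N hN (α / 2 - N) (2 * r)
    (|greenCoeff N α| * (1 / (α / 4)) * (1 + r ^ (-lam))) (by linarith) (by linarith)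
  have hI2 := intble_far N hN (α / 2 - lam)
    (|greenCoeff N α| * r ^ (α - (N : ℝ)) * ((2 / r ^ 2) ^ (α / 2) / (α / 2))) (by linarith)
  have hm1 : ∀ x : EN N, ‖x‖ ≤ 1 - 3 * r →
      AEStronglyMeasurable (fun z => cutψ r ‖z‖ * kerK N α lam x (x - z)) volume := by
    intro x hx
    have h1 : Measurable fun z : EN N => kerK N α lam x (x - z) :=
      (measurable_kerK N α lam hα0 x (by linarith)).comp (by fun_prop)
    have h2 : Measurable fun z : EN N => cutψ r ‖z‖ := (cut_cont r).measurable.comp measurable_norm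
    exact (h2.mul h1).aestronglyMeasurable
  have hm2 : ∀ x : EN N, ‖x‖ ≤ 1 - 3 * r →
      AEStronglyMeasurable (fun y => (1 - cutψ r ‖x - y‖) * kerK N α lam x y) volume := by
    intro x hx
    have h1 : Measurable fun y : EN N => kerK N α lam x y :=
      measurable_kerK N α lam hα0 x (by linarith)
    have h2 : Measurable fun y : EN N => 1 - cutψ r ‖x - y‖ :=
      measurable_const.sub ((cut_cont r).measurable.comp (by fun_prop))
    exact (h2.mul h1).aestronglyMeasurable
  have c1 : ContinuousAt (fun x => ∫ z, cutψ r ‖z‖ * kerK N α lam x (x - z)) x0 := by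
    apply continuousAt_of_dominated (ev.mono hm1) _ hI1
    · filter_upwards [Measure.ae_ne volume (0 : EN N)] with z hz
      by_cases h : ‖z‖ < 2 * r
      · apply continuousAt_const.mul
        apply kerK_contAt N α lam hα0 x0 (fun x => x - z) (by fun_prop) hx0'
        · have := norm_sub_le x0 z
          linarith
        · intro h
          apply hz
          simpa using h.symm
      · simp only [cut_eq_zero r _ hr (not_lt.1 h), zero_mul]
        exact continuousAt_const
    · exact ev.mono fun x hx => Eventually.of_forall fun z =>
        near_bound N hN α hα0 hα2 lam r hr x z hx
  have c2 : ContinuousAt (fun x => ∫ y, (1 - cutψ r ‖x - y‖) * kerK N α lam x y) x0 := by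
    apply continuousAt_of_dominated (ev.mono hm2) _ hI2
    · filter_upwards [Measure.ae_ne volume x0] with y hy
      by_cases h : ‖y‖ < 1
      · apply ContinuousAt.mul
        · apply continuousAt_const.sub
          exact (cut_cont r).continuousAt.comp' (by fun_prop)
        · exact kerK_contAt N α lam hα0 x0 (fun _ => y) continuous_const hx0' h hy.symm
      · simp only [kerK_zero N α lam _ y h, mul_zero]
        exact continuousAt_const
    · exact ev.mono fun x hx => Eventually.of_forall fun y =>
        far_bound N hN α hα0 hα2 lam r hr x y hx
  apply (c1.add c2).congr
  filter_upwards [ev] with x hx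
  have i1 : Integrable (fun z => cutψ r ‖z‖ * kerK N α lam x (x - z)) :=
    hI1.mono' (hm1 x hx) (Eventually.of_forall fun z =>
      near_bound N hN α hα0 hα2 lam r hr x z hx)
  have i2 : Integrable (fun y => (1 - cutψ r ‖x - y‖) * kerK N α lam x y) :=
    hI2.mono' (hm2 x hx) (Eventually.of_forall fun y =>
      far_bound N hN α hα0 hα2 lam r hr x y hx)
  have i1' : Integrable (fun y => cutψ r ‖x - y‖ * kerK N α lam x y) := by
    have := i1.comp_sub_left x
    simpa using this
  have e1 : ∫ z, cutψ r ‖z‖ * kerK N α lam x (x - z)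
      = ∫ y, cutψ r ‖x - y‖ * kerK N α lam x y := by
    rw [← integral_sub_left_eq_self _ volume x]
    simp
  rw [Pi.add_apply, e1, ← integral_add i1' i2]
  rw [setIntegral_eq_integral_of_forall_compl_eq_zero]
  · apply integral_congr_ae
    refine Eventually.of_forall fun y => ?_
    simp only [kerK]
    ring
  · intro y hy
    rw [greenB_zero N α x y (by simpa using hy), zero_mul]

end
end

section
/- Let λ < 1 + α/2 be a real number and let h be defined on B by h(x) = ∫_B G_B^α(x,y) δ(y)^{−λ} dy. Then for every z ∈ ∂B, lim_{x→z, x∈B} δ(x)^{1−α/2} h(x) = 0. -/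
open MeasureTheory Real Filter Topology Metric Set

noncomputable section

/-- Truncated singular kernel. -/
def kern {E : Type*} [NormedAddCommGroup E] (p : ℝ) (v : E) : ENNReal :=
  (Metric.ball (0 : E) 2).indicator (fun v => ‖v‖ₑ ^ p) v

lemma kern_measurable {E : Type*} [NormedAddCommGroup E] [MeasurableSpace E] [BorelSpace E]
    (p : ℝ) : Measurable (kern p : E → ENNReal) := by
  unfold kern
  exact (measurable_enorm.pow_const p).indicator measurableSet_ball

lemma kern_lintegral {E : Type*} [NormedAddCommGroup E] [NormedSpace ℝ E] [MeasurableSpace E]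
    [BorelSpace E] [FiniteDimensional ℝ E] [Nontrivial E] (μ : Measure E) [μ.IsAddHaarMeasure]
    (p : ℝ) (hp : -(Module.finrank ℝ E : ℝ) < p) :
    ∫⁻ v, kern p v ∂μ < ⊤ := by
  have h1 : IntegrableOn (fun v : E => ‖v‖ ^ p) (Metric.ball 0 2) μ := by
    rw [integrableOn_fun_norm_addHaar μ (f := fun r => r ^ p) (r := 2)]
    have hd : 0 < Module.finrank ℝ E := Module.finrank_pos
    have h2 : IntegrableOn (fun y : ℝ => y ^ ((Module.finrank ℝ E : ℝ) - 1 + p)) (Ioo 0 2) := by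
      rw [intervalIntegral.integrableOn_Ioo_rpow_iff (by norm_num)]
      linarith
    refine h2.congr_fun ?_ measurableSet_Ioo
    intro y hy
    simp only [smul_eq_mul]
    rw [Real.rpow_add hy.1, ← Real.rpow_natCast, Nat.cast_sub hd]
    simp
  have h3 := h1.2
  unfold HasFiniteIntegral at h3
  unfold kern
  rw [lintegral_indicator measurableSet_ball]
  refine lt_of_eq_of_lt (lintegral_congr_ae ?_) h3
  have h0 : ∀ᵐ v ∂(μ.restrict (Metric.ball (0:E) 2)), v ≠ 0 :=
    ae_restrict_of_ae (by simp [ae_iff])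
  filter_upwards [h0] with v hv
  have hv' : 0 < ‖v‖ := norm_pos_iff.mpr hv
  rw [Real.enorm_eq_ofReal (by positivity), ← ENNReal.ofReal_rpow_of_pos hv', ofReal_norm]

lemma enn_rpow_anti {a b : ENNReal} (h : a ≤ b) {p : ℝ} (hp : p ≤ 0) : b ^ p ≤ a ^ p := by
  obtain ⟨q, rfl⟩ : ∃ q, p = -q := ⟨-p, by ring⟩
  rw [ENNReal.rpow_neg, ENNReal.rpow_neg]
  exact ENNReal.inv_le_inv.mpr (ENNReal.rpow_le_rpow h (by linarith))

lemma kern_of_lt {E : Type*} [NormedAddCommGroup E] {p : ℝ} {v : E} (h : ‖v‖ < 2) :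
    kern p v = ‖v‖ₑ ^ p := by
  unfold kern
  rw [indicator_of_mem]
  simpa using h

/-- Green bound on the radial integral. -/
lemma int_bound (N : ℕ) (hN : 3 ≤ N) (α : ℝ) (hα2 : α < 2) (β : ℝ) (hβ : 0 < β)
    (hβα : β ≤ α / 2) (T : ℝ) (hT : 0 ≤ T) :
    |∫ s in (0:ℝ)..T, s ^ (α / 2 - 1) * (1 + s) ^ (-(N : ℝ) / 2)| ≤ T ^ β / β := by
  have hN' : (3:ℝ) ≤ N := by exact_mod_cast hN
  have := intervalIntegral.norm_integral_le_of_norm_le (μ := volume) (a := 0) (b := T)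
    (f := fun s : ℝ => s ^ (α / 2 - 1) * (1 + s) ^ (-(N : ℝ) / 2)) (g := fun s => s ^ (β - 1)) hT
    (Eventually.of_forall ?_) (intervalIntegral.intervalIntegrable_rpow' (by linarith))
  · rw [integral_rpow (Or.inl (by linarith))] at this
    rw [Real.norm_eq_abs] at this
    refine this.trans (le_of_eq ?_)
    rw [sub_add_cancel, Real.zero_rpow hβ.ne', sub_zero]
  · intro t ht
    have ht0 := ht.1
    rw [Real.norm_of_nonneg (by positivity)]
    have e : t ^ (β - 1) = t ^ (α / 2 - 1) * t ^ (β - α / 2) := by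
      rw [← Real.rpow_add ht0]; ring_nf
    rw [e]
    gcongr
    calc (1 + t) ^ (-(N : ℝ) / 2) ≤ (1 + t) ^ (β - α / 2) :=
          Real.rpow_le_rpow_of_exponent_le (by linarith) (by linarith)
      _ ≤ t ^ (β - α / 2) := Real.rpow_le_rpow_of_nonpos ht0 (by linarith) (by linarith)

lemma green_bound (N : ℕ) (hN : 3 ≤ N) (α : ℝ) (hα2 : α < 2) (β : ℝ) (hβ : 0 < β)
    (hβα : β ≤ α / 2) (x y : EN N) (hx : ‖x‖ < 1) (hy : ‖y‖ < 1) :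
    |greenB N α x y| ≤ |greenCoeff N α| / β * (‖x - y‖ ^ (α - (N : ℝ)) *
      (4 * (1 - ‖x‖) * (1 - ‖y‖) / ‖x - y‖ ^ 2) ^ β) := by
  have hx0 := norm_nonneg x
  have hy0 := norm_nonneg y
  unfold greenB
  rw [if_pos ⟨hx, hy⟩, abs_mul, abs_mul, abs_of_nonneg (a := ‖x - y‖ ^ (α - (N : ℝ))) (by positivity)]
  have hX : 0 ≤ 1 - ‖x‖ ^ 2 := by nlinarith
  have hY : 0 ≤ 1 - ‖y‖ ^ 2 := by nlinarith
  have h1 := int_bound N hN α hα2 β hβ hβα ((1 - ‖x‖ ^ 2) * (1 - ‖y‖ ^ 2) / ‖x - y‖ ^ 2)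
    (by positivity)
  have h2 : ((1 - ‖x‖ ^ 2) * (1 - ‖y‖ ^ 2) / ‖x - y‖ ^ 2) ^ β ≤
      (4 * (1 - ‖x‖) * (1 - ‖y‖) / ‖x - y‖ ^ 2) ^ β := by
    have e1 : 1 - ‖x‖ ^ 2 ≤ 2 * (1 - ‖x‖) := by nlinarith
    have e2 : 1 - ‖y‖ ^ 2 ≤ 2 * (1 - ‖y‖) := by nlinarith
    have e3 : (1 - ‖x‖ ^ 2) * (1 - ‖y‖ ^ 2) ≤ 4 * (1 - ‖x‖) * (1 - ‖y‖) := by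
      calc _ ≤ (2 * (1 - ‖x‖)) * (2 * (1 - ‖y‖)) := mul_le_mul e1 e2 hY (by linarith)
        _ = _ := by ring
    gcongr
  calc _ ≤ |greenCoeff N α| * ‖x - y‖ ^ (α - (N : ℝ)) *
        ((4 * (1 - ‖x‖) * (1 - ‖y‖) / ‖x - y‖ ^ 2) ^ β / β) := by
        gcongr
        exact h1.trans (by gcongr)
    _ = _ := by ring

lemma far_real (α ε n d e r : ℝ) (hε : 0 < ε) (hε1 : ε < 1) (hd : 0 < d) (he : 0 < e) (hr : 0 < r)
    (hdr : d ≤ 2 * r) (her : e ≤ 3 * r) :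
    d ^ (1 - α / 2) * (r ^ (α - n) * (4 * d * e / r ^ 2) ^ (α / 2)) * e ^ (-(1 + α / 2 - 3 * ε))
      ≤ 4 ^ (α / 2) * 18 * d ^ ε * (e ^ (-(1 - ε)) * r ^ (1 + ε - n)) := by
  have e0 : (4 * d * e / r ^ 2) ^ (α / 2) = 4 ^ (α / 2) * d ^ (α / 2) * e ^ (α / 2) * r ^ (-α) := by
    rw [Real.div_rpow (by positivity) (by positivity), Real.mul_rpow (by positivity) he.le,
      Real.mul_rpow (by positivity) hd.le, ← Real.rpow_natCast r 2, ← Real.rpow_mul hr.le,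
      Real.rpow_neg hr.le]
    rw [show ((2:ℕ):ℝ) * (α / 2) = α by push_cast; ring]
    rfl
  have e1 : d ^ (1 - α / 2) * (r ^ (α - n) * (4 * d * e / r ^ 2) ^ (α / 2))
      * e ^ (-(1 + α / 2 - 3 * ε)) = 4 ^ (α / 2) * d ^ ε * (e ^ (-(1 - ε)) * r ^ (-n)) *
        (d ^ (1 - ε) * e ^ (2 * ε)) := by
    rw [e0]
    have a1 : d ^ (1 - α / 2) * d ^ (α / 2) = d ^ ε * d ^ (1 - ε) := by
      rw [← Real.rpow_add hd, ← Real.rpow_add hd]; ring_nf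
    have a2 : r ^ (α - n) * r ^ (-α) = r ^ (-n) := by
      rw [← Real.rpow_add hr]; ring_nf
    have a3 : e ^ (α / 2) * e ^ (-(1 + α / 2 - 3 * ε)) = e ^ (-(1 - ε)) * e ^ (2 * ε) := by
      rw [← Real.rpow_add he, ← Real.rpow_add he]; ring_nf
    linear_combination (r ^ (α - n) * r ^ (-α) * 4 ^ (α / 2) * (e ^ (α / 2) * e ^ (-(1 + α / 2 - 3 * ε)))) * a1
      + (d ^ ε * d ^ (1 - ε)) * 4 ^ (α / 2) * (e ^ (α / 2) * e ^ (-(1 + α / 2 - 3 * ε))) * a2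
      + (d ^ ε * d ^ (1 - ε)) * 4 ^ (α / 2) * r ^ (-n) * a3
  have e2 : d ^ (1 - ε) ≤ 2 * r ^ (1 - ε) := by
    calc d ^ (1 - ε) ≤ (2 * r) ^ (1 - ε) := Real.rpow_le_rpow hd.le hdr (by linarith)
      _ = 2 ^ (1 - ε) * r ^ (1 - ε) := Real.mul_rpow (by norm_num) hr.le
      _ ≤ 2 ^ (1:ℝ) * r ^ (1 - ε) := by gcongr <;> linarith
      _ = _ := by rw [Real.rpow_one]
  have e3 : e ^ (2 * ε) ≤ 9 * r ^ (2 * ε) := by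
    calc e ^ (2 * ε) ≤ (3 * r) ^ (2 * ε) := Real.rpow_le_rpow he.le her (by linarith)
      _ = 3 ^ (2 * ε) * r ^ (2 * ε) := Real.mul_rpow (by norm_num) hr.le
      _ ≤ 3 ^ (2:ℝ) * r ^ (2 * ε) := by gcongr <;> linarith
      _ = _ := by norm_num
  rw [e1]
  calc _ ≤ 4 ^ (α / 2) * d ^ ε * (e ^ (-(1 - ε)) * r ^ (-n)) * ((2 * r ^ (1 - ε)) * (9 * r ^ (2 * ε))) := by
        gcongr
    _ = 4 ^ (α / 2) * 18 * d ^ ε * (e ^ (-(1 - ε)) * (r ^ (-n) * r ^ (1 - ε) * r ^ (2 * ε))) := by ring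
    _ = _ := by
        rw [← Real.rpow_add hr, ← Real.rpow_add hr]; ring_nf

lemma near_real (α ε n d e r : ℝ) (hε : 0 < ε) (hεα : 6 * ε ≤ α) (hα2 : α < 2) (hd : 0 < d)
    (hd1 : d ≤ 1) (he : 0 < e) (hr : 0 < r) (hdr : 2 * r ≤ d) (hde : d ≤ 2 * e) (hed : e ≤ 2 * d) :
    d ^ (1 - α / 2) * (r ^ (α - n) * (4 * d * e / r ^ 2) ^ (ε / 2)) * e ^ (-(1 + α / 2 - 3 * ε))
      ≤ 32 * d ^ ε * r ^ (ε - n) := by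
  have e0 : (4 * d * e / r ^ 2) ^ (ε / 2) ≤ 8 * d ^ ε * r ^ (-ε) := by
    calc (4 * d * e / r ^ 2) ^ (ε / 2) ≤ (8 * (d ^ 2 / r ^ 2)) ^ (ε / 2) := by
          apply Real.rpow_le_rpow (by positivity) _ (by positivity)
          rw [← mul_div_assoc]
          gcongr ?_ / _
          nlinarith
      _ = 8 ^ (ε / 2) * (d ^ ε / r ^ ε) := by
          rw [Real.mul_rpow (by norm_num) (by positivity), Real.div_rpow (by positivity) (by positivity),
            ← Real.rpow_natCast r 2, ← Real.rpow_mul hr.le,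
            ← Real.rpow_natCast d 2, ← Real.rpow_mul hd.le]
          rw [show ((2:ℕ):ℝ) * (ε / 2) = ε by push_cast; ring]
      _ ≤ 8 ^ (1:ℝ) * (d ^ ε / r ^ ε) := by
          gcongr <;> linarith
      _ = _ := by rw [Real.rpow_one, Real.rpow_neg hr.le]; ring
  have e1 : e ^ (-(1 + α / 2 - 3 * ε)) ≤ 4 * d ^ (-(1 + α / 2 - 3 * ε)) := by
    calc e ^ (-(1 + α / 2 - 3 * ε)) ≤ (d / 2) ^ (-(1 + α / 2 - 3 * ε)) :=
          Real.rpow_le_rpow_of_nonpos (by linarith) (by linarith) (by linarith)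
      _ = 2 ^ (1 + α / 2 - 3 * ε) * d ^ (-(1 + α / 2 - 3 * ε)) := by
          rw [Real.div_rpow hd.le (by norm_num), Real.rpow_neg (by norm_num : (0:ℝ) ≤ 2)]
          field_simp
      _ ≤ 2 ^ (2:ℝ) * d ^ (-(1 + α / 2 - 3 * ε)) := by
          gcongr <;> linarith
      _ = _ := by norm_num
  have e2 : r ^ (α - 2 * ε) ≤ d ^ (α - 2 * ε) := Real.rpow_le_rpow hr.le (by linarith) (by linarith)
  have e3 : d ^ (2 * ε) ≤ d ^ ε := Real.rpow_le_rpow_of_exponent_ge hd hd1 (by linarith)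
  calc _ ≤ d ^ (1 - α / 2) * (r ^ (α - n) * (8 * d ^ ε * r ^ (-ε))) * (4 * d ^ (-(1 + α / 2 - 3 * ε))) := by
        gcongr
    _ = 32 * (d ^ (1 - α / 2) * d ^ ε * d ^ (-(1 + α / 2 - 3 * ε))) * (r ^ (α - n) * r ^ (-ε)) := by ring
    _ = 32 * d ^ (-α + 4 * ε) * (r ^ (α - 2 * ε) * r ^ (ε - n)) := by
        rw [← Real.rpow_add hd, ← Real.rpow_add hd, ← Real.rpow_add hr, ← Real.rpow_add hr]; ring_nf
    _ ≤ 32 * d ^ (-α + 4 * ε) * (d ^ (α - 2 * ε) * r ^ (ε - n)) := by gcongr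
    _ = 32 * d ^ (2 * ε) * r ^ (ε - n) := by
        have e4 : d ^ (-α + 4 * ε) * d ^ (α - 2 * ε) = d ^ (2 * ε) := by
          rw [← Real.rpow_add hd]; ring_nf
        rw [← e4]; ring
    _ ≤ _ := by gcongr

lemma kern_sub_meas {E : Type*} [NormedAddCommGroup E] [MeasurableSpace E] [BorelSpace E]
    [SecondCountableTopology E] (p : ℝ) (a : E) : Measurable fun v : E => kern p (a - v) :=
  (kern_measurable p).comp (measurable_const.sub measurable_id)

/-- Drop the `i`-th coordinate. -/
def dropc {n : ℕ} (i : Fin (n + 1)) (y : EN (n + 1)) : Fin n → ℝ := fun j => y (i.succAbove j)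

lemma slice {n : ℕ} (i : Fin (n + 1)) (p q : ℝ) (w₀ : Fin n → ℝ) (c : (Fin n → ℝ) → ℝ)
    (hc : Measurable c) :
    ∫⁻ y : EN (n + 1), kern p (w₀ - dropc i y) * kern q (c (dropc i y) - y i) =
      (∫⁻ w : Fin n → ℝ, kern p w) * ∫⁻ t : ℝ, kern q t := by
  let F : ℝ × (Fin n → ℝ) → ENNReal := fun z => kern p (w₀ - z.2) * kern q (c z.2 - z.1)
  have hF : Measurable F := by
    refine Measurable.mul ?_ ?_
    · exact (kern_measurable p).comp (measurable_const.sub measurable_snd)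
    · exact (kern_measurable q).comp ((hc.comp measurable_snd).sub measurable_fst)
  have hm := (volume_preserving_piFinSuccAbove (fun _ : Fin (n + 1) => ℝ) i).comp
    (PiLp.volume_preserving_ofLp (Fin (n + 1)))
  have h1 := hm.lintegral_comp hF
  have h2 : ∀ y : EN (n + 1), F ((⇑(MeasurableEquiv.piFinSuccAbove (fun _ => ℝ) i) ∘ WithLp.ofLp) y)
      = kern p (w₀ - dropc i y) * kern q (c (dropc i y) - y i) := fun y => rfl
  simp only [h2] at h1
  rw [h1]
  rw [Measure.volume_eq_prod, lintegral_prod_symm _ hF.aemeasurable]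
  have h3 : ∀ w : Fin n → ℝ, ∫⁻ t : ℝ, F (t, w) = kern p (w₀ - w) * ∫⁻ t : ℝ, kern q t := by
    intro w
    simp only [F]
    rw [lintegral_const_mul _ (kern_sub_meas q (c w)),
      lintegral_sub_left_eq_self (fun t => kern q t) (c w)]
  simp only [h3]
  rw [lintegral_mul_const _ (kern_sub_meas p w₀),
    lintegral_sub_left_eq_self (fun t => kern p t) w₀]

/-- half-height of the ball over `w` -/
def hgt {n : ℕ} (w : Fin n → ℝ) : ℝ := √(1 - ∑ j, w j ^ 2)

lemma hgt_measurable {n : ℕ} : Measurable (hgt : (Fin n → ℝ) → ℝ) := by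
  unfold hgt
  fun_prop

lemma normsq_split {n : ℕ} (i : Fin (n + 1)) (y : EN (n + 1)) :
    ‖y‖ ^ 2 = y i ^ 2 + ∑ j, dropc i y j ^ 2 := by
  rw [EuclideanSpace.real_norm_sq_eq, Fin.sum_univ_succAbove _ i]
  rfl

lemma dropc_norm_le {n : ℕ} (i : Fin (n + 1)) (y : EN (n + 1)) : ‖dropc i y‖ ≤ ‖y‖ := by
  rw [pi_norm_le_iff_of_nonneg (norm_nonneg _)]
  intro j
  exact PiLp.norm_apply_le y _

lemma delta_slice {n : ℕ} (i : Fin (n + 1)) (y : EN (n + 1)) (hy : ‖y‖ < 1) (c : ℝ) (hc0 : 0 < c)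
    (hc : c ≤ |y i|) (m : ℝ) (hm : 0 ≤ m) :
    ENNReal.ofReal ((1 - ‖y‖) ^ (-m)) ≤ ENNReal.ofReal ((c / 2) ^ (-m)) *
      (kern (-m) (hgt (dropc i y) - y i) + kern (-m) (-hgt (dropc i y) - y i)) := by
  have hs := normsq_split i y
  have hy0 := norm_nonneg y
  set s := hgt (dropc i y) with hsdef
  have hS : 0 ≤ ∑ j, dropc i y j ^ 2 := Finset.sum_nonneg fun _ _ => sq_nonneg _
  have hs0 : 0 ≤ s := Real.sqrt_nonneg _
  have hs2 : s ^ 2 = 1 - ∑ j, dropc i y j ^ 2 := by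
    rw [hsdef, hgt, Real.sq_sqrt]
    nlinarith [sq_nonneg (y i)]
  have hs1 : s ≤ 1 := by nlinarith
  have hts : |y i| < s := abs_lt_of_sq_lt_sq (by nlinarith) hs0
  have habs := sq_abs (y i)
  have hlow : (c / 2) * (s - |y i|) ≤ 1 - ‖y‖ := by
    have : (s - |y i|) * (s + |y i|) = 1 - ‖y‖ ^ 2 := by nlinarith
    have h2 : (s - |y i|) * c ≤ (s - |y i|) * (s + |y i|) := by
      apply mul_le_mul_of_nonneg_left <;> linarith
    nlinarith
  have h1 : (1 - ‖y‖) ^ (-m) ≤ (c / 2) ^ (-m) * (s - |y i|) ^ (-m) := by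
    rw [← Real.mul_rpow (by positivity) (by linarith)]
    exact Real.rpow_le_rpow_of_nonpos (mul_pos (by positivity) (by linarith)) hlow (by linarith)
  refine (ENNReal.ofReal_le_ofReal h1).trans ?_
  rw [ENNReal.ofReal_mul (by positivity)]
  gcongr
  have hpos : 0 < s - |y i| := by linarith
  rw [← ENNReal.ofReal_rpow_of_pos hpos]
  rcases le_total 0 (y i) with h | h
  · refine le_trans (le_of_eq ?_) le_self_add
    rw [abs_of_nonneg h] at *
    rw [kern_of_lt, Real.enorm_eq_ofReal hpos.le]
    rw [Real.norm_of_nonneg hpos.le]; linarith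
  · refine le_trans (le_of_eq ?_) le_add_self
    rw [abs_of_nonpos h] at *
    have e : ‖-s - y i‖ = s - -y i := by
      rw [Real.norm_of_nonpos (by linarith)]; ring
    rw [kern_of_lt, ← ofReal_norm, e]
    rw [e]; linarith

lemma coord_big {n : ℕ} (y : EN (n + 1)) (hy : 1 / 2 ≤ ‖y‖) :
    ∃ i, 1 / (2 * ((n : ℝ) + 1)) ≤ |y i| := by
  by_contra! h
  have hn : (0:ℝ) < (n : ℝ) + 1 := by positivity
  have h1 : ‖y‖ ^ 2 < ∑ i : Fin (n + 1), (1 / (2 * ((n : ℝ) + 1))) ^ 2 := by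
    rw [EuclideanSpace.real_norm_sq_eq]
    apply Finset.sum_lt_sum_of_nonempty Finset.univ_nonempty
    intro i _
    rw [← sq_abs]
    exact pow_lt_pow_left₀ (h i) (abs_nonneg _) two_ne_zero
  simp only [Finset.sum_const, Finset.card_univ, Fintype.card_fin, nsmul_eq_mul] at h1
  have h2 : ((n + 1 : ℕ) : ℝ) * (1 / (2 * ((n : ℝ) + 1))) ^ 2 ≤ 1 / 4 := by
    push_cast
    rw [show ((n:ℝ) + 1) * (1 / (2 * ((n : ℝ) + 1))) ^ 2 = 1 / (4 * ((n:ℝ) + 1)) by field_simp; norm_num]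
    apply one_div_le_one_div_of_le <;> nlinarith [Nat.cast_nonneg (α := ℝ) n]
  nlinarith

lemma K_pointwise {n : ℕ} (x y : EN (n + 1)) (hx : ‖x‖ < 1) (hy : ‖y‖ < 1) (m p : ℝ) (hm : 0 ≤ m)
    (hp : p ≤ 0) :
    ENNReal.ofReal ((1 - ‖y‖) ^ (-m)) * ‖x - y‖ₑ ^ p ≤
      ENNReal.ofReal ((1 / 2 : ℝ) ^ (-m)) * kern p (x - y) +
      ENNReal.ofReal ((1 / (2 * ((n : ℝ) + 1)) / 2) ^ (-m)) * ∑ i : Fin (n + 1),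
        (kern p (dropc i x - dropc i y) * kern (-m) (hgt (dropc i y) - y i) +
         kern p (dropc i x - dropc i y) * kern (-m) (-hgt (dropc i y) - y i)) := by
  have hxy : ‖x - y‖ < 2 := by linarith [norm_sub_le x y]
  by_cases h : 1 / 2 ≤ ‖y‖
  · refine le_trans ?_ le_add_self
    obtain ⟨i, hi⟩ := coord_big y h
    have h1 := delta_slice i y hy _ (by positivity) hi m hm
    have hd : dropc i x - dropc i y = dropc i (x - y) := rfl
    have hle : ‖dropc i x - dropc i y‖ ≤ ‖x - y‖ := hd ▸ dropc_norm_le i (x - y)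
    have h2 : ‖x - y‖ₑ ^ p ≤ kern p (dropc i x - dropc i y) := by
      rw [kern_of_lt (hle.trans_lt hxy)]
      apply enn_rpow_anti _ hp
      rw [← ofReal_norm, ← ofReal_norm]
      exact ENNReal.ofReal_le_ofReal hle
    refine (mul_le_mul' h1 h2).trans ?_
    rw [mul_assoc]
    gcongr
    refine le_trans (le_of_eq ?_) (Finset.single_le_sum (fun _ _ => zero_le) (Finset.mem_univ i))
    ring
  · refine le_trans ?_ le_self_add
    rw [kern_of_lt hxy]
    gcongr ?_ * _
    apply ENNReal.ofReal_le_ofReal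
    exact Real.rpow_le_rpow_of_nonpos (by norm_num) (by linarith) (by linarith)

lemma K_bound {n : ℕ} (hn : 1 ≤ n) (m p : ℝ) (hm : 0 ≤ m) (hm1 : m < 1) (hp : p ≤ 0)
    (hpn : -(n : ℝ) < p) :
    ∃ M : ENNReal, M < ⊤ ∧ ∀ x : EN (n + 1), ‖x‖ < 1 →
      ∫⁻ y in Metric.ball (0 : EN (n + 1)) 1,
        ENNReal.ofReal ((1 - ‖y‖) ^ (-m)) * ‖x - y‖ₑ ^ p ≤ M := by
  have : Nonempty (Fin n) := ⟨⟨0, hn⟩⟩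
  have f1 : ∫⁻ v : EN (n + 1), kern p v < ⊤ := kern_lintegral volume p (by simp; linarith)
  have f2 : ∫⁻ v : Fin n → ℝ, kern p v < ⊤ := kern_lintegral volume p (by simpa using hpn)
  have f3 : ∫⁻ v : ℝ, kern (-m) v < ⊤ := kern_lintegral volume (-m) (by simpa using hm1)
  refine ⟨ENNReal.ofReal ((1 / 2 : ℝ) ^ (-m)) * (∫⁻ v : EN (n + 1), kern p v) +
    ENNReal.ofReal ((1 / (2 * ((n : ℝ) + 1)) / 2) ^ (-m)) * ∑ _i : Fin (n + 1),
      ((∫⁻ w : Fin n → ℝ, kern p w) * (∫⁻ t : ℝ, kern (-m) t) +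
        (∫⁻ w : Fin n → ℝ, kern p w) * (∫⁻ t : ℝ, kern (-m) t)), ?_, ?_⟩
  · refine ENNReal.add_lt_top.mpr ⟨ENNReal.mul_lt_top ENNReal.ofReal_lt_top f1,
      ENNReal.mul_lt_top ENNReal.ofReal_lt_top (ENNReal.sum_lt_top.mpr fun i _ =>
        ENNReal.add_lt_top.mpr ⟨ENNReal.mul_lt_top f2 f3, ENNReal.mul_lt_top f2 f3⟩)⟩
  · intro x hx
    have md : ∀ i : Fin (n + 1), Measurable (dropc i) := by
      intro i
      unfold dropc
      fun_prop
    have mk : ∀ i : Fin (n + 1), Measurable fun y => kern p (dropc i x - dropc i y) := fun i =>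
      (kern_measurable p).comp (measurable_const.sub (md i))
    have ms : ∀ i : Fin (n + 1), Measurable fun y : EN (n + 1) =>
        kern (-m) (hgt (dropc i y) - y i) := fun i =>
      (kern_measurable (-m)).comp ((hgt_measurable.comp (md i)).sub (by fun_prop))
    have ms' : ∀ i : Fin (n + 1), Measurable fun y : EN (n + 1) =>
        kern (-m) (-hgt (dropc i y) - y i) := fun i =>
      (kern_measurable (-m)).comp ((hgt_measurable.comp (md i)).neg.sub (by fun_prop))
    have m1 : ∀ i : Fin (n + 1), Measurable fun y : EN (n + 1) =>
        kern p (dropc i x - dropc i y) * kern (-m) (hgt (dropc i y) - y i) :=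
      fun i => (mk i).mul (ms i)
    have m2 : ∀ i : Fin (n + 1), Measurable fun y : EN (n + 1) =>
        kern p (dropc i x - dropc i y) * kern (-m) (hgt (dropc i y) - y i) +
         kern p (dropc i x - dropc i y) * kern (-m) (-hgt (dropc i y) - y i) :=
      fun i => (m1 i).add ((mk i).mul (ms' i))
    calc _ ≤ ∫⁻ y in Metric.ball (0 : EN (n + 1)) 1, _ :=
          setLIntegral_mono' measurableSet_ball fun y hy =>
            K_pointwise x y hx (by simpa using hy) m p hm hp
      _ ≤ _ := setLIntegral_le_lintegral _ _
      _ = _ := by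
        rw [lintegral_add_left
            ((kern_sub_meas p x).const_mul _),
          lintegral_const_mul _ (kern_sub_meas p x),
          lintegral_sub_left_eq_self (fun t => kern p t) x,
          lintegral_const_mul _ (Finset.measurable_fun_sum _ fun i _ => m2 i),
          lintegral_finsetSum _ fun i _ => m2 i]
        congr 2
        refine Finset.sum_congr rfl fun i _ => ?_
        rw [lintegral_add_left (m1 i),
          slice i p (-m) (dropc i x) hgt hgt_measurable,
          slice i p (-m) (dropc i x) (fun w => -hgt w) hgt_measurable.neg]

lemma greenB_self (N : ℕ) (α : ℝ) (x : EN N) : greenB N α x x = 0 := by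
  unfold greenB
  split_ifs <;> simp

lemma final_pointwise (N : ℕ) (hN : 3 ≤ N) (α : ℝ) (hα0 : 0 < α) (hα2 : α < 2) (lam ε : ℝ)
    (hε : 0 < ε) (hεα : 6 * ε ≤ α) (hεl : lam ≤ 1 + α / 2 - 3 * ε) :
    ∃ C : ℝ, 0 ≤ C ∧ ∀ x y : EN N, ‖x‖ < 1 → ‖y‖ < 1 →
      ‖delta1 x ^ (1 - α / 2) * (greenB N α x y * delta1 y ^ (-lam))‖ₑ ≤
        ENNReal.ofReal (C * (1 - ‖x‖) ^ ε) *
          (ENNReal.ofReal ((1 - ‖y‖) ^ (-(1 - ε))) * ‖x - y‖ₑ ^ (1 + ε - (N : ℝ)) +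
            kern (ε - (N : ℝ)) (x - y)) := by
  set A := |greenCoeff N α| with hA
  have hA0 : 0 ≤ A := abs_nonneg _
  refine ⟨A / (α / 2) * (4 ^ (α / 2) * 18) + A / (ε / 2) * 32, by positivity, ?_⟩
  intro x y hx hy
  by_cases hxy : x = y
  · subst hxy
    simp [greenB_self]
  have hr : 0 < ‖x - y‖ := norm_pos_iff.mpr (sub_ne_zero.mpr hxy)
  have hr2 : ‖x - y‖ < 2 := by linarith [norm_sub_le x y]
  have hd : 0 < 1 - ‖x‖ := by linarith
  have he : 0 < 1 - ‖y‖ := by linarith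
  have hx0 := norm_nonneg x
  have hy0 := norm_nonneg y
  have t1 : ‖x‖ - ‖y‖ ≤ ‖x - y‖ := norm_sub_norm_le x y
  have t2 : ‖y‖ - ‖x‖ ≤ ‖x - y‖ := by rw [norm_sub_rev]; exact norm_sub_norm_le y x
  have dx : delta1 x = 1 - ‖x‖ := if_pos hx
  have dy : delta1 y = 1 - ‖y‖ := if_pos hy
  rw [dx, dy, kern_of_lt hr2, ← ofReal_norm (x - y), ENNReal.ofReal_rpow_of_pos hr,
    ENNReal.ofReal_rpow_of_pos hr, ← ENNReal.ofReal_mul (by positivity),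
    ← ENNReal.ofReal_add (by positivity) (by positivity), ← ENNReal.ofReal_mul (by positivity),
    ← ofReal_norm]
  apply ENNReal.ofReal_le_ofReal
  rw [norm_mul, norm_mul, Real.norm_of_nonneg (r := (1 - ‖x‖) ^ (1 - α / 2)) (by positivity),
    Real.norm_of_nonneg (r := (1 - ‖y‖) ^ (-lam)) (by positivity), Real.norm_eq_abs]
  have hl : (1 - ‖y‖) ^ (-lam) ≤ (1 - ‖y‖) ^ (-(1 + α / 2 - 3 * ε)) :=
    Real.rpow_le_rpow_of_exponent_ge he (by linarith) (by linarith)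
  have gen : ∀ β, 0 < β → β ≤ α / 2 →
      (1 - ‖x‖) ^ (1 - α / 2) * (|greenB N α x y| * (1 - ‖y‖) ^ (-lam)) ≤
      A / β * ((1 - ‖x‖) ^ (1 - α / 2) * (‖x - y‖ ^ (α - (N : ℝ)) *
      (4 * (1 - ‖x‖) * (1 - ‖y‖) / ‖x - y‖ ^ 2) ^ β) * (1 - ‖y‖) ^ (-(1 + α / 2 - 3 * ε))) := by
    intro β hβ hβα
    have hg := green_bound N hN α hα2 β hβ hβα x y hx hy
    calc _ ≤ (1 - ‖x‖) ^ (1 - α / 2) * ((A / β * (‖x - y‖ ^ (α - (N : ℝ)) *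
          (4 * (1 - ‖x‖) * (1 - ‖y‖) / ‖x - y‖ ^ 2) ^ β)) *
            (1 - ‖y‖) ^ (-(1 + α / 2 - 3 * ε))) := by gcongr
      _ = _ := by ring
  set P := (1 - ‖y‖) ^ (-(1 - ε)) * ‖x - y‖ ^ (1 + ε - (N : ℝ)) with hP
  set Q := ‖x - y‖ ^ (ε - (N : ℝ)) with hQ
  have hP0 : 0 ≤ P := by positivity
  have hQ0 : 0 ≤ Q := by positivity
  set D := (1 - ‖x‖) ^ ε with hD
  have hD0 : 0 ≤ D := by positivity
  have n1 : 0 ≤ A / (α / 2) * (4 ^ (α / 2) * 18) * D := by positivity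
  have n2 : 0 ≤ A / (ε / 2) * 32 * D := by positivity
  rcases le_total (1 - ‖x‖) (2 * ‖x - y‖) with h | h
  · refine (gen (α / 2) (by linarith) le_rfl).trans ?_
    have := far_real α ε N (1 - ‖x‖) (1 - ‖y‖) ‖x - y‖ hε (by linarith) hd he hr h (by linarith)
    refine (mul_le_mul_of_nonneg_left this (by positivity)).trans ?_
    rw [← hP, ← hD]
    nlinarith [mul_nonneg n1 hQ0, mul_nonneg n2 hQ0, mul_nonneg n2 hP0]
  · refine (gen (ε / 2) (by linarith) (by linarith)).trans ?_
    have := near_real α ε N (1 - ‖x‖) (1 - ‖y‖) ‖x - y‖ hε hεα hα2 hd (by linarith) he hr h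
      (by linarith) (by linarith)
    refine (mul_le_mul_of_nonneg_left this (by positivity)).trans ?_
    rw [← hQ, ← hD]
    nlinarith [mul_nonneg n1 hQ0, mul_nonneg n1 hP0, mul_nonneg n2 hP0]

/-- `δ(x)^{1-α/2} h(x) → 0` at every boundary point. -/
theorem statement_3 (N : ℕ) (hN : 3 ≤ N) (α : ℝ) (hα0 : 0 < α) (hα2 : α < 2)
    (lam : ℝ) (hlam : lam < 1 + α / 2) :
    ∀ z : EN N, ‖z‖ = 1 →
      Tendsto
        (fun x : EN N => delta1 x ^ (1 - α / 2) *
          ∫ y in Metric.ball (0 : EN N) 1, greenB N α x y * delta1 y ^ (-lam))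
        (𝓝[Metric.ball (0 : EN N) 1] z) (𝓝 0) := by
  intro z hz
  obtain ⟨n, rfl⟩ : ∃ n, N = n + 1 := ⟨N - 1, by omega⟩
  have hn : (2:ℝ) ≤ n := by exact_mod_cast (by omega : 2 ≤ n)
  obtain ⟨ε, hε, hεα, hεl⟩ : ∃ ε : ℝ, 0 < ε ∧ 6 * ε ≤ α ∧ lam ≤ 1 + α / 2 - 3 * ε := by
    refine ⟨min (α / 6) ((1 + α / 2 - lam) / 3), lt_min (by linarith) (by linarith), ?_, ?_⟩
    · linarith [min_le_left (α / 6) ((1 + α / 2 - lam) / 3)]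
    · linarith [min_le_right (α / 6) ((1 + α / 2 - lam) / 3)]
  obtain ⟨M, hM, hK⟩ := K_bound (n := n) (by omega) (1 - ε) (1 + ε - ((n + 1 : ℕ) : ℝ))
    (by linarith) (by linarith) (by push_cast; linarith) (by push_cast; linarith)
  have hM2 : ∫⁻ v : EN (n + 1), kern (ε - ((n + 1 : ℕ) : ℝ)) v < ⊤ :=
    kern_lintegral volume _ (by simp; linarith)
  obtain ⟨C, hC0, hC⟩ := final_pointwise (n + 1) hN α hα0 hα2 lam ε hε hεα hεl
  set M' := M + ∫⁻ v : EN (n + 1), kern (ε - ((n + 1 : ℕ) : ℝ)) v with hM'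
  have hM't : M' < ⊤ := ENNReal.add_lt_top.mpr ⟨hM, hM2⟩
  have key : ∀ x ∈ Metric.ball (0 : EN (n + 1)) 1,
      ‖delta1 x ^ (1 - α / 2) *
          ∫ y in Metric.ball (0 : EN (n + 1)) 1, greenB (n + 1) α x y * delta1 y ^ (-lam)‖ ≤
        C * (1 - ‖x‖) ^ ε * M'.toReal := by
    intro x hx
    have hx' : ‖x‖ < 1 := by simpa using hx
    have hd : 0 < 1 - ‖x‖ := by linarith
    rw [← integral_const_mul]
    have h1 : ‖∫ y in Metric.ball (0 : EN (n + 1)) 1,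
        delta1 x ^ (1 - α / 2) * (greenB (n + 1) α x y * delta1 y ^ (-lam))‖ₑ ≤
        ENNReal.ofReal (C * (1 - ‖x‖) ^ ε) * M' := by
      refine (enorm_integral_le_lintegral_enorm _).trans ?_
      calc _ ≤ ∫⁻ y in Metric.ball (0 : EN (n + 1)) 1, ENNReal.ofReal (C * (1 - ‖x‖) ^ ε) *
            (ENNReal.ofReal ((1 - ‖y‖) ^ (-(1 - ε))) * ‖x - y‖ₑ ^ (1 + ε - ((n + 1 : ℕ) : ℝ)) +
              kern (ε - ((n + 1 : ℕ) : ℝ)) (x - y)) :=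
            setLIntegral_mono' measurableSet_ball fun y hy => hC x y hx' (by simpa using hy)
        _ = ENNReal.ofReal (C * (1 - ‖x‖) ^ ε) * ((∫⁻ y in Metric.ball (0 : EN (n + 1)) 1,
            ENNReal.ofReal ((1 - ‖y‖) ^ (-(1 - ε))) * ‖x - y‖ₑ ^ (1 + ε - ((n + 1 : ℕ) : ℝ))) +
            ∫⁻ y in Metric.ball (0 : EN (n + 1)) 1, kern (ε - ((n + 1 : ℕ) : ℝ)) (x - y)) := by
            rw [lintegral_const_mul' _ _ ENNReal.ofReal_ne_top,
              lintegral_add_right _ (kern_sub_meas _ x)]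
        _ ≤ _ := by
            rw [hM']
            refine mul_le_mul_right (add_le_add (hK x hx') ?_) _
            · refine (setLIntegral_le_lintegral _ _).trans (le_of_eq ?_)
              exact lintegral_sub_left_eq_self (fun t => kern (ε - ((n + 1 : ℕ) : ℝ)) t) x
    have h2 := ENNReal.toReal_mono (ENNReal.mul_lt_top ENNReal.ofReal_lt_top hM't).ne h1
    rwa [toReal_enorm, ENNReal.toReal_mul, ENNReal.toReal_ofReal (by positivity)] at h2
  refine squeeze_zero_norm' (a := fun x : EN (n + 1) => C * (1 - ‖x‖) ^ ε * M'.toReal)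
    (eventually_nhdsWithin_of_forall key) ?_
  have hcont : Continuous fun x : EN (n + 1) => C * (1 - ‖x‖) ^ ε * M'.toReal := by
    have : Continuous fun x : EN (n + 1) => (1 - ‖x‖) ^ ε :=
      (continuous_const.sub continuous_norm).rpow_const fun _ => Or.inr hε.le
    fun_prop
  have h0 := (hcont.tendsto z).mono_left (nhdsWithin_le_nhds (s := Metric.ball 0 1))
  rw [hz, sub_self, Real.zero_rpow hε.ne'] at h0
  simpa using h0

end
end
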